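/- There exists a Hermitian O_L-lattice Λ_h of rank p-1 (a finitely generated O_L-module with positive definite L-Hermitian form h) satisfying Λ_h^* = (O_L^*)^{-1} Λ_h and admitting an O_L-linear isometry of order p fixing only 0, such that for every n ≥ 1 and every nonzero Hermitian matrix A ∈ L^{n×n}, the representation number R_A = |{(x₁,…,x_n) ∈ Λ_h^n : (h(x_i,x_j))_{i,j} = A}| is divisible by p. -/

import Mathlib

open NumberField
open IsDedekindDomain (HeightOneSpectrum)

lemma aux_prime (ℓ : ℕ) (hℓpos : 0 < ℓ) (p : ℕ) (hp : p.Prime) (hp1 : p % 4 = 1) (hpℓ : ¬ p ∣ ℓ) :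
    ∃ r : ℕ, r.Prime ∧ r % 4 = 3 ∧ ℓ < r ∧ p < r ∧ ℓ ∣ r + 1 ∧ IsSquare ((ℓ : ℕ) : ZMod r) ∧
      ¬ IsSquare ((p : ℕ) : ZMod r) ∧ ¬ IsSquare ((r : ℕ) : ZMod p) := by
  have : Fact p.Prime := ⟨hp⟩
  have hp2 : p ≠ 2 := by rintro rfl; omega
  obtain ⟨a, ha⟩ := FiniteField.exists_nonsquare (F := ZMod p) (by rw [ZMod.ringChar_zmod_n]; exact hp2)
  have hco : Nat.Coprime (4 * ℓ) p := by
    apply Nat.Coprime.symm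
    rw [hp.coprime_iff_not_dvd, hp.dvd_mul]
    rintro (h | h)
    · have := (Nat.dvd_prime_pow Nat.prime_two (m := 2)).1 h
      obtain ⟨m, hm, rfl⟩ := this
      interval_cases m <;> simp_all
    · exact hpℓ h
  obtain ⟨k, hk1, hk2⟩ := Nat.chineseRemainder hco (4 * ℓ - 1) a.val
  have hkco : k.Coprime (4 * ℓ * p) := by
    apply Nat.Coprime.mul_right
    · have : Nat.gcd k (4 * ℓ) = Nat.gcd (4 * ℓ - 1) (4 * ℓ) := hk1.gcd_eq
      rw [Nat.Coprime, this]
      have : Nat.Coprime (4 * ℓ - 1) (4 * ℓ - 1 + 1) := by simp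
      rwa [Nat.sub_add_cancel (by omega)] at this
    · apply Nat.Coprime.symm
      rw [hp.coprime_iff_not_dvd]
      intro h
      have h1 : (k : ZMod p) = 0 := (ZMod.natCast_eq_zero_iff _ _).2 h
      have h2 : (k : ZMod p) = a := by
        rw [(ZMod.natCast_eq_natCast_iff _ _ _).2 hk2]; simp
      apply ha; rw [← h2, h1]; exact ⟨0, by simp⟩
  obtain ⟨r, hr, hrp, hrk⟩ := Nat.forall_exists_prime_gt_and_modEq (4 * ℓ + p) (q := 4 * ℓ * p) (a := k)
    (by have := hp.pos; positivity) hkco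
  have : Fact r.Prime := ⟨hrp⟩
  have h1 : r ≡ 4 * ℓ - 1 [MOD 4 * ℓ] := (hrk.of_mul_right _).trans hk1
  have h2 : r ≡ a.val [MOD p] := (hrk.of_mul_left _).trans hk2
  have hr4 : r % 4 = 3 := by
    have : r ≡ 4 * ℓ - 1 [MOD 4] := h1.of_mul_right _
    have h3 : r % 4 = (4 * ℓ - 1) % 4 := this
    omega
  have hrnp : ¬ IsSquare ((r : ℕ) : ZMod p) := by
    have h2 : (r : ZMod p) = a := by
        rw [(ZMod.natCast_eq_natCast_iff _ _ _).2 h2]; simp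
    rwa [h2]
  have hr2 : r ≠ 2 := by rintro rfl; omega
  refine ⟨r, hrp, hr4, by omega, by omega, ?_, ?_, ?_, hrnp⟩
  · have : r + 1 ≡ 4 * ℓ - 1 + 1 [MOD 4 * ℓ] := h1.add_right 1
    rw [Nat.sub_add_cancel (by omega)] at this
    have h3 : r + 1 ≡ 0 [MOD 4 * ℓ] := this.trans (by simp [Nat.ModEq])
    exact (Dvd.intro_left 4 rfl).trans ((Nat.modEq_zero_iff_dvd).1 h3)
  · have h3 : jacobiSym ℓ r = 1 := by
      rw [jacobiSym.mod_right' ℓ (hrp.odd_of_ne_two hr2)]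
      have : r % (4 * ℓ) = 4 * ℓ - 1 := by
        have h4 : r % (4 * ℓ) = (4 * ℓ - 1) % (4 * ℓ) := h1
        rw [h4, Nat.mod_eq_of_lt (by omega)]
      rw [this]
      have ho : Odd (4 * ℓ - 1) := ⟨2 * ℓ - 1, by omega⟩
      have h5 : jacobiSym ((4 * ℓ : ℕ) : ℤ) (4 * ℓ - 1) = jacobiSym 1 (4 * ℓ - 1) := by
        rw [jacobiSym.mod_left, jacobiSym.mod_left 1]
        congr 1
        have : ((4 * ℓ : ℕ) : ℤ) = 1 + ((4 * ℓ - 1 : ℕ) : ℤ) := by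
          rw [Nat.cast_sub (by omega)]; push_cast; ring
        rw [this]; simp
      rw [jacobiSym.one_left] at h5
      push_cast at h5
      rw [jacobiSym.mul_left, jacobiSym.at_four ho, one_mul] at h5
      exact h5
    rw [← jacobiSym.legendreSym.to_jacobiSym, legendreSym.eq_one_iff'] at h3
    · exact h3
    · rw [Ne, ZMod.natCast_eq_zero_iff]
      intro h; have := Nat.le_of_dvd hℓpos h; omega
  · rw [ZMod.exists_sq_eq_prime_iff_of_mod_four_eq_one hp1 hr2] at hrnp
    exact hrnp

lemma aux_norm (ℓ r : ℕ) (hℓ : 0 < ℓ) (hr : r.Prime) (hℓr : ℓ < r) (h1 : ℓ ∣ r + 1)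
    (h2 : IsSquare ((ℓ : ℕ) : ZMod r)) :
    ∃ X Y : ℚ, X ^ 2 + r * Y ^ 2 = ℓ := by
  have : Fact r.Prime := ⟨hr⟩
  have : NeZero ℓ := ⟨hℓ.ne'⟩
  obtain ⟨u, hu⟩ := h2
  -- pigeonhole
  let A := Nat.sqrt (r * ℓ)
  let B := Nat.sqrt ℓ
  let C := Nat.sqrt r
  let f : Fin (A + 1) × Fin (B + 1) × Fin (C + 1) → ZMod ℓ × ZMod r := fun x =>
    (((x.1 : ℕ) : ZMod ℓ) - ((x.2.1 : ℕ) : ZMod ℓ), ((x.1 : ℕ) : ZMod r) - u * ((x.2.2 : ℕ) : ZMod r))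
  have hcard : Fintype.card (ZMod ℓ × ZMod r) <
      Fintype.card (Fin (A + 1) × Fin (B + 1) × Fin (C + 1)) := by
    simp only [Fintype.card_prod, ZMod.card, Fintype.card_fin]
    have hA := Nat.lt_succ_sqrt (r * ℓ)
    have hB := Nat.lt_succ_sqrt ℓ
    have hC := Nat.lt_succ_sqrt r
    change r * ℓ < (A + 1) * (A + 1) at hA
    change ℓ < (B + 1) * (B + 1) at hB
    change r < (C + 1) * (C + 1) at hC
    have : (ℓ * r) ^ 2 < ((A + 1) * ((B + 1) * (C + 1))) ^ 2 := by
      calc (ℓ * r) ^ 2 = (r * ℓ) * (ℓ * r) := by ring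
        _ < ((A + 1) * (A + 1)) * (((B + 1) * (B + 1)) * ((C + 1) * (C + 1))) :=
          Nat.mul_lt_mul'' hA (Nat.mul_lt_mul'' hB hC)
        _ = _ := by ring
    exact lt_of_pow_lt_pow_left₀ 2 (Nat.zero_le _) this
  obtain ⟨P, Q, hPQ, hf⟩ := Fintype.exists_ne_map_eq_of_card_lt f hcard
  obtain ⟨P1, P2, P3⟩ := P
  obtain ⟨Q1, Q2, Q3⟩ := Q
  simp only [f, Prod.mk.injEq] at hf
  obtain ⟨hf1, hf2⟩ := hf
  let x : ℤ := (P1 : ℕ) - (Q1 : ℕ)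
  let y : ℤ := (P2 : ℕ) - (Q2 : ℕ)
  let z : ℤ := (P3 : ℕ) - (Q3 : ℕ)
  have bnd : ∀ (m : ℕ) (i j : Fin (Nat.sqrt m + 1)), (((i : ℕ) : ℤ) - (j : ℕ)) ^ 2 ≤ m := by
    intro m i j
    have hi := i.2
    have hj := j.2
    have hm : Nat.sqrt m ^ 2 ≤ m := Nat.sqrt_le' m
    have : (((i : ℕ) : ℤ) - (j : ℕ)) ^ 2 ≤ ((Nat.sqrt m : ℕ) : ℤ) ^ 2 := by
      apply sq_le_sq.2
      rw [abs_le, Nat.abs_cast]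
      constructor <;> omega
    refine this.trans (by exact_mod_cast hm)
  have hx : x ^ 2 ≤ r * ℓ := by
    have := bnd (r * ℓ) P1 Q1
    rw [Nat.cast_mul] at this
    exact this
  have hy : y ^ 2 ≤ ℓ := bnd ℓ P2 Q2
  have hz : z ^ 2 ≤ r := bnd r P3 Q3
  have hz' : z ^ 2 ≠ r := by
    intro h
    have : IsSquare (r : ℤ) := ⟨z, by rw [← h]; ring⟩
    exact (Nat.prime_iff_prime_int.1 hr).irreducible.not_isSquare this
  have hne : ¬ (x = 0 ∧ y = 0 ∧ z = 0) := by
    rintro ⟨h1, h2, h3⟩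
    apply hPQ
    simp only [x, y, z] at h1 h2 h3
    ext <;> simp <;> omega
  have hxy : ((x : ℤ) : ZMod ℓ) = (y : ZMod ℓ) := by
    simp only [x, y]; push_cast; linear_combination hf1
  have hxz : ((x : ℤ) : ZMod r) = u * (z : ZMod r) := by
    simp only [x, z]; push_cast; linear_combination hf2
  set N : ℤ := x ^ 2 + r * y ^ 2 - ℓ * z ^ 2 with hN
  have hNℓ : (ℓ : ℤ) ∣ N := by
    rw [← ZMod.intCast_zmod_eq_zero_iff_dvd N ℓ]
    have hr1 : (r : ZMod ℓ) = -1 := by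
      have := (ZMod.natCast_eq_zero_iff (r + 1) ℓ).2 h1
      push_cast at this; linear_combination this
    simp only [hN]; push_cast
    rw [hxy, hr1]; simp
  have hNr : (r : ℤ) ∣ N := by
    rw [← ZMod.intCast_zmod_eq_zero_iff_dvd N r]
    simp only [hN]; push_cast
    rw [hxz, hu]; simp; ring
  have hcop : IsCoprime (ℓ : ℤ) (r : ℤ) := by
    rw [Nat.isCoprime_iff_coprime]
    exact (hr.coprime_iff_not_dvd.2 (fun h => by have := Nat.le_of_dvd hℓ h; omega)).symm
  obtain ⟨k, hk⟩ := hcop.mul_dvd hNℓ hNr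
  have hℓ' : (0 : ℤ) < ℓ := by exact_mod_cast hℓ
  have hr' : (0 : ℤ) < r := by exact_mod_cast hr.pos
  have hlow : -(ℓ * r : ℤ) < N := by
    have h3 : (ℓ : ℤ) * z ^ 2 < ℓ * r := by
      apply mul_lt_mul_of_pos_left _ hℓ'
      exact lt_of_le_of_ne hz hz'
    have : 0 ≤ x ^ 2 + r * y ^ 2 := by positivity
    linarith
  have hup : N ≤ 2 * (ℓ * r : ℤ) := by
    have : (r : ℤ) * y ^ 2 ≤ r * ℓ := by gcongr
    have : 0 ≤ (ℓ : ℤ) * z ^ 2 := by positivity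
    linarith
  have hpos : (0 : ℤ) < ℓ * r := by positivity
  have hk0 : -1 < k := by
    by_contra hc
    push Not at hc
    nlinarith
  have hk2 : k ≤ 2 := by
    by_contra hc
    push Not at hc
    nlinarith
  have hk3 : k ≠ 2 := by
    intro h2
    rw [h2] at hk
    have e1 : x ^ 2 + r * y ^ 2 = ℓ * r * 2 + ℓ * z ^ 2 := by linarith
    have e2 : (r : ℤ) * y ^ 2 ≤ r * ℓ := by gcongr
    have e3 : 0 ≤ (ℓ : ℤ) * z ^ 2 := by positivity
    have e4 : x ^ 2 = r * ℓ := by linarith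
    have : (r : ℤ) ∣ x ^ 2 := ⟨ℓ, e4⟩
    have hd : (r : ℤ) ∣ x := (Nat.prime_iff_prime_int.1 hr).dvd_of_dvd_pow this
    obtain ⟨w, hw⟩ := hd
    rw [hw] at e4
    have e5 : (r : ℤ) * w ^ 2 = ℓ := by
      apply mul_left_cancel₀ hr'.ne'; linarith
    have e6 : (r : ℤ) ∣ ℓ := ⟨w ^ 2, e5.symm⟩
    have := Int.le_of_dvd hℓ' e6
    have : (ℓ : ℤ) < r := by exact_mod_cast hℓr
    omega
  have hk01 : k = 0 ∨ k = 1 := by omega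
  have hrq : (0 : ℚ) < r := by exact_mod_cast hr.pos
  have hℓq : (0 : ℚ) < ℓ := by exact_mod_cast hℓ
  rcases hk01 with rfl | rfl
  · have e : (x : ℚ) ^ 2 + r * y ^ 2 = ℓ * z ^ 2 := by
      have : x ^ 2 + r * y ^ 2 = ℓ * z ^ 2 := by linarith
      exact_mod_cast this
    have hz0 : (z : ℚ) ≠ 0 := by
      intro h0
      rw [h0] at e
      apply hne
      have : (x : ℚ) = 0 := by nlinarith [sq_nonneg (x : ℚ), mul_nonneg hrq.le (sq_nonneg (y : ℚ))]
      have h3 : (r : ℚ) * y ^ 2 = 0 := by rw [this] at e; simpa using e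
      have h4 : (y : ℚ) = 0 := by
        rcases mul_eq_zero.1 h3 with h | h
        · exact absurd h hrq.ne'
        · exact pow_eq_zero_iff (two_ne_zero) |>.1 h
      exact ⟨by exact_mod_cast this, by exact_mod_cast h4, by exact_mod_cast h0⟩
    refine ⟨x / z, y / z, ?_⟩
    field_simp
    linarith
  · have e : (x : ℚ) ^ 2 + r * y ^ 2 = ℓ * (z ^ 2 + r) := by
      have : x ^ 2 + r * y ^ 2 = ℓ * (z ^ 2 + r) := by linarith
      exact_mod_cast this
    have hd : (z : ℚ) ^ 2 + r ≠ 0 := by positivity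
    refine ⟨(x * z + r * y) / (z ^ 2 + r), (y * z - x) / (z ^ 2 + r), ?_⟩
    field_simp
    linear_combination (z ^ 2 + r : ℚ) * e

section Gauss
open Polynomial

variable {r : ℕ} [Fact r.Prime]

/-- squares among the units mod r -/
noncomputable def gQ (r : ℕ) [Fact r.Prime] : Finset (ZMod r)ˣ :=
  Finset.univ.filter (fun u => quadraticChar (ZMod r) (u : ZMod r) = 1)

lemma gQ_mem (u : (ZMod r)ˣ) : u ∈ gQ r ↔ quadraticChar (ZMod r) (u : ZMod r) = 1 := by
  simp [gQ]

lemma gQ_dich (u : (ZMod r)ˣ) : quadraticChar (ZMod r) (u : ZMod r) = 1 ∨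
    quadraticChar (ZMod r) (u : ZMod r) = -1 :=
  quadraticChar_dichotomy u.ne_zero

lemma gQ_neg_one (hr : r % 4 = 3) : quadraticChar (ZMod r) (-1) = -1 := by
  rw [quadraticChar_neg_one (by rw [ZMod.ringChar_zmod_n]; rintro rfl; omega), ZMod.card,
    ZMod.χ₄_nat_three_mod_four hr]

lemma gQ_neg (hr : r % 4 = 3) (u : (ZMod r)ˣ) : quadraticChar (ZMod r) ((-u : (ZMod r)ˣ) : ZMod r) =
    - quadraticChar (ZMod r) (u : ZMod r) := by
  rw [Units.val_neg, ← neg_one_mul, map_mul, gQ_neg_one hr, neg_one_mul]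

lemma gQ_prod_mul_left {M : Type*} [CommMonoid M] (f : (ZMod r)ˣ → M) (b : (ZMod r)ˣ)
    (hb : quadraticChar (ZMod r) (b : ZMod r) = 1) :
    ∏ a ∈ gQ r, f (b * a) = ∏ a ∈ gQ r, f a := by
  refine Finset.prod_nbij (fun a => b * a) ?_ ?_ ?_ ?_
  · intro a ha
    rw [gQ_mem] at *
    rw [Units.val_mul, map_mul, hb, ha, one_mul]
  · intro a _ b _ h
    simpa using h
  · intro a ha
    refine ⟨b⁻¹ * a, ?_, by simp⟩
    have ha' : a ∈ gQ r := ha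
    have : b⁻¹ * a ∈ gQ r := by
      rw [gQ_mem] at *
      have h2 := congrArg (quadraticChar (ZMod r)) (show (b : ZMod r) * ((b⁻¹ * a : (ZMod r)ˣ) : ZMod r) = a by
        rw [← Units.val_mul, mul_inv_cancel_left])
      rw [map_mul, hb, one_mul, ha'] at h2
      exact h2
    exact this
  · intros; rfl

lemma gQ_prod_mul_left' (hr : r % 4 = 3) {M : Type*} [CommMonoid M] (f : (ZMod r)ˣ → M) (b : (ZMod r)ˣ)
    (hb : quadraticChar (ZMod r) (b : ZMod r) = -1) :
    ∏ a ∈ gQ r, f (b * a) = ∏ a ∈ gQ r, f (-a) := by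
  have := gQ_prod_mul_left (fun a => f (-a)) (-b) (by rw [gQ_neg hr, hb]; simp)
  simpa using this

lemma gQ_card (hr : r % 4 = 3) : (gQ r).card = (r - 1) / 2 := by
  have h1 : (Finset.univ.filter (fun u : (ZMod r)ˣ => ¬ quadraticChar (ZMod r) (u : ZMod r) = 1)).card
      = (gQ r).card := by
    refine Finset.card_nbij (fun a => -a) ?_ ?_ ?_
    · intro a ha
      simp only [Finset.coe_filter, Finset.mem_univ, true_and, Finset.mem_coe, gQ_mem] at *
      rw [gQ_neg hr]
      have ha : ¬ quadraticChar (ZMod r) (a : ZMod r) = 1 := ha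
      rcases gQ_dich a with h | h
      · exact absurd h ha
      · rw [h]; simp
    · intro a _ b _ h
      simpa using h
    · intro a ha
      refine ⟨-a, ?_, by simp⟩
      have ha' : a ∈ gQ r := ha
      rw [gQ_mem] at ha'
      simp only [Finset.coe_filter, Finset.mem_univ, true_and]
      change ¬ quadraticChar (ZMod r) ((-a : (ZMod r)ˣ) : ZMod r) = 1
      rw [gQ_neg hr, ha']; norm_num
  have h2 := Finset.card_filter_add_card_filter_not (s := (Finset.univ : Finset (ZMod r)ˣ))
    (fun u => quadraticChar (ZMod r) (u : ZMod r) = 1)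
  rw [h1, Finset.card_univ, ZMod.card_units r] at h2
  change (gQ r).card + _ = _ at h2
  omega

lemma gQ_card_odd (hr : r % 4 = 3) : Odd (gQ r).card := by
  rw [gQ_card hr, Nat.odd_iff]; omega

/-- the polynomial -/
noncomputable def gF {E : Type*} [Field E] (ψ : AddChar (ZMod r) E) : E[X] :=
  ∏ a ∈ gQ r, (C (ψ (a : ZMod r)) * X - C (ψ (-(a : ZMod r))))

/-- the conjugate polynomial -/
noncomputable def gF' {E : Type*} [Field E] (ψ : AddChar (ZMod r) E) : E[X] :=
  ∏ a ∈ gQ r, (C (ψ (-(a : ZMod r))) * X - C (ψ (a : ZMod r)))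

lemma gF_refl (hr : r % 4 = 3) {E : Type*} [Field E] (ψ : AddChar (ZMod r) E) (x : E) (hx : x ≠ 0) :
    x ^ (gQ r).card * (gF ψ).eval x⁻¹ = - (gF' ψ).eval x := by
  have h : (-1 : E) ^ (gQ r).card = -1 := (gQ_card_odd hr).neg_one_pow
  rw [gF, gF', eval_prod, eval_prod, ← Finset.prod_const, ← Finset.prod_mul_distrib,
    ← neg_one_mul, ← h, ← Finset.prod_const, ← Finset.prod_mul_distrib]
  refine Finset.prod_congr rfl fun a _ => ?_
  simp
  field_simp

lemma gF'_refl (hr : r % 4 = 3) {E : Type*} [Field E] (ψ : AddChar (ZMod r) E) (x : E) (hx : x ≠ 0) :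
    x ^ (gQ r).card * (gF' ψ).eval x⁻¹ = - (gF ψ).eval x := by
  have h := gF_refl hr ψ x⁻¹ (inv_ne_zero hx)
  rw [inv_inv] at h
  have h2 : (gF' ψ).eval x⁻¹ = - ((x⁻¹) ^ (gQ r).card * (gF ψ).eval x) := by rw [h, neg_neg]
  rw [h2, mul_neg, ← mul_assoc, ← mul_pow, mul_inv_cancel₀ hx, one_pow, one_mul]

lemma prod_units_sub {E : Type*} [Field E] (p : ℕ) [Fact p.Prime] (hp2 : p ≠ 2) (ζ : E)
    (hζ : IsPrimitiveRoot ζ p) (x y : E) :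
    (∏ u : (ZMod p)ˣ, (ζ ^ (u : ZMod p).val * x - y)) * (x - y) = x ^ p - y ^ p := by
  have hp : p.Prime := Fact.out
  have hodd : Odd p := hp.odd_of_ne_two hp2
  have h1 : ∏ k : ZMod p, (ζ ^ k.val * x - y) = x ^ p - y ^ p := by
    have h2 := hζ.pow_sub_pow_eq_prod_sub_mul y x hp.pos
    have h3 : ∏ μ ∈ nthRootsFinset p (1 : E), (y - μ * x) = ∏ k : ZMod p, (y - ζ ^ k.val * x) := by
      symm
      refine Finset.prod_nbij (fun k => ζ ^ k.val) ?_ ?_ ?_ ?_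
      · intro k _
        rw [mem_nthRootsFinset hp.pos, ← pow_mul, mul_comm, pow_mul, hζ.pow_eq_one, one_pow]
      · intro a _ b _ h
        exact ZMod.val_injective _ (hζ.pow_inj (ZMod.val_lt a) (ZMod.val_lt b) h)
      · intro μ hμ
        have hμ' : μ ∈ nthRootsFinset p (1 : E) := hμ
        rw [mem_nthRootsFinset hp.pos] at hμ'
        obtain ⟨i, hi, rfl⟩ := hζ.eq_pow_of_pow_eq_one hμ'
        exact ⟨(i : ZMod p), by simp, by simp [ZMod.val_natCast, Nat.mod_eq_of_lt hi]⟩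
      · intros; rfl
    have h4 : ∏ k : ZMod p, (ζ ^ k.val * x - y) = (-1) ^ p * ∏ k : ZMod p, (y - ζ ^ k.val * x) := by
      have : (-1 : E) ^ p = ∏ k : ZMod p, (-1 : E) := by simp
      rw [this, ← Finset.prod_mul_distrib]
      exact Finset.prod_congr rfl fun _ _ => by ring
    rw [h4, ← h3, ← h2, hodd.neg_one_pow]; ring
  rw [← h1, ← Finset.prod_erase_mul Finset.univ _ (Finset.mem_univ (0 : ZMod p))]
  congr 1
  · refine Finset.prod_nbij (fun u => (u : ZMod p)) ?_ ?_ ?_ ?_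
    · intro u _; simp
    · intro a _ b _ h; exact Units.ext h
    · intro k hk
      simp at hk
      exact ⟨Units.mk0 k hk, by simp, by simp⟩
    · intros; rfl
  · simp

lemma psi_ne (hr2 : r ≠ 2) {E : Type*} [Field E] (η : E) (hη : IsPrimitiveRoot η r) (a : (ZMod r)ˣ) :
    (AddChar.zmodChar r hη.pow_eq_one) (a : ZMod r) ≠
      (AddChar.zmodChar r hη.pow_eq_one) (-(a : ZMod r)) := by
  rw [AddChar.zmodChar_apply, AddChar.zmodChar_apply]
  intro h
  have := ZMod.val_injective _ (hη.pow_inj (ZMod.val_lt _) (ZMod.val_lt _) h)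
  have hr : r.Prime := Fact.out
  exact ZMod.ne_neg_self (hr.odd_of_ne_two hr2) a.ne_zero this

lemma gF_prod (hr : r % 4 = 3) {E : Type*} [Field E] (η : E) (hη : IsPrimitiveRoot η r)
    (p : ℕ) [Fact p.Prime] (hp2 : p ≠ 2) (ζ : E) (hζ : IsPrimitiveRoot ζ p) 
    (hpr : quadraticChar (ZMod r) (p : ZMod r) = -1) :
    ∏ u : (ZMod p)ˣ, (gF (AddChar.zmodChar r hη.pow_eq_one)).eval (ζ ^ (u : ZMod p).val) = -1 := by
  have hr2 : r ≠ 2 := by rintro rfl; omega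
  set ψ := AddChar.zmodChar r hη.pow_eq_one with hψ
  simp only [gF, eval_prod, eval_sub, eval_mul, eval_C, eval_X]
  rw [Finset.prod_comm]
  have hp0 : (p : ZMod r) ≠ 0 := by
    intro h; rw [h] at hpr; simp at hpr
  have hne : ∏ a ∈ gQ r, (ψ (a : ZMod r) - ψ (-(a : ZMod r))) ≠ 0 :=
    Finset.prod_ne_zero_iff.2 fun a _ => sub_ne_zero.2 (psi_ne hr2 η hη a)
  apply mul_right_cancel₀ hne
  rw [← Finset.prod_mul_distrib]
  have h1 : ∀ a ∈ gQ r, (∏ u : (ZMod p)ˣ, (ψ (a : ZMod r) * ζ ^ (u : ZMod p).val - ψ (-(a : ZMod r)))) *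
      (ψ (a : ZMod r) - ψ (-(a : ZMod r))) =
      (fun b : (ZMod r)ˣ => ψ (b : ZMod r) - ψ (-(b : ZMod r))) ((Units.mk0 (p : ZMod r) hp0) * a) := by
    intro a _
    have := prod_units_sub p hp2 ζ hζ (ψ (a : ZMod r)) (ψ (-(a : ZMod r)))
    simp only [mul_comm (ψ (a : ZMod r))]
    rw [this, ← AddChar.map_nsmul_eq_pow, ← AddChar.map_nsmul_eq_pow]
    simp
  rw [Finset.prod_congr rfl h1, gQ_prod_mul_left' hr (fun b : (ZMod r)ˣ => ψ (b : ZMod r) - ψ (-(b : ZMod r)))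
    (Units.mk0 (p : ZMod r) hp0) (by simpa using hpr)]
  have h : (-1 : E) ^ (gQ r).card = -1 := (gQ_card_odd hr).neg_one_pow
  rw [← h, ← Finset.prod_const, ← Finset.prod_mul_distrib]
  refine Finset.prod_congr rfl fun a _ => ?_
  simp

lemma gF_inv {E : Type*} [Field E] (η : E) (hη : IsPrimitiveRoot η r) :
    gF' (AddChar.zmodChar r hη.pow_eq_one) = gF (AddChar.zmodChar r hη.inv.pow_eq_one) := by
  have h : ∀ a : ZMod r, AddChar.zmodChar r hη.inv.pow_eq_one a =
      AddChar.zmodChar r hη.pow_eq_one (-a) := by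
    intro a
    rw [AddChar.map_neg_eq_inv, AddChar.zmodChar_apply, AddChar.zmodChar_apply, inv_pow]
  simp only [gF, gF', h, neg_neg]

lemma gF_rational (hr : r % 4 = 3) (E : Type*) [Field E] [CharZero E] [IsCyclotomicExtension {r} ℚ E]
    (η : E) (hη : IsPrimitiveRoot η r) :
    ∃ (G : E) (A B : ℚ[X]), G ^ 2 = -(r : E) ∧
      gF (AddChar.zmodChar r hη.pow_eq_one) = A.map (algebraMap ℚ E) + C G * B.map (algebraMap ℚ E) ∧
      gF' (AddChar.zmodChar r hη.pow_eq_one) = A.map (algebraMap ℚ E) - C G * B.map (algebraMap ℚ E) := by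
  have hrp : r.Prime := Fact.out
  have hr2 : r ≠ 2 := by rintro rfl; omega
  have : IsGalois ℚ E := IsCyclotomicExtension.isGalois {r} ℚ E
  have : FiniteDimensional ℚ E := IsCyclotomicExtension.finiteDimensional {r} ℚ E
  set ψ := AddChar.zmodChar r hη.pow_eq_one with hψ
  -- Galois action
  let b : (E ≃ₐ[ℚ] E) →* (ZMod r)ˣ := hη.autToPow ℚ
  have hbinj : Function.Injective b := hη.autToPow_injective ℚ
  have hbsurj : Function.Surjective b := by
    have hc : Nat.card (E ≃ₐ[ℚ] E) = Nat.card (ZMod r)ˣ :=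
      Nat.card_congr (IsCyclotomicExtension.autEquivPow E (cyclotomic.irreducible_rat hrp.pos)).toEquiv
    have : Finite (E ≃ₐ[ℚ] E) := inferInstance
    exact ((Nat.bijective_iff_injective_and_card b).2 ⟨hbinj, hc⟩).2
  have hact : ∀ (σ : E ≃ₐ[ℚ] E) (a : ZMod r), σ (ψ a) = ψ ((b σ : ZMod r) * a) := by
    intro σ a
    have h1 : σ η = ψ (b σ : ZMod r) := by
      rw [hψ, AddChar.zmodChar_apply]
      exact (hη.autToPow_spec ℚ σ).symm
    have h2 : ψ a = η ^ a.val := by rw [hψ, AddChar.zmodChar_apply]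
    rw [h2, map_pow, h1, ← AddChar.map_nsmul_eq_pow, nsmul_eq_mul, ZMod.natCast_val, ZMod.cast_id, mul_comm]
  obtain ⟨s, hs⟩ := hbsurj (-1)
  -- Gauss sum
  obtain ⟨G, hG⟩ : ∃ G : E, G ^ 2 = -(r : E) := by
    let χ : MulChar (ZMod r) E := (quadraticChar (ZMod r)).ringHomComp (Int.castRingHom E)
    have hχ1 : χ ≠ 1 := by
      intro h
      have h1 : χ (-1) = 1 := by rw [h]; exact MulChar.one_apply (by simp)
      have h2 : χ (-1) = -1 := by
        simp only [χ, MulChar.ringHomComp_apply, gQ_neg_one hr]; simp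
      rw [h1] at h2
      norm_num at h2
    have hχq : χ.IsQuadratic := (quadraticChar_isQuadratic (ZMod r)).comp _
    have := gaussSum_sq hχ1 hχq (AddChar.zmodChar_primitive_of_primitive_root r hη)
    refine ⟨_, this.trans ?_⟩
    simp only [χ, MulChar.ringHomComp_apply, gQ_neg_one hr, ZMod.card]; simp
  have hr0 : (r : E) ≠ 0 := by exact_mod_cast hrp.ne_zero
  have hG0 : G ≠ 0 := by
    rintro rfl
    apply hr0
    have : (r : E) = - (0 ^ 2) := by rw [hG]; ring
    rw [this]; simp
  have hpm : ∀ σ : E ≃ₐ[ℚ] E, σ G = G ∨ σ G = -G := by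
    intro σ
    apply sq_eq_sq_iff_eq_or_eq_neg.1
    rw [← map_pow, hG, map_neg, map_natCast]
  have hsqr : ∀ σ : E ≃ₐ[ℚ] E, quadraticChar (ZMod r) (b σ : ZMod r) = 1 → σ G = G := by
    intro σ h
    rw [quadraticChar_one_iff_isSquare (b σ).ne_zero] at h
    obtain ⟨e, he⟩ := h
    have he0 : e ≠ 0 := by
      rintro rfl; simp at he
    obtain ⟨t, ht⟩ := hbsurj (Units.mk0 e he0)
    have : σ = t * t := by
      apply hbinj
      rw [map_mul, ht]
      ext; simpa using he
    rw [this, AlgEquiv.mul_apply]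
    rcases hpm t with h | h <;> simp [h]
  have hdec : ∀ x : E, (∀ σ : E ≃ₐ[ℚ] E, quadraticChar (ZMod r) (b σ : ZMod r) = 1 → σ x = x) → s x = x →
      ∃ q : ℚ, algebraMap ℚ E q = x := by
    intro x h1 h2
    have : x ∈ (⊥ : IntermediateField ℚ E) := by
      rw [IsGalois.mem_bot_iff_fixed]
      intro f
      rcases gQ_dich (b f) with h | h
      · exact h1 f h
      · have h3 := h1 (f * s) (by rw [map_mul, hs]; simp only [mul_neg, mul_one]; rw [gQ_neg hr, h]; simp)
        rwa [AlgEquiv.mul_apply, h2] at h3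
    exact IntermediateField.mem_bot.1 this
  have hsG : s G = -G := by
    rcases hpm s with h | h
    · exfalso
      obtain ⟨q, hq⟩ := hdec G hsqr h
      rw [← hq, ← map_pow] at hG
      have h3 : q ^ 2 = - (r : ℚ) := by
        apply (algebraMap ℚ E).injective; rw [hG]; simp
      have : (0 : ℚ) < r := by exact_mod_cast hrp.pos
      nlinarith [sq_nonneg q]
    · exact h
  have hss : ∀ x, s (s x) = x := by
    intro x
    have : s * s = 1 := by apply hbinj; rw [map_mul, hs]; simp
    rw [← AlgEquiv.mul_apply, this]; rfl
  have hcomm : ∀ (σ : E ≃ₐ[ℚ] E) x, σ (s x) = s (σ x) := by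
    intro σ x
    have : σ * s = s * σ := by apply hbinj; rw [map_mul, map_mul, mul_comm]
    rw [← AlgEquiv.mul_apply, this]; rfl
  have hfix : ∀ x : E, (∀ σ : E ≃ₐ[ℚ] E, quadraticChar (ZMod r) (b σ : ZMod r) = 1 → σ x = x) →
      ∃ u v : ℚ, x = algebraMap ℚ E u + G * algebraMap ℚ E v ∧ s x = algebraMap ℚ E u - G * algebraMap ℚ E v := by
    intro x hx
    obtain ⟨u, hu⟩ := hdec (x + s x) (fun σ h => by rw [map_add, hcomm, hx σ h]) (by
      rw [map_add, hss, add_comm])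
    obtain ⟨v, hv⟩ := hdec ((x - s x) * G) (fun σ h => by rw [map_mul, map_sub, hcomm, hx σ h, hsqr σ h]) (by
      rw [map_mul, map_sub, hss, hsG]; ring)
    have key : G * (algebraMap ℚ E (v / (-(2 * r)))) = (x - s x) / 2 := by
      rw [map_div₀, hv]
      simp only [map_neg, map_mul, map_ofNat, map_natCast]
      field_simp
      rw [hG]; ring
    refine ⟨u / 2, v / (-(2 * r)), ?_, ?_⟩
    · rw [key, map_div₀, hu, map_ofNat]; ring
    · rw [key, map_div₀, hu, map_ofNat]; ring
  -- coefficients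
  have hFσ : ∀ σ : E ≃ₐ[ℚ] E, quadraticChar (ZMod r) (b σ : ZMod r) = 1 →
      (gF ψ).map (σ : E →+* E) = gF ψ := by
    intro σ h
    have h1 : (gF ψ).map (σ : E →+* E) = ∏ a ∈ gQ r,
      (fun a : (ZMod r)ˣ => (C (ψ (a : ZMod r)) * X - C (ψ (-(a : ZMod r))))) (b σ * a) := by
      simp only [gF, Polynomial.map_prod, Polynomial.map_sub, Polynomial.map_mul, map_C, map_X, RingHom.coe_coe, hact,
        Units.val_mul, mul_neg]
    rw [h1, gQ_prod_mul_left (fun a : (ZMod r)ˣ => (C (ψ (a : ZMod r)) * X - C (ψ (-(a : ZMod r))))) _ h]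
    rfl
  have hFs : (gF ψ).map (s : E →+* E) = gF' ψ := by
    simp only [gF, gF', Polynomial.map_prod, Polynomial.map_sub, Polynomial.map_mul, map_C, map_X, RingHom.coe_coe, hact,
        hs, Units.val_neg, Units.val_one, neg_mul, one_mul, neg_neg]
  have hcoef : ∀ n, ∃ u v : ℚ, (gF ψ).coeff n = algebraMap ℚ E u + G * algebraMap ℚ E v ∧
      s ((gF ψ).coeff n) = algebraMap ℚ E u - G * algebraMap ℚ E v := by
    intro n
    apply hfix
    intro σ h
    have := congrArg (fun P => P.coeff n) (hFσ σ h)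
    simpa using this
  choose u v hu hv using hcoef
  let N := (gF ψ).natDegree + 1
  refine ⟨G, ∑ i ∈ Finset.range N, C (u i) * X ^ i, ∑ i ∈ Finset.range N, C (v i) * X ^ i, hG, ?_, ?_⟩
  · rw [(gF ψ).as_sum_range_C_mul_X_pow]
    simp only [Polynomial.map_sum, Polynomial.map_mul, map_C, Polynomial.map_pow, map_X, Finset.mul_sum]
    rw [← Finset.sum_add_distrib]
    refine Finset.sum_congr rfl fun i _ => ?_
    rw [hu i]
    simp only [C_add, C_mul]; ring
  · rw [← hFs, (gF ψ).as_sum_range_C_mul_X_pow]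
    simp only [Polynomial.map_sum, Polynomial.map_mul, map_C, Polynomial.map_pow, map_X, Finset.mul_sum]
    rw [← Finset.sum_sub_distrib]
    refine Finset.sum_congr rfl fun i _ => ?_
    rw [RingHom.coe_coe, hv i]
    simp only [C_sub, C_mul]; ring

lemma gauss_main (hr : r % 4 = 3) (p : ℕ) [Fact p.Prime] (hp2 : p ≠ 2)
    (hpr : ¬ IsSquare (p : ZMod r)) (K : Type*) [Field K] [CharZero K] (ζ : K) (hζ : IsPrimitiveRoot ζ p) :
    ∃ (m : ℕ) (A B : ℚ[X]), (∀ x : K, x ≠ 0 → x ^ m * aeval x⁻¹ A = - aeval x A) ∧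
      (∀ x : K, x ≠ 0 → x ^ m * aeval x⁻¹ B = aeval x B) ∧
      ∏ u : (ZMod p)ˣ, (⟨aeval (ζ ^ (u : ZMod p).val) A, aeval (ζ ^ (u : ZMod p).val) B⟩ :
        QuadraticAlgebra K (-(r : K)) 0) = -1 := by
  have hrp : r.Prime := Fact.out
  have hpr' : quadraticChar (ZMod r) (p : ZMod r) = -1 := by
    rw [quadraticChar_neg_one_iff_not_isSquare]; exact hpr
  let E := AlgebraicClosure K
  let C₀ := CyclotomicField r ℚ
  have : NeZero ((r : ℕ) : ℚ) := ⟨by exact_mod_cast hrp.ne_zero⟩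
  have : IsCyclotomicExtension {r} ℚ C₀ := CyclotomicField.isCyclotomicExtension r ℚ
  have : FiniteDimensional ℚ C₀ := IsCyclotomicExtension.finiteDimensional {r} ℚ C₀
  let ι : C₀ →ₐ[ℚ] E := IsAlgClosed.lift
  have hη₀ := IsCyclotomicExtension.zeta_spec r ℚ C₀
  obtain ⟨G₀, A, B, hG₀, hF, hF'⟩ := gF_rational hr C₀ _ hη₀
  have hη : IsPrimitiveRoot (ι (IsCyclotomicExtension.zeta r ℚ C₀)) r := hη₀.map_of_injective ι.injective
  set G := ι G₀ with hGdef
  have hG : G ^ 2 = -(r : E) := by rw [hGdef, ← map_pow, hG₀, map_neg, map_natCast]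
  have hψ : ∀ a, AddChar.zmodChar r hη.pow_eq_one a = ι (AddChar.zmodChar r hη₀.pow_eq_one a) := by
    intro a; rw [AddChar.zmodChar_apply, AddChar.zmodChar_apply, map_pow]
  have hcomp : (ι : C₀ →+* E).comp (algebraMap ℚ C₀) = algebraMap ℚ E := ι.comp_algebraMap
  have hFE : gF (AddChar.zmodChar r hη.pow_eq_one) = A.map (algebraMap ℚ E) + C G * B.map (algebraMap ℚ E) := by
    have h1 : gF (AddChar.zmodChar r hη.pow_eq_one) = (gF (AddChar.zmodChar r hη₀.pow_eq_one)).map (ι : C₀ →+* E) := by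
      simp only [gF, Polynomial.map_prod, Polynomial.map_sub, Polynomial.map_mul, map_C, map_X, hψ, RingHom.coe_coe]
    rw [h1, hF]
    simp only [Polynomial.map_add, Polynomial.map_mul, Polynomial.map_map, map_C, hcomp, RingHom.coe_coe, hGdef]
  have hFE' : gF' (AddChar.zmodChar r hη.pow_eq_one) = A.map (algebraMap ℚ E) - C G * B.map (algebraMap ℚ E) := by
    have h1 : gF' (AddChar.zmodChar r hη.pow_eq_one) = (gF' (AddChar.zmodChar r hη₀.pow_eq_one)).map (ι : C₀ →+* E) := by
      simp only [gF', Polynomial.map_prod, Polynomial.map_sub, Polynomial.map_mul, map_C, map_X, hψ, RingHom.coe_coe]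
    rw [h1, hF']
    simp only [Polynomial.map_sub, Polynomial.map_mul, Polynomial.map_map, map_C, hcomp, RingHom.coe_coe, hGdef]
  have hr0 : (r : E) ≠ 0 := by exact_mod_cast hrp.ne_zero
  have hG0 : G ≠ 0 := by
    intro h
    rw [h] at hG
    apply hr0
    have : (r : E) = - (0 ^ 2) := by rw [hG]; ring
    rw [this]; simp
  have hev : ∀ x : K, (gF (AddChar.zmodChar r hη.pow_eq_one)).eval (algebraMap K E x) =
      algebraMap K E (aeval x A) + G * algebraMap K E (aeval x B) := by
    intro x
    rw [hFE, eval_add, eval_mul, eval_C, eval_map_algebraMap, eval_map_algebraMap, aeval_algebraMap_apply,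
      aeval_algebraMap_apply]
  have hev' : ∀ x : K, (gF' (AddChar.zmodChar r hη.pow_eq_one)).eval (algebraMap K E x) =
      algebraMap K E (aeval x A) - G * algebraMap K E (aeval x B) := by
    intro x
    rw [hFE', eval_sub, eval_mul, eval_C, eval_map_algebraMap, eval_map_algebraMap, aeval_algebraMap_apply,
      aeval_algebraMap_apply]
  have hr1 : ∀ x : K, x ≠ 0 → (algebraMap K E x) ^ (gQ r).card * (algebraMap K E (aeval x⁻¹ A) +
      G * algebraMap K E (aeval x⁻¹ B)) = - (algebraMap K E (aeval x A) - G * algebraMap K E (aeval x B)) := by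
    intro x hx
    have := gF_refl hr (AddChar.zmodChar r hη.pow_eq_one) (algebraMap K E x) (by simpa using hx)
    rw [← map_inv₀, hev, hev'] at this
    exact this
  have hr2 : ∀ x : K, x ≠ 0 → (algebraMap K E x) ^ (gQ r).card * (algebraMap K E (aeval x⁻¹ A) -
      G * algebraMap K E (aeval x⁻¹ B)) = - (algebraMap K E (aeval x A) + G * algebraMap K E (aeval x B)) := by
    intro x hx
    have := gF'_refl hr (AddChar.zmodChar r hη.pow_eq_one) (algebraMap K E x) (by simpa using hx)
    rw [← map_inv₀, hev, hev'] at this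
    exact this
  refine ⟨(gQ r).card, A, B, ?_, ?_, ?_⟩
  · intro x hx
    apply (algebraMap K E).injective
    rw [map_mul, map_pow, map_neg]
    linear_combination (hr1 x hx + hr2 x hx) / 2
  · intro x hx
    apply (algebraMap K E).injective
    rw [map_mul, map_pow]
    apply mul_left_cancel₀ hG0
    linear_combination (hr1 x hx - hr2 x hx) / 2
  · have hζE : IsPrimitiveRoot (algebraMap K E ζ) p := hζ.map_of_injective (algebraMap K E).injective
    have hp1 := gF_prod hr _ hη p hp2 _ hζE hpr'
    have hp2 := gF_prod hr _ hη.inv p hp2 _ hζE hpr'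
    rw [← gF_inv _ hη] at hp2
    simp only [← map_pow, hev, hev'] at hp1 hp2
    have hGG : G * G = (-(r : K)) • (1 : E) + (0 : K) • G := by
      rw [← pow_two, hG]; simp [Algebra.smul_def]
    have hGG' : (-G) * (-G) = (-(r : K)) • (1 : E) + (0 : K) • (-G) := by
      rw [neg_mul_neg, hGG]; simp
    let f₁ : QuadraticAlgebra K (-(r : K)) 0 →ₐ[K] E := QuadraticAlgebra.lift ⟨G, hGG⟩
    let f₂ : QuadraticAlgebra K (-(r : K)) 0 →ₐ[K] E := QuadraticAlgebra.lift ⟨-G, hGG'⟩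
    have hf₁ : ∀ x y : K, f₁ ⟨x, y⟩ = algebraMap K E x + G * algebraMap K E y := by
      intro x y; simp [f₁, QuadraticAlgebra.lift, Algebra.smul_def, mul_comm]
    have hf₂ : ∀ x y : K, f₂ ⟨x, y⟩ = algebraMap K E x - G * algebraMap K E y := by
      intro x y; simp [f₂, QuadraticAlgebra.lift, Algebra.smul_def, mul_comm, sub_eq_add_neg]; ring
    simp only [← hf₁] at hp1
    simp only [← hf₂] at hp2
    rw [← map_prod] at hp1 hp2
    generalize (∏ u : (ZMod p)ˣ, (⟨aeval (ζ ^ (u : ZMod p).val) A, aeval (ζ ^ (u : ZMod p).val) B⟩ :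
        QuadraticAlgebra K (-(r : K)) 0)) = z at hp1 hp2 ⊢
    obtain ⟨x, y⟩ := z
    rw [hf₁] at hp1
    rw [hf₂] at hp2
    have hy : y = 0 := by
      apply (algebraMap K E).injective
      rw [map_zero]
      apply mul_left_cancel₀ hG0
      linear_combination (hp1 - hp2) / 2
    have hx : x = -1 := by
      apply (algebraMap K E).injective
      rw [map_neg, map_one]
      linear_combination (hp1 + hp2) / 2
    ext <;> simp [hx, hy, QuadraticAlgebra.re_one, QuadraticAlgebra.im_one]
end Gauss

section Step4
open QuadraticAlgebra

/-- coefficientwise action of an automorphism -/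
noncomputable def gS {K : Type*} [Field K] [CharZero K] (r : ℕ) (g : K ≃ₐ[ℚ] K) :
    QuadraticAlgebra K (-(r : K)) 0 →+* QuadraticAlgebra K (-(r : K)) 0 where
  toFun z := ⟨g z.re, g z.im⟩
  map_one' := by ext <;> simp [QuadraticAlgebra.re_one, QuadraticAlgebra.im_one]
  map_mul' x y := by ext <;> simp
  map_zero' := by ext <;> simp
  map_add' x y := by ext <;> simp

lemma gS_mul {K : Type*} [Field K] [CharZero K] (r : ℕ) (g h : K ≃ₐ[ℚ] K) (z) :
    gS r (g * h) z = gS r g (gS r h z) := rfl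

lemma gS_star {K : Type*} [Field K] [CharZero K] (r : ℕ) (g : K ≃ₐ[ℚ] K) (z) :
    gS r g (star z) = star (gS r g z) := by
  ext <;> simp [gS]

lemma gS_prod_shift {K : Type*} [Field K] [CharZero K] (r : ℕ) (g : K ≃ₐ[ℚ] K) (k : ℕ) (z) :
    gS r g (∏ i ∈ Finset.range k, gS r (g ^ i) z) = ∏ i ∈ Finset.range k, gS r (g ^ (i + 1)) z := by
  rw [map_prod]
  refine Finset.prod_congr rfl fun i _ => ?_
  rw [← gS_mul, pow_succ']

lemma step4 {K : Type*} [Field K] [CharZero K] (r ℓ f : ℕ) (hr : r ≠ 0) (hf : Even f)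
    (g τ : K ≃ₐ[ℚ] K) (hgτ : g * τ = τ * g) (a b α : K)
    (ha : τ a = a) (hb : τ b = b) (hfa : (g ^ f) a = -a) (hfb : (g ^ f) b = b)
    (hgα : g α = α) (hτα : τ α = -α) (hα : α ^ 2 = -(ℓ : K)) (hℓ : ℓ ≠ 0)
    (X Y₀ : ℚ) (hXY : X ^ 2 + r * Y₀ ^ 2 = ℓ)
    (hprod : ∏ i ∈ Finset.range (2 * f), gS r (g ^ i) ⟨a, b⟩ = -1) :
    ∃ n : K, ∏ i ∈ Finset.range (2 * f), (g ^ i) n = -(r : K) ^ f := by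
  set θ : QuadraticAlgebra K (-(r : K)) 0 := ⟨a, b⟩ with hθ
  have hα0 : α ≠ 0 := by
    rintro rfl
    apply hℓ
    have : (ℓ : K) = 0 := by linear_combination hα
    exact_mod_cast this
  have hstar : gS r (g ^ f) θ = - star θ := by
    ext
    · change (g ^ f) a = _
      rw [hfa]; simp [hθ]
    · change (g ^ f) b = _
      rw [hfb]; simp [hθ]
  set Y := ∏ i ∈ Finset.range f, gS r (g ^ i) θ with hY
  have hgY : gS r g Y * θ = - (Y * star θ) := by
    rw [hY, gS_prod_shift]
    have h1 := Finset.prod_range_succ' (fun i => gS r (g ^ i) θ) f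
    have h2 := Finset.prod_range_succ (fun i => gS r (g ^ i) θ) f
    have h3 : gS r (g ^ 0) θ = θ := rfl
    rw [h3] at h1
    rw [← h1, h2, hstar, mul_neg]
  have hYs : Y * star Y = -1 := by
    have h1 : star Y = ∏ i ∈ Finset.range f, gS r (g ^ (f + i)) θ := by
      have : ∀ i, gS r (g ^ (f + i)) θ = - star (gS r (g ^ i) θ) := by
        intro i
        rw [add_comm, pow_add, gS_mul, hstar, map_neg, gS_star]
      simp only [this]
      rw [Finset.prod_neg, Finset.card_range, hf.neg_one_pow, one_mul, hY, star_prod]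
    rw [h1, hY, ← Finset.prod_range_add, ← two_mul, hprod]
  set ρ : QuadraticAlgebra K (-(r : K)) 0 := ⟨(X : K), (Y₀ : K)⟩ with hρ
  have hρg : gS r g ρ = ρ := by ext <;> simp [gS, hρ]
  have hρs : ρ * star ρ = (ℓ : QuadraticAlgebra K (-(r : K)) 0) := by
    have : (X : K) ^ 2 + r * (Y₀ : K) ^ 2 = ℓ := by exact_mod_cast hXY
    ext
    · simp [hρ]; linear_combination this
    · simp [hρ]; ring
  set y := Y * ρ with hy
  have hys : y * star y = -(ℓ : QuadraticAlgebra K (-(r : K)) 0) := by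
    rw [hy, star_mul, mul_comm (star ρ), mul_mul_mul_comm, hYs, hρs]; ring
  have hgy : gS r g y * θ = - (y * star θ) := by
    rw [hy, map_mul, hρg]; linear_combination ρ * hgY
  have hτθ : gS r τ θ = θ := by ext <;> simp [gS, hθ, ha, hb]
  have hτρ : gS r τ ρ = ρ := by ext <;> simp [gS, hρ]
  have hτY : gS r τ Y = Y := by
    rw [hY, map_prod]
    refine Finset.prod_congr rfl fun i _ => ?_
    have : τ * g ^ i = g ^ i * τ := ((show Commute g τ from hgτ).pow_left i).symm.eq
    rw [← gS_mul, this, gS_mul, hτθ]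
  have hτy : gS r τ y = y := by rw [hy, map_mul, hτY, hτρ]
  clear_value y
  obtain ⟨U, V⟩ := y
  have hτU : τ U = U := congrArg QuadraticAlgebra.re hτy
  have hτV : τ V = V := congrArg QuadraticAlgebra.im hτy
  have hUV : U ^ 2 + r * V ^ 2 = -(ℓ : K) := by
    have := congrArg QuadraticAlgebra.re hys
    simp at this
    linear_combination this
  have hV : V ≠ 0 := by
    rintro rfl
    have h1 : U ^ 2 = α ^ 2 := by rw [hα, ← hUV]; ring
    have h2 : (2 : K) * α = 0 := by
      rcases sq_eq_sq_iff_eq_or_eq_neg.1 h1 with h | h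
      · rw [h, hτα] at hτU; linear_combination -hτU
      · rw [h, map_neg, hτα] at hτU; linear_combination hτU
    simp [hα0] at h2
  -- the map φ
  let φ : K → QuadraticAlgebra K (-(r : K)) 0 := fun x =>
    ⟨(x + τ x) / 2 + (x - τ x) / (2 * α) * U, (x - τ x) / (2 * α) * V⟩
  have hφ : ∀ x₀ x₁ : K, τ x₀ = x₀ → τ x₁ = x₁ → φ (x₀ + x₁ * α) = ⟨x₀ + x₁ * U, x₁ * V⟩ := by
    intro x₀ x₁ h0 h1
    have e1 : (x₀ + x₁ * α + τ (x₀ + x₁ * α)) / 2 = x₀ := by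
      rw [map_add, map_mul, h0, h1, hτα]; ring
    have e2 : (x₀ + x₁ * α - τ (x₀ + x₁ * α)) / (2 * α) = x₁ := by
      rw [map_add, map_mul, h0, h1, hτα]; field_simp; ring
    simp only [φ, e1, e2]
  have hττ : ∀ x, (∃ x₀ x₁, τ x₀ = x₀ ∧ τ x₁ = x₁ ∧ x = x₀ + x₁ * α) → φ x = 0 → x = 0 := by
    rintro x ⟨x₀, x₁, h0, h1, rfl⟩ h
    rw [hφ _ _ h0 h1] at h
    have e1 := congrArg QuadraticAlgebra.re h
    have e2 := congrArg QuadraticAlgebra.im h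
    simp [hV] at e1 e2
    rw [e2] at e1
    simp at e1
    rw [e1, e2]; simp
  set n₀ : K := (-(r : K) * b * V - a * U) / V with hn₀
  set n₁ : K := a / V with hn₁
  have hτn₀ : τ n₀ = n₀ := by simp [hn₀, ha, hb, hτU, hτV]
  have hτn₁ : τ n₁ = n₁ := by simp [hn₁, ha, hτV]
  set n : K := n₀ + n₁ * α with hn
  have hφn : (⟨n₀ + n₁ * U, n₁ * V⟩ : QuadraticAlgebra K (-(r : K)) 0) = ω * θ := by
    ext
    · simp [hθ, hn₀, hn₁]; field_simp; ring
    · simp [hθ, hn₁]; field_simp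
  have hcommτ : ∀ x, τ (g x) = g (τ x) := fun x => (AlgEquiv.congr_fun hgτ x).symm
  have key : ∀ x₀ x₁ : K, τ x₀ = x₀ → τ x₁ = x₁ →
      ∃ z₀ z₁, τ z₀ = z₀ ∧ τ z₁ = z₁ ∧ n * g (x₀ + x₁ * α) = z₀ + z₁ * α ∧
       (⟨z₀ + z₁ * U, z₁ * V⟩ : QuadraticAlgebra K (-(r : K)) 0) =
        ω * θ * gS r g ⟨x₀ + x₁ * U, x₁ * V⟩ := by
    intro x₀ x₁ h0 h1
    refine ⟨n₀ * g x₀ - ℓ * n₁ * g x₁, n₀ * g x₁ + n₁ * g x₀, ?_, ?_, ?_, ?_⟩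
    · simp [hτn₀, hτn₁, hcommτ, h0, h1]
    · simp [hτn₀, hτn₁, hcommτ, h0, h1]
    · rw [map_add, map_mul, hgα, hn]; linear_combination n₁ * g x₁ * hα
    · have e1 : gS r g ⟨x₀ + x₁ * U, x₁ * V⟩ = QuadraticAlgebra.C (g x₀) + QuadraticAlgebra.C (g x₁) * gS r g ⟨U, V⟩ := by
        ext <;> simp [gS]
      have e2 : (ω * θ) * gS r g ⟨U, V⟩ = (⟨U, V⟩ : QuadraticAlgebra K (-(r : K)) 0) * star (ω * θ) := by
        have : star (ω : QuadraticAlgebra K (-(r : K)) 0) = -ω := by ext <;> simp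
        rw [star_mul, this]
        linear_combination ω * hgy
      have e3 : (ω * θ) * gS r g ⟨x₀ + x₁ * U, x₁ * V⟩ = QuadraticAlgebra.C (g x₀) * (ω * θ) + QuadraticAlgebra.C (g x₁) * ((⟨U, V⟩ : QuadraticAlgebra K (-(r : K)) 0) * star (ω * θ)) := by
        rw [← e2, e1]; ring
      rw [e3, ← hφn]
      ext
      · simp; linear_combination (-n₁ * g x₁) * hUV
      · simp; ring
  have hind : ∀ k : ℕ, ∃ z₀ z₁, τ z₀ = z₀ ∧ τ z₁ = z₁ ∧ ∏ i ∈ Finset.range k, (g ^ i) n = z₀ + z₁ * α ∧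
       (⟨z₀ + z₁ * U, z₁ * V⟩ : QuadraticAlgebra K (-(r : K)) 0) =
        ∏ i ∈ Finset.range k, gS r (g ^ i) (ω * θ) := by
    intro k
    induction k with
    | zero => exact ⟨1, 0, by simp, by simp, by simp, by ext <;> simp [QuadraticAlgebra.re_one, QuadraticAlgebra.im_one]⟩
    | succ k ih =>
      obtain ⟨z₀, z₁, h0, h1, h2, h3⟩ := ih
      obtain ⟨w₀, w₁, h4, h5, h6, h7⟩ := key z₀ z₁ h0 h1
      refine ⟨w₀, w₁, h4, h5, ?_, ?_⟩
      · rw [← h6, ← h2, Finset.prod_range_succ', map_prod, mul_comm]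
        congr 1
        exact Finset.prod_congr rfl fun i _ => by rw [pow_succ']; rfl
      · rw [h7, h3, gS_prod_shift, Finset.prod_range_succ', mul_comm]
        rfl
  obtain ⟨z₀, z₁, h0, h1, h2, h3⟩ := hind (2 * f)
  refine ⟨n, ?_⟩
  have hω : ∀ i, gS r (g ^ i) (ω : QuadraticAlgebra K (-(r : K)) 0) = ω := by
    intro i; ext <;> simp [gS]
  have h4 : ∏ i ∈ Finset.range (2 * f), gS r (g ^ i) (ω * θ) = QuadraticAlgebra.C (-(r : K) ^ f) := by
    simp only [map_mul, hω]
    rw [Finset.prod_mul_distrib, hprod, Finset.prod_const, Finset.card_range, pow_mul]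
    have : (ω : QuadraticAlgebra K (-(r : K)) 0) ^ 2 = QuadraticAlgebra.C (-(r : K)) := by
      rw [pow_two]; ext <;> simp
    rw [this]
    have h5 : ∀ m : ℕ, (QuadraticAlgebra.C (-(r : K)) : QuadraticAlgebra K (-(r : K)) 0) ^ m = QuadraticAlgebra.C ((-(r : K)) ^ m) := by
      intro m
      induction m with
      | zero => simp
      | succ m ih => rw [pow_succ, ih, pow_succ, QuadraticAlgebra.C_mul]
    rw [h5, hf.neg_pow]
    ext <;> simp [QuadraticAlgebra.re_one, QuadraticAlgebra.im_one]
  rw [h4] at h3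
  have e1 : z₀ + z₁ * U = -(r : K) ^ f := congrArg QuadraticAlgebra.re h3
  have e2 : z₁ * V = 0 := congrArg QuadraticAlgebra.im h3
  have e3 : z₁ = 0 := by simpa [hV] using e2
  rw [e3] at e1
  rw [h2, e3, ← e1]; ring
end Step4

lemma no_sqrt (p ℓ : ℕ) (hp : p.Prime) (hp1 : p % 4 = 1) (hℓ : 0 < ℓ) (F : Type) [Field F] [NumberField F]
    [IsCyclotomicExtension {p} ℚ F] (β : F) (hβ : β ^ 2 = -(ℓ : F)) : False := by
  have : Fact p.Prime := ⟨hp⟩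
  have : NeZero p := ⟨hp.ne_zero⟩
  obtain ⟨e, he⟩ := (ZMod.exists_sq_eq_neg_one_iff (p := p)).2 (by omega)
  have he0 : e ≠ 0 := by
    rintro rfl
    simp at he
  have hirr := Polynomial.cyclotomic.irreducible_rat hp.pos
  have hζ := IsCyclotomicExtension.zeta_spec p ℚ F
  set ζ := IsCyclotomicExtension.zeta p ℚ F
  let E := IsCyclotomicExtension.autEquivPow F hirr
  let t := E.symm (Units.mk0 e he0)
  have htt : E (t * t) = -1 := by
    rw [map_mul]
    simp only [t, MulEquiv.apply_symm_apply]
    ext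
    simp [← he]
  have htβ : (t * t) β = β := by
    have : (t β) ^ 2 = β ^ 2 := by
      rw [← map_pow, hβ]; simp
    rcases sq_eq_sq_iff_eq_or_eq_neg.1 this with h | h
    · simp [h]
    · simp [h]
  have htζ : (t * t) ζ = ζ⁻¹ := by
    have h1 := hζ.autToPow_spec ℚ (t * t)
    have h2 : hζ.autToPow ℚ (t * t) = -1 := htt
    rw [h2] at h1
    rw [← h1]
    apply eq_inv_of_mul_eq_one_left
    rw [← pow_succ]
    have : (((-1 : (ZMod p)ˣ) : ZMod p)).val + 1 = p := by
      obtain ⟨k, rfl⟩ : ∃ k, p = k + 1 := ⟨p - 1, by have := hp.pos; omega⟩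
      simp [ZMod.val_neg_one]
    rw [this, hζ.pow_eq_one]
  obtain ⟨s⟩ : Nonempty (F →+* ℂ) := inferInstance
  let s1 : F →ₐ[ℚ] ℂ := s.toRatAlgHom.comp (t * t).toAlgHom
  let s2 : F →ₐ[ℚ] ℂ := ((starRingEnd ℂ).comp s).toRatAlgHom
  have hs : s1 = s2 := by
    apply (hζ.powerBasis ℚ).algHom_ext
    have hsζ : ‖s ζ‖ = 1 := by
      apply Complex.norm_eq_one_of_pow_eq_one (n := p) _ hp.ne_zero
      rw [← map_pow, hζ.pow_eq_one, map_one]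
    have : s ((t * t) ζ) = (starRingEnd ℂ) (s ζ) := by
      rw [htζ, map_inv₀, Complex.inv_eq_conj hsζ]
    simpa [s1, s2] using this
  have h3 : (starRingEnd ℂ) (s β) = s β := by
    have := DFunLike.congr_fun hs β
    have h4 : s ((t * t) β) = (starRingEnd ℂ) (s β) := this
    rw [← h4, htβ]
  obtain ⟨x, hx⟩ := Complex.conj_eq_iff_real.1 h3
  have : (x : ℂ) ^ 2 = -(ℓ : ℂ) := by
    rw [← hx, ← map_pow, hβ]; simp
  have h5 : x ^ 2 = -(ℓ : ℝ) := by exact_mod_cast this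
  have : (0 : ℝ) < ℓ := by exact_mod_cast hℓ
  nlinarith [sq_nonneg x]

structure Setup (p ℓ : ℕ) (L K : Type) [Field L] [NumberField L] [Field K] [NumberField K] [Algebra L K]
    (conj : L ≃ₐ[ℚ] L) (α : L) where
  hp : p.Prime
  hp1 : p % 4 = 1
  hpℓ : ¬ p ∣ ℓ
  hℓ : 0 < ℓ
  hα : α ^ 2 = -(ℓ : L)
  hdim : Module.finrank ℚ L = 2
  hconj : conj α = -α
  ζ : K
  a : (ZMod p)ˣ
  g : K ≃ₐ[ℚ] K
  τ : K ≃ₐ[ℚ] K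
  ha : ∀ x, x ∈ Subgroup.zpowers a
  hζ : IsPrimitiveRoot ζ p
  gζ : g ζ = ζ ^ (a : ZMod p).val
  gL : ∀ x, g (algebraMap L K x) = algebraMap L K x
  τζ : τ ζ = ζ
  τL : ∀ x, τ (algebraMap L K x) = algebraMap L K (conj x)
  pb : PowerBasis L K
  pbg : pb.gen = ζ
  pbd : pb.dim = p - 1
  gal : IsGalois L K

lemma exists_setup (ℓ : ℕ) (hℓpos : 0 < ℓ)
    (p : ℕ) (hp : p.Prime) (hp1 : p % 4 = 1) (hpℓ : ¬ p ∣ ℓ)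
    (L : Type) [Field L] [NumberField L]
    (α : L) (hα : α ^ 2 = -(ℓ : L)) (hdim : Module.finrank ℚ L = 2)
    (conj : L ≃ₐ[ℚ] L) (hconj : conj α = -α) :
    ∃ (K : Type) (_ : Field K) (_ : NumberField K) (_ : Algebra L K), Nonempty (Setup p ℓ L K conj α) := by
  have : Fact p.Prime := ⟨hp⟩
  have : NeZero p := ⟨hp.ne_zero⟩
  have : NeZero ((p : ℕ) : L) := ⟨by exact_mod_cast hp.ne_zero⟩
  let K := CyclotomicField p L
  have : IsCyclotomicExtension {p} L K := CyclotomicField.isCyclotomicExtension p L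
  have : NumberField K := IsCyclotomicExtension.numberField {p} L K
  have hζ := IsCyclotomicExtension.zeta_spec p L K
  set ζ := IsCyclotomicExtension.zeta p L K
  have hfin : Module.finrank ℚ L * Module.finrank L K = Module.finrank ℚ K := Module.finrank_mul_finrank ℚ L K
  have hcyc : IsCyclotomicExtension {p} ℚ (IntermediateField.adjoin ℚ {ζ}) :=
    hζ.intermediateField_adjoin_isCyclotomicExtension ℚ
  have hnt : IntermediateField.adjoin ℚ {ζ} ≠ ⊤ := by
    intro h
    have hmem : algebraMap L K α ∈ IntermediateField.adjoin ℚ {ζ} := by rw [h]; trivial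
    apply no_sqrt p ℓ hp hp1 hℓpos (IntermediateField.adjoin ℚ {ζ}) ⟨_, hmem⟩
    ext
    simp [← map_pow, hα]
  have h1 : Module.finrank ℚ (IntermediateField.adjoin ℚ {ζ}) = p - 1 := by
    rw [IsCyclotomicExtension.finrank _ (Polynomial.cyclotomic.irreducible_rat hp.pos),
      Nat.totient_prime hp]
  have h2 : Module.finrank (IntermediateField.adjoin ℚ {ζ}) K ≠ 1 := fun h =>
    hnt (IntermediateField.finrank_eq_one_iff_eq_top.1 h)
  have h3 : 0 < Module.finrank (IntermediateField.adjoin ℚ {ζ}) K := Module.finrank_pos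
  have h4 := Module.finrank_mul_finrank ℚ (IntermediateField.adjoin ℚ {ζ}) K
  have h5 : p - 1 ≤ Module.finrank L K := by
    rw [h1, ← hfin, hdim] at h4
    have h6 : 2 ≤ Module.finrank (IntermediateField.adjoin ℚ {ζ}) K := by omega
    have := Nat.mul_le_mul_left (p - 1) h6
    omega
  have hpd := (hζ.powerBasis L).finrank
  have hpdim := hζ.powerBasis_dim L
  have hdvd : minpoly L ζ ∣ Polynomial.cyclotomic p L := by
    apply minpoly.dvd
    rw [Polynomial.aeval_def, Polynomial.eval₂_eq_eval_map, Polynomial.map_cyclotomic]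
    exact hζ.isRoot_cyclotomic hp.pos
  have hcm : Polynomial.cyclotomic p L = minpoly L ζ := by
    symm
    apply Polynomial.eq_of_dvd_of_natDegree_le_of_leadingCoeff hdvd
    · rw [Polynomial.natDegree_cyclotomic, Nat.totient_prime hp]
      omega
    · rw [(Polynomial.cyclotomic.monic p L).leadingCoeff, (minpoly.monic (IsIntegral.of_finite L ζ)).leadingCoeff]
  have hirr : Irreducible (Polynomial.cyclotomic p L) := by
    rw [hcm]; exact minpoly.irreducible (IsIntegral.of_finite L ζ)
  have hdimp : (hζ.powerBasis L).dim = p - 1 := by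
    rw [hpdim, ← hcm, Polynomial.natDegree_cyclotomic, Nat.totient_prime hp]
  obtain ⟨a, ha⟩ := IsCyclic.exists_generator (α := (ZMod p)ˣ)
  let E := IsCyclotomicExtension.autEquivPow K hirr
  let g' := E.symm a
  have hg' : g' ζ = ζ ^ (a : ZMod p).val := by
    have h1 := hζ.autToPow_spec L g'
    have h2 : hζ.autToPow L g' = a := E.apply_symm_apply a
    rw [h2] at h1
    exact h1.symm
  -- the lift of conj
  let B := hζ.powerBasis L
  let ev : Polynomial L →+* K := (Polynomial.aeval ζ : Polynomial L →ₐ[L] K).toRingHom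
  have hev : Function.Surjective ev := by
    intro y
    obtain ⟨f, hf⟩ := B.exists_eq_aeval' y
    exact ⟨f, hf.symm⟩
  let ev2 : Polynomial L →+* K := Polynomial.eval₂RingHom ((algebraMap L K).comp (conj : L →+* L)) ζ
  have hker : RingHom.ker ev ≤ RingHom.ker ev2 := by
    intro f hf
    have hf' : Polynomial.aeval ζ f = 0 := hf
    obtain ⟨q, rfl⟩ := minpoly.dvd L ζ hf'
    rw [← hcm, RingHom.mem_ker, map_mul]
    have : ev2 (Polynomial.cyclotomic p L) = 0 := by
      change Polynomial.eval₂ _ _ _ = 0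
      rw [Polynomial.eval₂_eq_eval_map, Polynomial.map_cyclotomic]
      exact hζ.isRoot_cyclotomic hp.pos
    rw [this, zero_mul]
  let T : K →+* K := RingHom.liftOfSurjective ev hev ⟨ev2, hker⟩
  have hT : ∀ f, T (ev f) = ev2 f := fun f => RingHom.liftOfRightInverse_comp_apply _ _ _ ⟨ev2, hker⟩ f
  let τ : K ≃ₐ[ℚ] K := AlgEquiv.ofBijective T.toRatAlgHom (AlgHom.bijective _)
  refine ⟨K, inferInstance, inferInstance, inferInstance, ⟨⟨hp, hp1, hpℓ, hℓpos, hα, hdim, hconj, ζ, a, g'.restrictScalars ℚ, τ, ha, hζ, hg', ?_, ?_, ?_,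
    hζ.powerBasis L, rfl, hdimp, IsCyclotomicExtension.isGalois {p} L K⟩⟩⟩
  · intro x
    exact g'.commutes x
  · have := hT Polynomial.X
    have h1 : ev Polynomial.X = ζ := Polynomial.aeval_X _
    have h2 : ev2 Polynomial.X = ζ := Polynomial.eval₂_X _ _
    rw [h1, h2] at this
    exact this
  · intro x
    have := hT (Polynomial.C x)
    have h1 : ev (Polynomial.C x) = algebraMap L K x := Polynomial.aeval_C _ _
    have h2 : ev2 (Polynomial.C x) = algebraMap L K (conj x) := Polynomial.eval₂_C _ _
    rw [h1, h2] at this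
    exact this

namespace Setup
variable {p ℓ : ℕ} {L K : Type} [Field L] [NumberField L] [Field K] [NumberField K] [Algebra L K]
    {conj : L ≃ₐ[ℚ] L} {α : L} (S : Setup p ℓ L K conj α)
include S

lemma ℓ0 : (ℓ : L) ≠ 0 := by exact_mod_cast S.hℓ.ne'
lemma α0 : α ≠ 0 := by
  rintro rfl
  have := S.hα
  apply S.ℓ0
  simpa using this.symm

lemma L_rep (x : L) : ∃ u v : ℚ, x = algebraMap ℚ L u + algebraMap ℚ L v * α := by
  have hli : LinearIndependent ℚ ![(1 : L), α] := by
    rw [LinearIndependent.pair_iff]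
    intro s t h
    have ht : t = 0 := by
      by_contra ht
      have h1 : algebraMap ℚ L s + algebraMap ℚ L t * α = 0 := by
        simpa [Algebra.smul_def] using h
      have h2 : algebraMap ℚ L (s ^ 2) = algebraMap ℚ L (-(ℓ : ℚ) * t ^ 2) := by
        have : algebraMap ℚ L s = - (algebraMap ℚ L t * α) := by linear_combination h1
        rw [map_pow, this, map_mul, map_neg, map_natCast, ← S.hα, map_pow]
        ring
      have h3 := (algebraMap ℚ L).injective h2
      have h4 : 0 < t ^ 2 := by positivity
      have h5 : (0 : ℚ) < ℓ := by exact_mod_cast S.hℓ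
      nlinarith [sq_nonneg s, mul_pos h5 h4]
    subst ht
    simpa using h
  have := hli.span_eq_top_of_card_eq_finrank (by simp [S.hdim])
  have hx : x ∈ Submodule.span ℚ (Set.range ![(1 : L), α]) := by rw [this]; trivial
  rw [Matrix.range_cons, Matrix.range_cons, Matrix.range_empty, Set.union_empty, Set.singleton_union,
    Submodule.mem_span_pair] at hx
  obtain ⟨u, v, rfl⟩ := hx
  exact ⟨u, v, by simp [Algebra.smul_def]⟩

lemma conj_conj (x : L) : conj (conj x) = x := by
  obtain ⟨u, v, rfl⟩ := S.L_rep x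
  simp only [map_add, map_mul, AlgEquiv.commutes, S.hconj, map_neg, neg_neg]

lemma hom_ext {M : Type*} [Semiring M] (f1 f2 : K →+* M)
    (hL : ∀ x, f1 (algebraMap L K x) = f2 (algebraMap L K x)) (hz : f1 S.ζ = f2 S.ζ) : f1 = f2 := by
  ext y
  obtain ⟨f, hf⟩ := S.pb.exists_eq_aeval' y
  rw [S.pbg] at hf
  subst hf
  induction f using Polynomial.induction_on' with
  | add p q h1 h2 => simp [h1, h2]
  | monomial n a => simp [Polynomial.aeval_monomial, hL, hz]

lemma hom_ext' {M : Type*} [DivisionRing M] (f1 f2 : K →+* M)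
    (hL : f1 (algebraMap L K α) = f2 (algebraMap L K α)) (hz : f1 S.ζ = f2 S.ζ) : f1 = f2 := by
  apply S.hom_ext _ _ _ hz
  intro x
  obtain ⟨u, v, rfl⟩ := S.L_rep x
  simp only [map_add, map_mul, hL]
  simp

lemma aut_ext (f1 f2 : K ≃ₐ[ℚ] K)
    (hL : f1 (algebraMap L K α) = f2 (algebraMap L K α)) (hz : f1 S.ζ = f2 S.ζ) : f1 = f2 := by
  have := S.hom_ext' (f1 : K →+* K) (f2 : K →+* K) hL hz
  ext x
  exact DFunLike.congr_fun this x

lemma zpow_mod (u : ℕ) : S.ζ ^ ((u : ZMod p).val) = S.ζ ^ u := by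
  have h := pow_mod_orderOf S.ζ u
  rw [← S.hζ.eq_orderOf] at h
  rw [ZMod.val_natCast, h]

lemma zpow_eq {u v : ℕ} (h : (u : ZMod p) = v) : S.ζ ^ u = S.ζ ^ v := by
  rw [← S.zpow_mod, h, S.zpow_mod]

lemma gA : S.g (algebraMap L K α) = algebraMap L K α := S.gL α
lemma τA : S.τ (algebraMap L K α) = - algebraMap L K α := by rw [S.τL, S.hconj, map_neg]

lemma gpowL (i : ℕ) (x : L) : (S.g ^ i) (algebraMap L K x) = algebraMap L K x := by
  induction i with
  | zero => rfl
  | succ i ih => rw [pow_succ, AlgEquiv.mul_apply, S.gL, ih]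

lemma gpowζ (i : ℕ) : (S.g ^ i) S.ζ = S.ζ ^ ((S.a ^ i : (ZMod p)ˣ) : ZMod p).val := by
  have : NeZero p := ⟨S.hp.ne_zero⟩
  have : Fact (1 < p) := ⟨S.hp.one_lt⟩
  induction i with
  | zero =>
    simp [ZMod.val_one]
  | succ i ih =>
    rw [pow_succ, AlgEquiv.mul_apply, S.gζ, map_pow, ih, ← pow_mul]
    apply S.zpow_eq
    push_cast
    simp [pow_succ]

lemma ord_a : orderOf S.a = p - 1 := by
  have : Fact p.Prime := ⟨S.hp⟩
  rw [orderOf_eq_card_of_forall_mem_zpowers S.ha, Nat.card_eq_fintype_card, ZMod.card_units]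

lemma gpow_card : S.g ^ (p - 1) = 1 := by
  apply S.aut_ext
  · rw [S.gpowL]; rfl
  · rw [S.gpowζ, ← S.ord_a, pow_orderOf_eq_one]
    have : Fact (1 < p) := ⟨S.hp.one_lt⟩
    simp [ZMod.val_one]

lemma ττ : S.τ * S.τ = 1 := by
  apply S.aut_ext
  · simp [S.τA]
  · simp [S.τζ]

lemma gτ : S.g * S.τ = S.τ * S.g := by
  apply S.aut_ext
  · simp [S.τA, S.gA]
  · simp [S.τζ, S.gζ]

lemma two_f : 2 * ((p - 1) / 2) = p - 1 := by have := S.hp1; omega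
lemma even_f : Even ((p - 1) / 2) := by
  rw [Nat.even_iff]; have := S.hp1; omega

lemma a_f : S.a ^ ((p - 1) / 2) = -1 := by
  have : Fact p.Prime := ⟨S.hp⟩
  have h2 : S.a ^ ((p - 1) / 2) * S.a ^ ((p - 1) / 2) = 1 := by
    rw [← pow_add, ← two_mul, S.two_f, ← S.ord_a, pow_orderOf_eq_one]
  have h1 : S.a ^ ((p - 1) / 2) ≠ 1 := by
    intro h
    have := orderOf_dvd_of_pow_eq_one h
    rw [S.ord_a] at this
    have := Nat.le_of_dvd (by have := S.hp1; have := S.hp.two_le; omega) this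
    have := S.hp1; have := S.hp.two_le; omega
  have h3 : ((S.a ^ ((p - 1) / 2) : (ZMod p)ˣ) : ZMod p) * ((S.a ^ ((p - 1) / 2) : (ZMod p)ˣ) : ZMod p) = 1 := by
    rw [← Units.val_mul, h2]; simp
  rcases mul_self_eq_one_iff.1 h3 with h | h
  · exact absurd (Units.ext h) h1
  · exact Units.ext (by simpa using h)

/-- the involution `ζ ↦ ζ⁻¹` -/
def h : K ≃ₐ[ℚ] K := S.g ^ ((p - 1) / 2)
/-- complex conjugation -/
def c : K ≃ₐ[ℚ] K := S.h * S.τ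

lemma hA : S.h (algebraMap L K α) = algebraMap L K α := S.gpowL _ _
lemma hhζ : S.h S.ζ = S.ζ⁻¹ := by
  have : Fact p.Prime := ⟨S.hp⟩
  rw [h, S.gpowζ, S.a_f]
  apply eq_inv_of_mul_eq_one_left
  rw [← pow_succ]
  have : (((-1 : (ZMod p)ˣ) : ZMod p)).val + 1 = p := by
    obtain ⟨k, hk⟩ : ∃ k, p = k + 1 := ⟨p - 1, by have := S.hp.pos; omega⟩
    subst hk
    simp [ZMod.val_neg_one]
  rw [this, S.hζ.pow_eq_one]

lemma cL (x : L) : S.c (algebraMap L K x) = algebraMap L K (conj x) := by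
  rw [c, AlgEquiv.mul_apply, S.τL, h, S.gpowL]
lemma cA : S.c (algebraMap L K α) = -algebraMap L K α := by rw [S.cL, S.hconj, map_neg]
lemma cζ : S.c S.ζ = S.ζ⁻¹ := by rw [c, AlgEquiv.mul_apply, S.τζ, S.hhζ]
lemma gc : S.g * S.c = S.c * S.g := by
  rw [c, h, ← mul_assoc, ← pow_succ', pow_succ, mul_assoc, S.gτ, mul_assoc]
lemma cc : S.c * S.c = 1 := by
  apply S.aut_ext
  · simp [S.cA]
  · simp [S.cζ]
lemma ccx (x : K) : S.c (S.c x) = x := DFunLike.congr_fun S.cc x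
lemma ττx (x : K) : S.τ (S.τ x) = x := DFunLike.congr_fun S.ττ x
lemma gcx (x : K) : S.g (S.c x) = S.c (S.g x) := DFunLike.congr_fun S.gc x
lemma gτx (x : K) : S.g (S.τ x) = S.τ (S.g x) := DFunLike.congr_fun S.gτ x
lemma gpowc (i : ℕ) (x : K) : (S.g ^ i) (S.c x) = S.c ((S.g ^ i) x) := 
  DFunLike.congr_fun ((show Commute S.g S.c from S.gc).pow_left i) x
lemma gpowτ (i : ℕ) (x : K) : (S.g ^ i) (S.τ x) = S.τ ((S.g ^ i) x) := 
  DFunLike.congr_fun ((show Commute S.g S.τ from S.gτ).pow_left i) x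
lemma c_eq (x : K) : S.c x = S.h (S.τ x) := rfl
lemma hτx (x : K) : S.h (S.τ x) = S.τ (S.h x) := S.gpowτ _ x
lemma hhx (x : K) : S.h (S.h x) = x := by
  rw [h, ← AlgEquiv.mul_apply, ← pow_add, ← two_mul, S.two_f, S.gpow_card]; rfl

lemma A2 : (algebraMap L K α) ^ 2 = -(ℓ : K) := by rw [← map_pow, S.hα]; simp
lemma A0 : algebraMap L K α ≠ 0 := by simpa using S.α0
lemma ζ0 : S.ζ ≠ 0 := S.hζ.ne_zero S.hp.ne_zero

lemma exists_pow_of_root {M : Type*} [CommRing M] [IsDomain M] {ξ η : M} (h1 : IsPrimitiveRoot ξ p) (h2 : IsPrimitiveRoot η p) :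
    ∃ i < p - 1, η = ξ ^ ((S.a ^ i : (ZMod p)ˣ) : ZMod p).val := by
  have : Fact p.Prime := ⟨S.hp⟩
  have : NeZero p := ⟨S.hp.ne_zero⟩
  obtain ⟨k, hk, hk2, rfl⟩ := (h1.isPrimitiveRoot_iff).1 h2
  have hx := S.ha (ZMod.unitOfCoprime k hk2)
  rw [← mem_powers_iff_mem_zpowers] at hx
  rw [(isOfFinOrder_of_finite S.a).mem_powers_iff_mem_range_orderOf] at hx
  obtain ⟨i, hi, hi2⟩ := Finset.mem_image.1 hx
  rw [Finset.mem_range, S.ord_a] at hi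
  refine ⟨i, hi, ?_⟩
  rw [hi2]
  simp [ZMod.val_natCast, Nat.mod_eq_of_lt hk]

lemma aut_cases (γ : K ≃ₐ[ℚ] K) : ∃ i < p - 1, γ = S.g ^ i ∨ γ = S.g ^ i * S.τ := by
  obtain ⟨i, hi, hi2⟩ := S.exists_pow_of_root S.hζ (S.hζ.map_of_injective γ.injective)
  have hA : (γ (algebraMap L K α)) ^ 2 = (algebraMap L K α) ^ 2 := by
    rw [← map_pow, S.A2]; simp
  refine ⟨i, hi, ?_⟩
  rcases sq_eq_sq_iff_eq_or_eq_neg.1 hA with h | h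
  · left
    apply S.aut_ext
    · rw [h, S.gpowL]
    · rw [hi2, S.gpowζ]
  · right
    apply S.aut_ext
    · rw [h, AlgEquiv.mul_apply, S.τA, map_neg, S.gpowL]
    · rw [hi2, AlgEquiv.mul_apply, S.τζ, S.gpowζ]

lemma gpow_inj {i j : ℕ} (hi : i < p - 1) (hj : j < p - 1) (hij : S.g ^ i = S.g ^ j) : i = j := by
  have : Fact p.Prime := ⟨S.hp⟩
  have := DFunLike.congr_fun hij S.ζ
  rw [S.gpowζ, S.gpowζ] at this
  have := S.hζ.pow_inj (ZMod.val_lt _) (ZMod.val_lt _) this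
  have := Units.ext (ZMod.val_injective _ this)
  apply pow_injOn_Iio_orderOf _ _ this
  · simpa [S.ord_a] using hi
  · simpa [S.ord_a] using hj

lemma galQ : IsGalois ℚ K := by
  apply IsGalois.of_card_aut_eq_finrank
  apply le_antisymm
  · rw [Nat.card_eq_fintype_card]
    exact AlgEquiv.card_le
  · have h1 : Module.finrank ℚ K = 2 * (p - 1) := by
      rw [← Module.finrank_mul_finrank ℚ L K, S.hdim, S.pb.finrank, S.pbd]
    let F : Fin (p - 1) ⊕ Fin (p - 1) → (K ≃ₐ[ℚ] K) := Sum.elim (fun i => S.g ^ (i : ℕ)) (fun i => S.g ^ (i : ℕ) * S.τ)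
    have hne : ∀ i j : ℕ, S.g ^ i ≠ S.g ^ j * S.τ := by
      intro i j hij
      have := DFunLike.congr_fun hij (algebraMap L K α)
      rw [AlgEquiv.mul_apply, S.τA, map_neg, S.gpowL, S.gpowL] at this
      exact S.A0 (self_eq_neg.1 this)
    have hF : Function.Injective F := by
      rintro (i | i) (j | j) hij
      · simp only [F, Sum.elim_inl] at hij
        rw [Fin.ext (S.gpow_inj i.2 j.2 hij)]
      · exact absurd hij (hne _ _)
      · exact absurd hij.symm (hne _ _)
      · simp only [F, Sum.elim_inr] at hij
        rw [Fin.ext (S.gpow_inj i.2 j.2 (mul_right_cancel hij))]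
    have := Nat.card_le_card_of_injective F hF
    simp at this
    rw [h1]
    rw [Nat.card_eq_fintype_card]
    omega

/-- `g` as an `L`-automorphism -/
noncomputable def g' : K ≃ₐ[L] K := AlgEquiv.ofRingEquiv (f := (S.g : K ≃+* K)) S.gL

lemma g'_pow (i : ℕ) (x : K) : (S.g' ^ i) x = (S.g ^ i) x := by
  induction i generalizing x with
  | zero => rfl
  | succ i ih => rw [pow_succ, pow_succ, AlgEquiv.mul_apply, AlgEquiv.mul_apply, ih]; rfl

lemma gal_cases (γ : K ≃ₐ[L] K) : ∃ i < p - 1, γ = S.g' ^ i := by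
  obtain ⟨i, hi, hi2⟩ := S.exists_pow_of_root S.hζ (S.hζ.map_of_injective γ.injective)
  refine ⟨i, hi, ?_⟩
  have := S.hom_ext (γ : K →+* K) ((S.g' ^ i : K ≃ₐ[L] K) : K →+* K) (by intro x; simp) (by
    have : γ S.ζ = (S.g' ^ i) S.ζ := by rw [S.g'_pow, S.gpowζ, hi2]
    exact this)
  ext x
  exact DFunLike.congr_fun this x

lemma g'_gen (γ : K ≃ₐ[L] K) : γ ∈ Subgroup.zpowers S.g' := by
  obtain ⟨i, -, rfl⟩ := S.gal_cases γ
  exact ⟨i, by simp⟩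

open Classical in
lemma univ_eq : (Finset.univ : Finset (K ≃ₐ[L] K)) = (Finset.range (p - 1)).image (fun i => S.g' ^ i) := by
  ext γ
  simp only [Finset.mem_univ, Finset.mem_image, Finset.mem_range, true_iff]
  obtain ⟨i, hi, h⟩ := S.gal_cases γ
  exact ⟨i, hi, h.symm⟩

lemma g'_inj : Set.InjOn (fun i => S.g' ^ i) (Finset.range (p - 1) : Set ℕ) := by
  intro i hi j hj hij
  apply S.gpow_inj (by simpa using hi) (by simpa using hj)
  ext x
  rw [← S.g'_pow, ← S.g'_pow]
  exact DFunLike.congr_fun hij x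

lemma trace_eq (x : K) : algebraMap L K (Algebra.trace L K x) = ∑ i ∈ Finset.range (p - 1), (S.g ^ i) x := by
  classical
  have := S.gal
  rw [trace_eq_sum_automorphisms, S.univ_eq, Finset.sum_image S.g'_inj]
  simp [S.g'_pow]

lemma norm_eq (x : K) : algebraMap L K (Algebra.norm L x) = ∏ i ∈ Finset.range (p - 1), (S.g ^ i) x := by
  classical
  have := S.gal
  rw [Algebra.norm_eq_prod_automorphisms, S.univ_eq, Finset.prod_image S.g'_inj]
  simp [S.g'_pow]

end Setup

namespace Setup
variable {p ℓ : ℕ} {L K : Type} [Field L] [NumberField L] [Field K] [NumberField K] [Algebra L K]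
    {conj : L ≃ₐ[ℚ] L} {α : L} (S : Setup p ℓ L K conj α)
include S

lemma reindex {M : Type*} [CommMonoid M] [Fact p.Prime] (F : (ZMod p)ˣ → M) :
    ∏ i ∈ Finset.range (p - 1), F (S.a ^ i) = ∏ u, F u := by
  classical
  have h1 : (Finset.univ : Finset (ZMod p)ˣ) = (Finset.range (p - 1)).image (fun i => S.a ^ i) := by
    ext x
    simp only [Finset.mem_univ, true_iff]
    have hx := S.ha x
    rw [← mem_powers_iff_mem_zpowers] at hx
    rw [(isOfFinOrder_of_finite S.a).mem_powers_iff_mem_range_orderOf, S.ord_a] at hx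
    exact hx
  rw [h1, Finset.prod_image]
  intro i hi j hj hij
  apply pow_injOn_Iio_orderOf _ _ hij
  · simpa [S.ord_a] using hi
  · simpa [S.ord_a] using hj

lemma prod_ζ (w : K) (N : ℕ) (hw : w = S.ζ ^ N) : ∏ i ∈ Finset.range (p - 1), (S.g ^ i) w = 1 := by
  have : Fact p.Prime := ⟨S.hp⟩
  subst hw
  have h1 : ∀ i, (S.g ^ i) (S.ζ ^ N) = (S.ζ ^ ((S.a ^ i : (ZMod p)ˣ) : ZMod p).val) ^ N := by
    intro i
    rw [map_pow, S.gpowζ]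
  rw [Finset.prod_congr rfl (fun i _ => h1 i), S.reindex (fun u => (S.ζ ^ (u : ZMod p).val) ^ N), Finset.prod_pow]
  have h2 : ∏ u : (ZMod p)ˣ, S.ζ ^ (u : ZMod p).val = 1 := by
    set x := ∏ u : (ZMod p)ˣ, S.ζ ^ (u : ZMod p).val with hx
    have hx0 : x ≠ 0 := Finset.prod_ne_zero_iff.2 fun u _ => pow_ne_zero _ S.ζ0
    have h20 : (2 : ZMod p) ≠ 0 := by
      have : ((2 : ℕ) : ZMod p) ≠ 0 := by
        rw [Ne, ZMod.natCast_eq_zero_iff]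
        intro h
        have := Nat.le_of_dvd (by norm_num) h
        have := S.hp1
        have := S.hp.two_le
        omega
      simpa using this
    have h3 : x ^ 2 = x := by
      rw [hx, ← Finset.prod_pow]
      rw [← Equiv.prod_comp (Equiv.mulLeft (Units.mk0 (2 : ZMod p) h20)) (fun u : (ZMod p)ˣ => S.ζ ^ (u : ZMod p).val)]
      refine Finset.prod_congr rfl fun u _ => ?_
      rw [← pow_mul]
      apply S.zpow_eq
      simp [mul_comm]
    have : x * (x - 1) = 0 := by linear_combination h3
    rcases mul_eq_zero.1 this with h | h
    · exact absurd h hx0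
    · linear_combination h
  rw [h2, one_pow]

lemma exists_n (r : ℕ) (hr : r.Prime) (hr4 : r % 4 = 3) (hpr : ¬ IsSquare ((p : ℕ) : ZMod r))
    (X Y : ℚ) (hXY : X ^ 2 + r * Y ^ 2 = ℓ) :
    ∃ n : K, ∏ i ∈ Finset.range (p - 1), (S.g ^ i) n = -(r : K) ^ ((p - 1) / 2) := by
  have : Fact p.Prime := ⟨S.hp⟩
  have : Fact r.Prime := ⟨hr⟩
  obtain ⟨m, A, B, hA, hB, hprod⟩ := gauss_main (r := r) hr4 p (by have := S.hp1; omega) hpr K S.ζ S.hζ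
  obtain ⟨e, he⟩ : ∃ e, 2 * e = p + 1 := ⟨(p + 1) / 2, by have := S.hp1; omega⟩
  have hζ0 := S.ζ0
  obtain ⟨w, hw⟩ : ∃ w, w = S.ζ ^ (e * m * (p - 1)) := ⟨_, rfl⟩
  have hp1 : S.ζ ^ (p - 1) * S.ζ = 1 := by
    rw [← pow_succ, Nat.sub_add_cancel S.hp.pos, S.hζ.pow_eq_one]
  have hpi : S.ζ ^ (p - 1) = S.ζ⁻¹ := eq_inv_of_mul_eq_one_left hp1
  have hwi : w = (S.ζ⁻¹) ^ (e * m) := by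
    rw [hw, mul_comm, pow_mul, hpi]
  have h2e : S.ζ ^ (e * m) * S.ζ ^ (e * m) = S.ζ ^ m := by
    rw [← pow_add]
    apply S.zpow_eq
    have : ((2 * e : ℕ) : ZMod p) = 1 := by rw [he]; simp
    push_cast at this ⊢
    linear_combination (m : ZMod p) * this
  have hhw : S.h w = S.ζ ^ (e * m) := by rw [hwi, map_pow, map_inv₀, S.hhζ, inv_inv]
  have haev : ∀ (γ : K ≃ₐ[ℚ] K) (P : Polynomial ℚ), γ (Polynomial.aeval S.ζ P) = Polynomial.aeval (γ S.ζ) P := by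
    intro γ P
    exact (Polynomial.aeval_algHom_apply (γ : K →ₐ[ℚ] K) S.ζ P).symm
  have hτw : S.τ w = w := by rw [hw, map_pow, S.τζ]
  have hmul : w * S.ζ ^ (e * m) = 1 := by
    rw [hwi, ← mul_pow, inv_mul_cancel₀ hζ0, one_pow]
  have key : ∀ x y : K, S.ζ ^ m * x = y → S.ζ ^ (e * m) * x = w * y := by
    intro x y h
    rw [← h, ← h2e]
    linear_combination (- S.ζ ^ (e * m) * x) * hmul
  have hlast : ∏ i ∈ Finset.range (2 * ((p - 1) / 2)), gS r (S.g ^ i)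
      ⟨w * Polynomial.aeval S.ζ A, w * Polynomial.aeval S.ζ B⟩ = -1 := by
    rw [S.two_f]
    have h1 : ∀ i, gS r (S.g ^ i) ⟨w * Polynomial.aeval S.ζ A, w * Polynomial.aeval S.ζ B⟩ =
        (algebraMap K (QuadraticAlgebra K (-(r : K)) 0) ((S.g ^ i) w)) *
        ⟨Polynomial.aeval (S.ζ ^ ((S.a ^ i : (ZMod p)ˣ) : ZMod p).val) A,
         Polynomial.aeval (S.ζ ^ ((S.a ^ i : (ZMod p)ˣ) : ZMod p).val) B⟩ := by
      intro i
      rw [← S.gpowζ, ← haev, ← haev, ← Algebra.smul_def]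
      change (⟨_, _⟩ : QuadraticAlgebra K (-(r : K)) 0) = ⟨_, _⟩
      congr 1
      · exact map_mul (S.g ^ i) w _
      · exact map_mul (S.g ^ i) w _
    rw [Finset.prod_congr rfl (fun i _ => h1 i), Finset.prod_mul_distrib, ← map_prod, S.prod_ζ w _ hw, map_one, one_mul,
      S.reindex (fun u => (⟨Polynomial.aeval (S.ζ ^ (u : ZMod p).val) A,
        Polynomial.aeval (S.ζ ^ (u : ZMod p).val) B⟩ : QuadraticAlgebra K (-(r : K)) 0)), hprod]
  obtain ⟨n, hn⟩ := step4 (K := K) r ℓ ((p - 1) / 2) hr.ne_zero S.even_f S.g S.τ S.gτ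
    (w * Polynomial.aeval S.ζ A) (w * Polynomial.aeval S.ζ B) (algebraMap L K α)
    (by rw [map_mul, hτw, haev, S.τζ]) (by rw [map_mul, hτw, haev, S.τζ])
    (by
      change S.h _ = _
      rw [map_mul, hhw, haev, S.hhζ, key _ _ (hA _ hζ0)]; ring)
    (by
      change S.h _ = _
      rw [map_mul, hhw, haev, S.hhζ, key _ _ (hB _ hζ0)])
    S.gA S.τA S.A2 S.hℓ.ne' X Y hXY hlast
  rw [S.two_f] at hn
  exact ⟨n, hn⟩

lemma emb_c (s : K →+* ℂ) (x : K) : s (S.c x) = (starRingEnd ℂ) (s x) := by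
  have : s.comp (S.c : K →+* K) = (starRingEnd ℂ).comp s := by
    apply S.hom_ext'
    · change s (S.c _) = (starRingEnd ℂ) (s _)
      rw [S.cA, map_neg]
      have h1 : (s (algebraMap L K α)) ^ 2 = -(ℓ : ℂ) := by rw [← map_pow, S.A2]; simp
      set z := s (algebraMap L K α)
      have hre := congrArg Complex.re h1
      have him := congrArg Complex.im h1
      simp [pow_two] at hre him
      have hl : (0 : ℝ) < ℓ := by exact_mod_cast S.hℓ
      have : z.re = 0 := by
        have : z.re * z.im = 0 := by linarith
        rcases mul_eq_zero.1 this with h | h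
        · exact h
        · rw [h] at hre; nlinarith [mul_self_nonneg z.re]
      apply Complex.ext <;> simp [this]
    · change s (S.c _) = (starRingEnd ℂ) (s _)
      have hsζ : ‖s S.ζ‖ = 1 := by
        apply Complex.norm_eq_one_of_pow_eq_one (n := p) _ S.hp.ne_zero
        rw [← map_pow, S.hζ.pow_eq_one, map_one]
      rw [S.cζ, map_inv₀, Complex.inv_eq_conj hsζ]
  exact DFunLike.congr_fun this x

lemma exists_d (r : ℕ) (hr : 0 < r) (n : K)
    (hn : ∏ i ∈ Finset.range (p - 1), (S.g ^ i) n = -(r : K) ^ ((p - 1) / 2)) (s : K →+* ℂ) :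
    ∃ d : K, d ≠ 0 ∧ S.c d = d ∧ r * S.g d = d * n * S.c n ∧
      ∀ i, ∃ y : ℝ, 0 < y ∧ s ((S.g ^ i) d) = y := by
  have hr0 : (r : K) ≠ 0 := by exact_mod_cast hr.ne'
  have := S.gal
  have : IsCyclic (K ≃ₐ[L] K) := ⟨S.g', S.g'_gen⟩
  have hn0 : n ≠ 0 := by
    rintro rfl
    have hp2 := S.hp.two_le
    rw [Finset.prod_eq_zero (i := 0) (Finset.mem_range.2 (show 0 < p - 1 by omega)) (map_zero (S.g ^ 0))] at hn
    exact pow_ne_zero _ hr0 (neg_eq_zero.1 hn.symm)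
  have hcn0 : S.c n ≠ 0 := by simpa using hn0
  have hnorm : Algebra.norm L (r / (n * S.c n) : K) = 1 := by
    apply (algebraMap L K).injective
    rw [S.norm_eq, map_one]
    simp only [map_div₀, map_mul, map_natCast, Finset.prod_div_distrib, Finset.prod_mul_distrib, S.gpowc]
    rw [← map_prod, hn, Finset.prod_const, Finset.card_range]
    simp only [map_neg, map_pow, map_natCast]
    rw [neg_mul_neg, ← pow_add, ← two_mul, S.two_f, div_self (pow_ne_zero _ hr0)]
  obtain ⟨y, hy⟩ := groupCohomology.exists_div_of_norm_eq_one S.g'_gen hnorm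
  have hgy0 : S.g (y : K) ≠ 0 := by simp
  have hy' : r * S.g (y : K) = y * n * S.c n := by
    change (y : K) / S.g y = _ at hy
    rw [div_eq_div_iff hgy0 (mul_ne_zero hn0 hcn0)] at hy
    linear_combination -hy
  -- make c-invariant
  obtain ⟨d, hd0, hcd, hd⟩ : ∃ d : K, d ≠ 0 ∧ S.c d = d ∧ r * S.g d = d * n * S.c n := by
    by_cases hz : (y : K) + S.c y = 0
    · refine ⟨algebraMap L K α * y, mul_ne_zero S.A0 y.ne_zero, ?_, ?_⟩
      · rw [map_mul, S.cA]
        linear_combination (- algebraMap L K α) * hz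
      · rw [map_mul, S.gA]
        linear_combination (algebraMap L K α) * hy'
    · refine ⟨(y : K) + S.c y, hz, ?_, ?_⟩
      · rw [map_add, S.ccx, add_comm]
      · rw [map_add, S.gcx]
        have := congrArg S.c hy'
        simp only [map_mul, map_natCast, S.ccx] at this
        linear_combination hy' + this
  have hreal : ∃ x : ℝ, x ≠ 0 ∧ s d = x := by
    have := S.emb_c s d
    rw [hcd] at this
    obtain ⟨x, hx⟩ := Complex.conj_eq_iff_real.1 this.symm
    refine ⟨x, ?_, hx⟩
    rintro rfl
    simp at hx
    exact hd0 hx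
  obtain ⟨x, hx0, hx⟩ := hreal
  have hpos : ∀ e : K, r * S.g e = e * n * S.c n → (∃ y : ℝ, 0 < y ∧ s e = y) →
      ∀ i, ∃ y : ℝ, 0 < y ∧ s ((S.g ^ i) e) = y := by
    intro e he h0 i
    induction i with
    | zero => exact h0
    | succ i ih =>
      obtain ⟨y, hy, hy2⟩ := ih
      have h1 := congrArg (fun z => s ((S.g ^ i) z)) he
      simp only [map_mul, map_natCast, S.gpowc, S.emb_c, hy2] at h1
      rw [mul_assoc, Complex.mul_conj] at h1
      have hrC : (r : ℂ) ≠ 0 := by exact_mod_cast hr.ne'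
      refine ⟨y * Complex.normSq (s ((S.g ^ i) n)) / r, ?_, ?_⟩
      · have : 0 < Complex.normSq (s ((S.g ^ i) n)) := by
          rw [Complex.normSq_pos]
          exact (map_ne_zero s).2 ((map_ne_zero (S.g ^ i)).2 hn0)
        have : (0 : ℝ) < r := by exact_mod_cast hr
        positivity
      · rw [pow_succ, AlgEquiv.mul_apply]
        push_cast
        rw [eq_div_iff hrC]
        linear_combination h1
  rcases lt_or_gt_of_ne hx0 with h | h
  · refine ⟨-d, neg_ne_zero.2 hd0, by rw [map_neg, hcd], by rw [map_neg]; linear_combination -hd, ?_⟩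
    apply hpos
    · rw [map_neg]; linear_combination -hd
    · exact ⟨-x, by linarith, by rw [map_neg, hx]; simp⟩
  · exact ⟨d, hd0, hcd, hd, hpos d hd ⟨x, h, hx⟩⟩

end Setup

lemma int_rat {F : Type*} [Field F] [CharZero F] (x : ℚ) (h : IsIntegral ℤ (algebraMap ℚ F x)) : ∃ z : ℤ, x = z := by
  rw [isIntegral_algebraMap_iff (algebraMap ℚ F).injective] at h
  obtain ⟨y, hy⟩ := IsIntegrallyClosed.isIntegral_iff.1 h
  exact ⟨y, by simpa using hy.symm⟩

lemma int_natCast {F : Type*} [Field F] (n : ℕ) : IsIntegral ℤ (n : F) := by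
  simpa using (isIntegral_algebraMap (R := ℤ) (A := F) (x := (n : ℤ)))
lemma int_intCast {F : Type*} [Field F] (n : ℤ) : IsIntegral ℤ (n : F) := by
  simpa using (isIntegral_algebraMap (R := ℤ) (A := F) (x := (n : ℤ)))

lemma int_div_dvd {F : Type*} [Field F] [CharZero F] (z : ℤ) (q : ℕ) (hq : q ≠ 0) (h : IsIntegral ℤ ((z : F) / q)) :
    (q : ℤ) ∣ z := by
  have h1 : algebraMap ℚ F ((z : ℚ) / q) = (z : F) / q := by simp
  rw [← h1] at h
  obtain ⟨w, hw⟩ := int_rat _ h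
  refine ⟨w, ?_⟩
  have : (q : ℚ) ≠ 0 := by exact_mod_cast hq
  rw [div_eq_iff this] at hw
  have : z = w * q := by exact_mod_cast hw
  rw [this, mul_comm]

lemma int_cop {F : Type*} [Field F] [CharZero F] (M q : ℕ) (hq : q ≠ 0) (hc : M.Coprime q) (x : F)
    (hx : IsIntegral ℤ x) (h : IsIntegral ℤ (M * x / q)) : IsIntegral ℤ (x / q) := by
  have h1 := Nat.isCoprime_iff_coprime.2 hc
  obtain ⟨u, v, huv⟩ := h1
  have h2 : (u : F) * M + v * q = 1 := by exact_mod_cast huv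
  have hq' : (q : F) ≠ 0 := by exact_mod_cast hq
  have : x / q = u * (M * x / q) + v * x := by
    field_simp
    linear_combination (-x) * h2
  rw [this]
  exact ((int_intCast u).mul h).add ((int_intCast v).mul hx)

namespace Setup
variable {p ℓ : ℕ} {L K : Type} [Field L] [NumberField L] [Field K] [NumberField K] [Algebra L K]
    {conj : L ≃ₐ[ℚ] L} {α : L} (S : Setup p ℓ L K conj α)
include S

omit S in
lemma int_aut {F : Type*} [Field F] [NumberField F] (γ : F ≃ₐ[ℚ] F) {x : F} (h : IsIntegral ℤ x) : IsIntegral ℤ (γ x) :=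
  h.map γ

lemma pK0 : (p : K) ≠ 0 := by exact_mod_cast S.hp.ne_zero
lemma intζ : IsIntegral ℤ S.ζ := S.hζ.isIntegral S.hp.pos
lemma intζi : IsIntegral ℤ S.ζ⁻¹ := by rw [← S.hhζ]; exact int_aut _ S.intζ
lemma intα : IsIntegral ℤ α := by
  apply IsIntegral.of_pow (n := 2) (by norm_num)
  rw [S.hα]; exact (int_natCast ℓ).neg
omit S in
lemma intL {x : L} : IsIntegral ℤ (algebraMap L K x) ↔ IsIntegral ℤ x :=
  isIntegral_algebraMap_iff (algebraMap L K).injective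
lemma intA : IsIntegral ℤ (algebraMap L K α) := intL.2 S.intα

lemma conj_rat (x : L) (h : conj x = x) : ∃ u : ℚ, x = algebraMap ℚ L u := by
  obtain ⟨u, v, rfl⟩ := S.L_rep x
  simp only [map_add, map_mul, AlgEquiv.commutes, S.hconj] at h
  have : algebraMap ℚ L v * α = 0 := by linear_combination (-1/2 : L) * h
  exact ⟨u, by rw [this, add_zero]⟩

lemma conj_int (x : L) (hx : IsIntegral ℤ x) (h : conj x = x) : ∃ u : ℤ, x = u := by
  obtain ⟨u, rfl⟩ := S.conj_rat x h
  obtain ⟨z, rfl⟩ := int_rat _ hx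
  exact ⟨z, by simp⟩

lemma geom0 (ξ : K) (h1 : ξ ^ p = 1) (h2 : ξ ≠ 1) : ∑ i ∈ Finset.range p, ξ ^ i = 0 := by
  have := mul_geom_sum ξ p
  rw [h1, sub_self] at this
  exact (mul_eq_zero.1 this).resolve_left (sub_ne_zero.2 h2)

lemma dualsum (z : K) : (p : K) * z =
    ∑ i ∈ Finset.range p, algebraMap L K (Algebra.trace L K (z * S.ζ⁻¹ ^ i)) * S.ζ ^ i := by
  simp only [S.trace_eq, Finset.sum_mul]
  rw [Finset.sum_comm]
  have h1 : ∀ j, ∀ i, (S.g ^ j) (z * S.ζ⁻¹ ^ i) * S.ζ ^ i = (S.g ^ j) z * (((S.g ^ j) S.ζ)⁻¹ * S.ζ) ^ i := by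
    intro j i
    rw [map_mul, map_pow, map_inv₀, mul_pow]; ring
  simp only [h1, ← Finset.mul_sum]
  have hp2 := S.hp.two_le
  rw [Finset.sum_eq_single 0]
  · have : ((S.g ^ 0) S.ζ)⁻¹ * S.ζ = 1 := inv_mul_cancel₀ S.ζ0
    rw [this]
    simp [mul_comm]
  · intro j hj hj0
    have hne : (S.g ^ j) S.ζ ≠ 0 := (map_ne_zero (S.g ^ j)).2 S.ζ0
    rw [S.geom0, mul_zero]
    · rw [mul_pow, inv_pow, ← map_pow, S.hζ.pow_eq_one, map_one, inv_one, mul_one]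
    · intro h
      have h2 : S.ζ = (S.g ^ j) S.ζ := by
        rwa [inv_mul_eq_iff_eq_mul₀ hne, mul_one] at h
      apply hj0
      apply S.gpow_inj (Finset.mem_range.1 hj) (by omega)
      apply S.aut_ext
      · rw [S.gpowL]; rfl
      · rw [← h2]; rfl
  · intro h
    exact absurd (Finset.mem_range.2 (by omega)) h

lemma trace_int (z : K) (hz : IsIntegral ℤ z) : IsIntegral ℤ (Algebra.trace L K z) := by
  rw [← intL (K := K), S.trace_eq]
  exact IsIntegral.sum _ fun i _ => int_aut _ hz

lemma conj_trace (z : K) : conj (Algebra.trace L K z) = Algebra.trace L K (S.τ z) := by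
  apply (algebraMap L K).injective
  rw [← S.τL, S.trace_eq, S.trace_eq, map_sum]
  simp only [S.gpowτ]

lemma conj_trace_c (z : K) : conj (Algebra.trace L K z) = Algebra.trace L K (S.c z) := by
  apply (algebraMap L K).injective
  rw [← S.cL, S.trace_eq, S.trace_eq, map_sum]
  simp only [S.gpowc]

/-- being an `O_L`-combination of powers of `ζ` -/
def Rep (x : K) : Prop := ∃ c : ℕ → L, (∀ i, IsIntegral ℤ (c i)) ∧ x = ∑ i ∈ Finset.range p, algebraMap L K (c i) * S.ζ ^ i

lemma Rep.add {x y : K} (hx : S.Rep x) (hy : S.Rep y) : S.Rep (x + y) := by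
  obtain ⟨c, hc, rfl⟩ := hx
  obtain ⟨d, hd, rfl⟩ := hy
  exact ⟨fun i => c i + d i, fun i => (hc i).add (hd i), by simp [add_mul, Finset.sum_add_distrib]⟩
lemma Rep.smul {x : K} (b : L) (hb : IsIntegral ℤ b) (hx : S.Rep x) : S.Rep (algebraMap L K b * x) := by
  obtain ⟨c, hc, rfl⟩ := hx
  exact ⟨fun i => b * c i, fun i => hb.mul (hc i), by simp [Finset.mul_sum, mul_assoc]⟩
lemma Rep.pow (k : ℕ) : S.Rep (S.ζ ^ k) := by
  have hp := S.hp.pos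
  refine ⟨fun i => if i = k % p then 1 else 0, fun i => ?_, ?_⟩
  · dsimp only; split_ifs
    · exact isIntegral_one
    · exact isIntegral_zero
  · have h1 : S.ζ ^ k = S.ζ ^ (k % p) := S.zpow_eq (by simp)
    rw [h1, Finset.sum_eq_single (k % p)]
    · simp
    · intro b _ hb; simp [hb]
    · intro h; exact absurd (Finset.mem_range.2 (Nat.mod_lt _ hp)) h

lemma Rep.fixed {y : K} (hy : IsIntegral ℤ y) (hτ : S.τ y = y) : S.Rep y := by
  have : Fact p.Prime := ⟨S.hp⟩
  have : NeZero p := ⟨S.hp.ne_zero⟩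
  let F := IntermediateField.adjoin ℚ {S.ζ}
  have hcyc : IsCyclotomicExtension {p} ℚ F := S.hζ.intermediateField_adjoin_isCyclotomicExtension ℚ
  have hζF : S.ζ ∈ F := IntermediateField.mem_adjoin_simple_self ℚ _
  have hyF : y ∈ F := by
    have h1 : (p : K) * y ∈ F := by
      rw [S.dualsum]
      apply sum_mem
      intro i _
      apply mul_mem _ (pow_mem hζF i)
      obtain ⟨u, hu⟩ := S.conj_rat (Algebra.trace L K (y * S.ζ⁻¹ ^ i)) (by
        rw [S.conj_trace, map_mul, hτ, map_pow, map_inv₀, S.τζ])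
      rw [hu, ← IsScalarTower.algebraMap_apply]
      exact F.algebraMap_mem u
    have h2 : y = (p : K)⁻¹ * (p * y) := by rw [inv_mul_cancel_left₀ S.pK0]
    rw [h2]
    exact mul_mem (inv_mem (natCast_mem F p)) h1
  have hζ' : IsPrimitiveRoot (⟨S.ζ, hζF⟩ : F) p := by
    rw [← IsPrimitiveRoot.map_iff_of_injective (f := algebraMap F K) (algebraMap F K).injective]
    exact S.hζ
  have hic := IsCyclotomicExtension.Rat.isIntegralClosure_adjoin_singleton_of_prime hζ'
  have hyi : IsIntegral ℤ (⟨y, hyF⟩ : F) := by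
    rw [← isIntegral_algebraMap_iff (algebraMap F K).injective]
    exact hy
  obtain ⟨⟨w, hw⟩, hw2⟩ := hic.isIntegral_iff.1 hyi
  rw [Algebra.adjoin_singleton_eq_range_aeval] at hw
  obtain ⟨P, hP⟩ := hw
  have hyP : y = Polynomial.aeval S.ζ P := by
    have h3 : (⟨y, hyF⟩ : F) = Polynomial.aeval (⟨S.ζ, hζF⟩ : F) P := by
      rw [← hw2]; exact hP.symm
    have h4 := congrArg (algebraMap F K) h3
    rw [← Polynomial.aeval_algebraMap_apply] at h4
    exact h4
  rw [hyP]
  clear hyP hP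
  induction P using Polynomial.induction_on' with
  | add P Q h1 h2 => rw [map_add]; exact h1.add S h2
  | monomial n a =>
    rw [Polynomial.aeval_monomial]
    have : algebraMap ℤ K a = algebraMap L K (a : L) := by simp
    rw [this]
    exact (Rep.pow S n).smul S _ (int_intCast a)

lemma rep {x : K} (hx : IsIntegral ℤ x) : S.Rep x := by
  have h1 : S.Rep (p * x) := ⟨_, fun i => S.trace_int _ (hx.mul (S.intζi.pow i)), S.dualsum x⟩
  have hτ := int_aut S.τ hx
  have h2 : S.Rep (x + S.τ x) := Rep.fixed S (hx.add hτ) (by rw [map_add, S.ττx, add_comm])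
  have h3 : S.Rep (algebraMap L K α * (x - S.τ x)) := Rep.fixed S (S.intA.mul (hx.sub hτ)) (by
    rw [map_mul, map_sub, S.ττx, S.τA]; ring)
  have h4 : S.Rep ((2 * ℓ : ℕ) * x) := by
    have e : ((2 * ℓ : ℕ) : K) * x = algebraMap L K (ℓ : L) * (x + S.τ x) +
        algebraMap L K (-α) * (algebraMap L K α * (x - S.τ x)) := by
      have := S.A2
      rw [map_natCast, map_neg, Nat.cast_mul, Nat.cast_ofNat]
      linear_combination (x - S.τ x) * this
    rw [e]
    exact (h2.smul S _ (int_natCast ℓ)).add S (h3.smul S _ S.intα.neg)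
  have hcop : Nat.Coprime p (2 * ℓ) := by
    rw [S.hp.coprime_iff_not_dvd, S.hp.dvd_mul]
    rintro (h | h)
    · have := Nat.le_of_dvd (by norm_num) h
      have := S.hp1
      have := S.hp.two_le
      omega
    · exact S.hpℓ h
  obtain ⟨u, v, huv⟩ := Nat.isCoprime_iff_coprime.2 hcop
  have huv' : (u : K) * p + v * (2 * ℓ : ℕ) = 1 := by exact_mod_cast huv
  have e : x = algebraMap L K (u : L) * (p * x) + algebraMap L K (v : L) * ((2 * ℓ : ℕ) * x) := by
    rw [map_intCast, map_intCast]
    linear_combination (-x) * huv'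
  rw [e]
  exact (h1.smul S _ (int_intCast u)).add S (h4.smul S _ (int_intCast v))

lemma one_sub_ne (k : ℕ) (hk : ¬ p ∣ k) : S.ζ ^ k ≠ 1 := fun h => hk (S.hζ.dvd_of_pow_eq_one k h)
lemma pi0 : 1 - S.ζ ≠ 0 := by
  intro h
  exact S.hζ.ne_one S.hp.one_lt (by linear_combination -h)

lemma one_sub_pow (k : ℕ) : IsIntegral ℤ ((1 - S.ζ ^ k) / (1 - S.ζ)) := by
  have h1 : (1 - S.ζ ^ k) / (1 - S.ζ) = ∑ i ∈ Finset.range k, S.ζ ^ i := by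
    rw [div_eq_iff S.pi0]
    exact (geom_sum_mul_neg S.ζ k).symm
  rw [h1]
  exact IsIntegral.sum _ fun i _ => S.intζ.pow i

lemma gsub (i : ℕ) : IsIntegral ℤ ((S.g ^ i) (1 - S.ζ) / (1 - S.ζ)) := by
  rw [map_sub, map_one, S.gpowζ]
  exact S.one_sub_pow _

lemma g_sub {x : K} (hx : IsIntegral ℤ x) : IsIntegral ℤ ((S.g x - x) / (1 - S.ζ)) := by
  obtain ⟨c, hc, rfl⟩ := S.rep hx
  rw [map_sum, ← Finset.sum_sub_distrib, Finset.sum_div]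
  apply IsIntegral.sum
  intro i _
  rw [map_mul, S.gL, map_pow, S.gζ, ← mul_sub, mul_div_assoc]
  apply (intL.2 (hc i)).mul
  have e : ((S.ζ ^ (S.a : ZMod p).val) ^ i - S.ζ ^ i) / (1 - S.ζ) = (1 - S.ζ ^ i) / (1 - S.ζ)
      - (1 - S.ζ ^ ((S.a : ZMod p).val * i)) / (1 - S.ζ) := by
    rw [← sub_div, ← pow_mul]; congr 1; ring
  rw [e]
  exact (S.one_sub_pow _).sub (S.one_sub_pow _)

lemma prod_one_sub : ∏ i ∈ Finset.range (p - 1), (S.g ^ i) (1 - S.ζ) = p := by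
  have : Fact p.Prime := ⟨S.hp⟩
  have h1 : ∀ i, (S.g ^ i) (1 - S.ζ) = 1 - S.ζ ^ ((S.a ^ i : (ZMod p)ˣ) : ZMod p).val := by
    intro i; rw [map_sub, map_one, S.gpowζ]
  rw [Finset.prod_congr rfl (fun i _ => h1 i), S.reindex (fun u => 1 - S.ζ ^ (u : ZMod p).val)]
  have h2 := Polynomial.eval_one_cyclotomic_prime (R := K) (p := p)
  rw [← h2, Polynomial.cyclotomic_eq_prod_X_sub_primitiveRoots S.hζ, Polynomial.eval_prod]
  refine Finset.prod_bij (fun u _ => S.ζ ^ (u : ZMod p).val) ?_ ?_ ?_ ?_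
  · intro u _
    rw [mem_primitiveRoots S.hp.pos]
    exact S.hζ.pow_of_coprime _ (ZMod.val_coe_unit_coprime u)
  · intro u _ v _ h
    exact Units.ext (ZMod.val_injective _ (S.hζ.pow_inj (ZMod.val_lt _) (ZMod.val_lt _) h))
  · intro b hb
    rw [mem_primitiveRoots S.hp.pos] at hb
    obtain ⟨i, -, hi⟩ := S.exists_pow_of_root S.hζ hb
    exact ⟨S.a ^ i, Finset.mem_univ _, hi.symm⟩
  · intro u _
    simp

lemma p_div : IsIntegral ℤ ((p : K) / (1 - S.ζ)) := by
  have hp2 := S.hp.two_le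
  obtain ⟨k, hk⟩ : ∃ k, p - 1 = k + 1 := ⟨p - 2, by omega⟩
  rw [← S.prod_one_sub, hk, Finset.prod_range_succ, mul_div_assoc]
  exact (IsIntegral.prod _ fun i _ => int_aut _ (isIntegral_one.sub S.intζ)).mul (S.gsub _)

lemma int_dvd_of_pi (t : ℤ) (h : IsIntegral ℤ ((t : K) / (1 - S.ζ))) : (p : ℤ) ∣ t := by
  have h1 : IsIntegral ℤ (∏ i ∈ Finset.range (p - 1), (S.g ^ i) ((t : K) / (1 - S.ζ))) :=
    IsIntegral.prod _ fun i _ => int_aut _ h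
  simp only [map_div₀, map_intCast, Finset.prod_div_distrib, S.prod_one_sub, Finset.prod_const] at h1
  have h2 := int_div_dvd (F := K) (t ^ (p - 1)) p S.hp.ne_zero (by simpa using h1)
  exact (Nat.prime_iff_prime_int.1 S.hp).dvd_of_dvd_pow h2

lemma cop2 : Nat.Coprime (2 * ℓ) p := by
  rw [Nat.coprime_comm, S.hp.coprime_iff_not_dvd, S.hp.dvd_mul]
  rintro (h | h)
  · have := Nat.le_of_dvd (by norm_num) h
    have := S.hp1
    have := S.hp.two_le
    omega
  · exact S.hpℓ h

lemma L_of_pi (x : L) (hx : IsIntegral ℤ x) (h : IsIntegral ℤ ((algebraMap L K x) / (1 - S.ζ))) : IsIntegral ℤ (x / p) := by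
  have hc := int_aut conj hx
  have hτ : IsIntegral ℤ (algebraMap L K (conj x) / (1 - S.ζ)) := by
    have := int_aut S.τ h
    rwa [map_div₀, map_sub, map_one, S.τζ, S.τL] at this
  obtain ⟨u, hu⟩ := S.conj_int (x + conj x) (hx.add hc) (by rw [map_add, S.conj_conj, add_comm])
  obtain ⟨v, hv⟩ := S.conj_int (α * (x - conj x)) (S.intα.mul (hx.sub hc)) (by
    rw [map_mul, map_sub, S.conj_conj, S.hconj]; ring)
  obtain ⟨u', rfl⟩ := S.int_dvd_of_pi u (by
    have e : (u : K) = algebraMap L K (x + conj x) := by rw [hu]; simp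
    rw [e, map_add, add_div]
    exact h.add hτ)
  obtain ⟨v', rfl⟩ := S.int_dvd_of_pi v (by
    have e : (v : K) = algebraMap L K (α * (x - conj x)) := by rw [hv]; simp
    rw [e, map_mul, map_sub, mul_div_assoc, sub_div]
    exact S.intA.mul (h.sub hτ))
  apply int_cop (2 * ℓ) p S.hp.ne_zero S.cop2 x hx
  have hp0 : (p : L) ≠ 0 := by exact_mod_cast S.hp.ne_zero
  have e : ((2 * ℓ : ℕ) : L) * x / p = ℓ * u' - α * v' := by
    rw [div_eq_iff hp0]
    push_cast at hu hv ⊢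
    linear_combination (ℓ : L) * hu - α * hv + (x - conj x) * S.hα
  rw [e]
  exact ((int_natCast ℓ).mul (int_intCast _)).sub (S.intα.mul (int_intCast _))

lemma trace_dual (z : K) : (∀ x : K, IsIntegral ℤ x → IsIntegral ℤ (Algebra.trace L K (z * x))) ↔
    IsIntegral ℤ (p * z / (1 - S.ζ)) := by
  constructor
  · intro h
    have h0 : ∑ i ∈ Finset.range p, algebraMap L K (Algebra.trace L K (z * S.ζ⁻¹ ^ i)) = 0 := by
      rw [← map_sum, ← map_sum, ← Finset.mul_sum, S.geom0, mul_zero, map_zero, map_zero]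
      · rw [inv_pow, S.hζ.pow_eq_one, inv_one]
      · intro h
        exact S.hζ.ne_one S.hp.one_lt (inv_eq_one.1 h)
    have h1 : (p : K) * z / (1 - S.ζ) = ∑ i ∈ Finset.range p,
        algebraMap L K (Algebra.trace L K (z * S.ζ⁻¹ ^ i)) * (-((1 - S.ζ ^ i) / (1 - S.ζ))) := by
      have : ∀ i, algebraMap L K (Algebra.trace L K (z * S.ζ⁻¹ ^ i)) * (-((1 - S.ζ ^ i) / (1 - S.ζ))) =
        (algebraMap L K (Algebra.trace L K (z * S.ζ⁻¹ ^ i)) * S.ζ ^ i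
          - algebraMap L K (Algebra.trace L K (z * S.ζ⁻¹ ^ i))) / (1 - S.ζ) := by
        intro i; ring
      rw [Finset.sum_congr rfl (fun i _ => this i), ← Finset.sum_div, Finset.sum_sub_distrib, ← S.dualsum, h0, sub_zero]
    rw [h1]
    exact IsIntegral.sum _ fun i _ => (intL.2 (h _ (S.intζi.pow i))).mul (S.one_sub_pow i).neg
  · intro h x hx
    have hy := h.mul hx
    set y := (p : K) * z / (1 - S.ζ) * x with hy'
    have h1 : (p : L) * Algebra.trace L K (z * x) = Algebra.trace L K ((1 - S.ζ) * y) := by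
      have e : (1 - S.ζ) * y = (p : L) • (z * x) := by
        rw [hy', Algebra.smul_def, map_natCast]
        have := S.pi0
        field_simp
      rw [e, map_smul, smul_eq_mul]
    have h2 := S.L_of_pi (Algebra.trace L K ((1 - S.ζ) * y)) (S.trace_int _ ((isIntegral_one.sub S.intζ).mul hy)) (by
      rw [S.trace_eq, Finset.sum_div]
      apply IsIntegral.sum
      intro i _
      rw [map_mul, mul_comm, mul_div_assoc]
      exact (int_aut _ hy).mul (S.gsub i))
    have hp0 : (p : L) ≠ 0 := by exact_mod_cast S.hp.ne_zero
    rwa [← h1, mul_div_cancel_left₀ _ hp0] at h2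

end Setup

lemma sqf_rat (m : ℕ) (hm : Squarefree m) (W : ℚ) (k : ℤ) (h : m * W ^ 2 = k) : ∃ w : ℤ, W = w := by
  have hden : (W.den : ℚ) ≠ 0 := by exact_mod_cast W.den_ne_zero
  have h1 : (m : ℤ) * W.num ^ 2 = k * (W.den : ℤ) ^ 2 := by
    have : (m : ℚ) * W.num ^ 2 = k * (W.den : ℚ) ^ 2 := by
      rw [← h]
      nth_rw 2 [← Rat.num_div_den W]
      field_simp
    exact_mod_cast this
  have hcop : IsCoprime ((W.den : ℤ) ^ 2) (W.num ^ 2) := by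
    apply IsCoprime.pow
    rw [isCoprime_comm, Int.isCoprime_iff_gcd_eq_one]
    exact W.reduced
  have h2 : (W.den : ℤ) ^ 2 ∣ (m : ℤ) := hcop.dvd_of_dvd_mul_right ⟨k, by rw [h1, mul_comm]⟩
  have h3 : W.den * W.den ∣ m := by rw [← pow_two]; exact_mod_cast h2
  have h4 := Nat.isUnit_iff.1 (hm _ h3)
  exact ⟨W.num, (Rat.den_eq_one_iff W).1 h4 |>.symm⟩

/-- nilpotent modulo `q` -/
def Nil (F : Type*) [Field F] [NumberField F] (q : ℕ) (x : F) : Prop :=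
  ∃ X : 𝓞 F, (X : F) = x ∧ X ∈ (Ideal.span {(q : 𝓞 F)}).radical

lemma Nil.of {F : Type*} [Field F] [NumberField F] {q : ℕ} (hq : q ≠ 0) {x : F} (hx : IsIntegral ℤ x) (M : ℕ)
    (h : IsIntegral ℤ (x ^ M / q)) : Nil F q x := by
  obtain ⟨X, hX⟩ : ∃ X : 𝓞 F, (X : F) = x := ⟨⟨x, hx⟩, rfl⟩
  obtain ⟨Y, hY⟩ : ∃ X : 𝓞 F, (X : F) = x ^ M / q := ⟨⟨_, h⟩, rfl⟩
  refine ⟨X, hX, M, ?_⟩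
  rw [Ideal.mem_span_singleton]
  refine ⟨Y, ?_⟩
  have : (q : F) ≠ 0 := by exact_mod_cast hq
  apply RingOfIntegers.ext
  simp only [map_mul, map_pow, map_natCast]
  change (X : F) ^ M = q * (Y : F)
  rw [hX, hY]
  field_simp

lemma Nil.pow {F : Type*} [Field F] [NumberField F] {q : ℕ} (hq : q ≠ 0) {x : F} (h : Nil F q x) :
    ∃ M : ℕ, IsIntegral ℤ (x ^ M / q) := by
  obtain ⟨X, rfl, M, hM⟩ := h
  rw [Ideal.mem_span_singleton] at hM
  obtain ⟨Y, hY⟩ := hM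
  refine ⟨M, ?_⟩
  have h1 := congrArg (algebraMap (𝓞 F) F) hY
  simp only [map_mul, map_pow, map_natCast] at h1
  have : (q : F) ≠ 0 := by exact_mod_cast hq
  rw [h1, mul_div_cancel_left₀ _ this]
  exact Y.2

lemma Nil.int {F : Type*} [Field F] [NumberField F] {q : ℕ} {x : F} (h : Nil F q x) : IsIntegral ℤ x := by
  obtain ⟨X, rfl, hM⟩ := h
  exact X.2

lemma Nil.add {F : Type*} [Field F] [NumberField F] {q : ℕ} {x y : F} (hx : Nil F q x) (hy : Nil F q y) :
    Nil F q (x + y) := by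
  obtain ⟨X, rfl, hM⟩ := hx
  obtain ⟨Y, rfl, hN⟩ := hy
  exact ⟨X + Y, by simp, Ideal.add_mem _ hM hN⟩

lemma Nil.zero {F : Type*} [Field F] [NumberField F] {q : ℕ} : Nil F q 0 := ⟨0, by simp, Ideal.zero_mem _⟩

lemma Nil.mul {F : Type*} [Field F] [NumberField F] {q : ℕ} {x y : F} (hx : Nil F q x) (hy : IsIntegral ℤ y) :
    Nil F q (x * y) := by
  obtain ⟨X, rfl, hM⟩ := hx
  obtain ⟨Y, rfl⟩ : ∃ X : 𝓞 F, (X : F) = y := ⟨⟨y, hy⟩, rfl⟩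
  exact ⟨X * Y, by simp, Ideal.mul_mem_right _ _ hM⟩

lemma Nil.aut {F : Type*} [Field F] [NumberField F] {q : ℕ} (hq : q ≠ 0) {x : F} (hx : Nil F q x) (γ : F ≃ₐ[ℚ] F) :
    Nil F q (γ x) := by
  obtain ⟨M, hM⟩ := hx.pow hq
  apply Nil.of hq (Setup.int_aut γ hx.int) M
  have := Setup.int_aut γ hM
  simpa using this

lemma Nil.sum {F : Type*} [Field F] [NumberField F] {q : ℕ} {ι : Type*} (s : Finset ι) (f : ι → F)
    (h : ∀ i ∈ s, Nil F q (f i)) : Nil F q (∑ i ∈ s, f i) := by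
  classical
  induction s using Finset.induction_on with
  | empty => simpa using Nil.zero
  | insert a s ha ih =>
    rw [Finset.sum_insert ha]
    exact (h a (Finset.mem_insert_self _ _)).add (ih fun i hi => h i (Finset.mem_insert_of_mem hi))

lemma Nil.dvd {F : Type*} [Field F] [NumberField F] {q : ℕ} (hq : q.Prime) (z : ℤ) (h : Nil F q (z : F)) : (q : ℤ) ∣ z := by
  obtain ⟨M, hM⟩ := h.pow hq.ne_zero
  have h2 := int_div_dvd (F := F) (z ^ M) q hq.ne_zero (by simpa using hM)
  exact (Nat.prime_iff_prime_int.1 hq).dvd_of_dvd_pow h2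

/-- `-ℓ` is a fundamental discriminant -/
def Fund (ℓ : ℕ) : Prop := (ℓ % 4 = 3 ∧ Squarefree ℓ) ∨
      ∃ m : ℕ, ℓ = 4 * m ∧ Squarefree m ∧ (m % 4 = 1 ∨ m % 4 = 2)

namespace Setup
variable {p ℓ : ℕ} {L K : Type} [Field L] [NumberField L] [Field K] [NumberField K] [Algebra L K]
    {conj : L ≃ₐ[ℚ] L} {α : L} (S : Setup p ℓ L K conj α)
include S

lemma sub_conj (hf : Fund ℓ) (x : L) (hx : IsIntegral ℤ x) : ∃ z : ℤ, x - conj x = z * α := by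
  have hc := int_aut conj hx
  obtain ⟨U, hU⟩ := S.conj_int (x + conj x) (hx.add hc) (by rw [map_add, S.conj_conj, add_comm])
  obtain ⟨N, hN⟩ := S.conj_int (x * conj x) (hx.mul hc) (by rw [map_mul, S.conj_conj, mul_comm])
  obtain ⟨u, v, rfl⟩ := S.L_rep x
  simp only [map_add, map_mul, AlgEquiv.commutes, S.hconj] at hU hN ⊢
  have hU' : 2 * u = U := by
    apply (algebraMap ℚ L).injective
    simp only [map_mul, map_ofNat, map_intCast]
    linear_combination hU
  have hN' : u ^ 2 + ℓ * v ^ 2 = N := by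
    apply (algebraMap ℚ L).injective
    simp only [map_mul, map_natCast, map_intCast, map_pow, map_add]
    linear_combination hN + (algebraMap ℚ L v) ^ 2 * S.hα
  have h4 : (ℓ : ℚ) * (2 * v) ^ 2 = ((4 * N - U ^ 2 : ℤ) : ℚ) := by
    push_cast; rw [← hN', ← hU']; ring
  have key : ∃ w : ℤ, 2 * v = w := by
    rcases hf with ⟨-, hs⟩ | ⟨m, rfl, hs, hm⟩
    · exact sqf_rat ℓ hs _ _ h4
    · have h5 : (m : ℚ) * (4 * v) ^ 2 = ((4 * N - U ^ 2 : ℤ) : ℚ) := by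
        rw [← h4]; push_cast; ring
      obtain ⟨w, hw⟩ := sqf_rat m hs _ _ h5
      rw [hw] at h5
      have h6 : (m : ℤ) * w ^ 2 = 4 * N - U ^ 2 := by exact_mod_cast h5
      rcases Int.even_or_odd w with ⟨k, hk⟩ | ⟨k, hk⟩
      · refine ⟨k, ?_⟩
        rw [hk] at hw
        push_cast at hw
        linarith
      · exfalso
        have h7 : ((m : ℤ) + U ^ 2) % 4 = 0 := by
          have : (m : ℤ) + U ^ 2 = 4 * (N - m * (k ^ 2 + k)) := by
            rw [hk] at h6; linear_combination h6
          omega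
        rcases Int.even_or_odd U with ⟨j, hj⟩ | ⟨j, hj⟩
        · have : U ^ 2 = 4 * (j ^ 2) := by rw [hj]; ring
          omega
        · have : U ^ 2 = 4 * (j ^ 2 + j) + 1 := by rw [hj]; ring
          omega
  obtain ⟨w, hw⟩ := key
  refine ⟨w, ?_⟩
  have : algebraMap ℚ L (2 * v) = w := by rw [hw]; simp
  rw [← this]
  simp only [map_mul, map_ofNat]
  ring

lemma intω (hf : Fund ℓ) : IsIntegral ℤ (((ℓ : L) + α) / 2) := by
  have h4 : 4 ∣ ℓ ^ 2 + ℓ := by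
    rcases hf with ⟨h, -⟩ | ⟨m, rfl, -, -⟩
    · obtain ⟨k, rfl⟩ : ∃ k, ℓ = 4 * k + 3 := ⟨ℓ / 4, by omega⟩
      exact ⟨4 * k ^ 2 + 7 * k + 3, by ring⟩
    · exact ⟨4 * m ^ 2 + m, by ring⟩
  obtain ⟨k, hk⟩ := h4
  have hk' : (ℓ : L) ^ 2 + ℓ = 4 * k := by exact_mod_cast hk
  refine ⟨Polynomial.X ^ 2 - Polynomial.C (ℓ : ℤ) * Polynomial.X + Polynomial.C (k : ℤ), ?_, ?_⟩
  · monicity!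
  · simp [Polynomial.eval₂_add, Polynomial.eval₂_sub, Polynomial.eval₂_mul, Polynomial.eval₂_pow]
    linear_combination (1 / 4 : L) * S.hα - (1 / 4 : L) * hk'

lemma nil_L (hf : Fund ℓ) (q : ℕ) (hq : q.Prime) (hqℓ : ¬ q ∣ ℓ) (x : L) (h : Nil L q x) : IsIntegral ℤ (x / q) := by
  have key : ∀ y : L, IsIntegral ℤ y → IsIntegral ℤ ((x * y + conj (x * y)) / q) := by
    intro y hy
    have h1 : Nil L q (x * y + conj (x * y)) := (h.mul hy).add ((h.mul hy).aut hq.ne_zero conj)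
    obtain ⟨z, hz⟩ := S.conj_int _ h1.int (by rw [map_add, S.conj_conj, add_comm])
    rw [hz] at h1 ⊢
    obtain ⟨w, rfl⟩ := h1.dvd hq
    have : (q : L) ≠ 0 := by exact_mod_cast hq.ne_zero
    push_cast
    rw [mul_div_cancel_left₀ _ this]
    exact int_intCast w
  have hω := S.intω hf
  have k0 := key 1 isIntegral_one
  have k1 := key _ hω
  have hcω := int_aut conj hω
  have hcop : Nat.Coprime ℓ q := by
    rw [Nat.coprime_comm, hq.coprime_iff_not_dvd]; exact hqℓ
  apply int_cop ℓ q hq.ne_zero hcop x h.int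
  have e : (ℓ : L) * x / q = -α * ((x * (((ℓ : L) + α) / 2) + conj (x * (((ℓ : L) + α) / 2))) / q
      - (x * 1 + conj (x * 1)) / q * conj (((ℓ : L) + α) / 2)) := by
    simp only [map_mul, map_div₀, map_add, map_natCast, map_ofNat, S.hconj, mul_one]
    have : (q : L) ≠ 0 := by exact_mod_cast hq.ne_zero
    field_simp
    linear_combination (2 * x) * S.hα
  rw [e]
  exact S.intα.neg.mul (k1.sub (k0.mul hcω))

lemma rad_q (hf : Fund ℓ) (q : ℕ) (hq : q.Prime) (hqℓ : ¬ q ∣ ℓ) (hqp : q ≠ p) (x : K) (hx : IsIntegral ℤ x)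
    (h : IsIntegral ℤ (x ^ 2 / q)) : IsIntegral ℤ (x / q) := by
  have hN : Nil K q x := Nil.of hq.ne_zero hx 2 h
  have hcop : Nat.Coprime p q := (Nat.coprime_primes S.hp hq).2 (Ne.symm hqp)
  apply int_cop p q hq.ne_zero hcop x hx
  rw [S.dualsum, Finset.sum_div]
  apply IsIntegral.sum
  intro i _
  set t := Algebra.trace L K (x * S.ζ⁻¹ ^ i) with ht
  have h1 : Nil K q (algebraMap L K t) := by
    rw [ht, S.trace_eq]
    exact Nil.sum _ _ fun j _ => (hN.mul (S.intζi.pow i)).aut hq.ne_zero _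
  obtain ⟨M, hM⟩ := h1.pow hq.ne_zero
  have h2 : Nil L q t := Nil.of hq.ne_zero (intL.1 h1.int) M (by
    rw [← intL (K := K)]
    simpa using hM)
  have h3 := intL (K := K) |>.2 (S.nil_L hf q hq hqℓ t h2)
  rw [map_div₀, map_natCast] at h3
  rw [mul_div_right_comm]
  exact h3.mul (S.intζ.pow i)

lemma rad_pi (hf : Fund ℓ) (x : K) (hx : IsIntegral ℤ x)
    (h : IsIntegral ℤ (x ^ 2 / (1 - S.ζ))) : IsIntegral ℤ (x / (1 - S.ζ)) := by
  obtain ⟨c, hc, hxc⟩ := S.rep hx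
  set C := ∑ i ∈ Finset.range p, c i with hC
  have hCi : IsIntegral ℤ C := IsIntegral.sum _ fun i _ => hc i
  have hCK : IsIntegral ℤ (algebraMap L K C) := intL.2 hCi
  have h1 : IsIntegral ℤ ((algebraMap L K C - x) / (1 - S.ζ)) := by
    have : algebraMap L K C - x = ∑ i ∈ Finset.range p, algebraMap L K (c i) * (1 - S.ζ ^ i) := by
      rw [hxc, hC, map_sum, ← Finset.sum_sub_distrib]
      exact Finset.sum_congr rfl fun i _ => by ring
    rw [this, Finset.sum_div]
    apply IsIntegral.sum
    intro i _
    rw [mul_div_assoc]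
    exact (intL.2 (hc i)).mul (S.one_sub_pow i)
  have h2 : IsIntegral ℤ (algebraMap L K (C ^ 2) / (1 - S.ζ)) := by
    have e : algebraMap L K (C ^ 2) / (1 - S.ζ) = x ^ 2 / (1 - S.ζ) +
      (algebraMap L K C - x) / (1 - S.ζ) * (algebraMap L K C + x) := by rw [map_pow]; ring
    rw [e]
    exact h.add (h1.mul (hCK.add hx))
  have h3 := S.L_of_pi _ (hCi.pow 2) h2
  have h4 := S.nil_L hf p S.hp S.hpℓ C (Nil.of S.hp.ne_zero hCi 2 h3)
  have h5 : IsIntegral ℤ (algebraMap L K C / (1 - S.ζ)) := by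
    have e : algebraMap L K C / (1 - S.ζ) = algebraMap L K (C / p) * (p / (1 - S.ζ)) := by
      rw [map_div₀, map_natCast]
      have := S.pK0
      field_simp
    rw [e]
    exact (intL.2 h4).mul S.p_div
  have e : x / (1 - S.ζ) = algebraMap L K C / (1 - S.ζ) - (algebraMap L K C - x) / (1 - S.ζ) := by ring
  rw [e]
  exact h5.sub h1

lemma τ_sub (hf : Fund ℓ) {x : K} (hx : IsIntegral ℤ x) : IsIntegral ℤ ((S.τ x - x) / algebraMap L K α) := by
  obtain ⟨c, hc, rfl⟩ := S.rep hx
  rw [map_sum, ← Finset.sum_sub_distrib, Finset.sum_div]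
  apply IsIntegral.sum
  intro i _
  obtain ⟨z, hz⟩ := S.sub_conj hf (c i) (hc i)
  have e : (S.τ (algebraMap L K (c i) * S.ζ ^ i) - algebraMap L K (c i) * S.ζ ^ i) / algebraMap L K α = -(z : K) * S.ζ ^ i := by
    rw [map_mul, map_pow, S.τζ, S.τL, div_eq_iff S.A0]
    have := congrArg (algebraMap L K) hz
    simp only [map_sub, map_mul, map_intCast] at this
    linear_combination (-S.ζ ^ i) * this
  rw [e]
  exact (int_intCast z).neg.mul (S.intζ.pow i)

end Setup

section ordmach
variable {K : Type} [Field K] [NumberField K]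

noncomputable def ordQ (Q : HeightOneSpectrum (𝓞 K)) (x : K) : ℤ := -WithZero.log (Q.valuation K x)

lemma vne (Q : HeightOneSpectrum (𝓞 K)) {x : K} (hx : x ≠ 0) : Q.valuation K x ≠ 0 :=
  (Valuation.ne_zero_iff _).2 hx

lemma ordQ_mul (Q : HeightOneSpectrum (𝓞 K)) {x y : K} (hx : x ≠ 0) (hy : y ≠ 0) :
    ordQ Q (x * y) = ordQ Q x + ordQ Q y := by
  simp only [ordQ, map_mul]
  rw [WithZero.log_mul (vne Q hx) (vne Q hy)]; ring

lemma ordQ_inv (Q : HeightOneSpectrum (𝓞 K)) (x : K) : ordQ Q x⁻¹ = - ordQ Q x := by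
  simp only [ordQ, map_inv₀, WithZero.log_inv]

lemma ordQ_div (Q : HeightOneSpectrum (𝓞 K)) {x y : K} (hx : x ≠ 0) (hy : y ≠ 0) :
    ordQ Q (x / y) = ordQ Q x - ordQ Q y := by
  rw [div_eq_mul_inv, ordQ_mul Q hx (inv_ne_zero hy), ordQ_inv]; ring

lemma ordQ_pow (Q : HeightOneSpectrum (𝓞 K)) (x : K) (n : ℕ) : ordQ Q (x ^ n) = n * ordQ Q x := by
  simp only [ordQ, map_pow, WithZero.log_pow]; simp

lemma ordQ_zpow (Q : HeightOneSpectrum (𝓞 K)) (x : K) (n : ℤ) : ordQ Q (x ^ n) = n * ordQ Q x := by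
  simp only [ordQ, map_zpow₀, WithZero.log_zpow]; simp

lemma ordQ_neg (Q : HeightOneSpectrum (𝓞 K)) (x : K) : ordQ Q (-x) = ordQ Q x := by
  simp only [ordQ, Valuation.map_neg]

lemma ordQ_one (Q : HeightOneSpectrum (𝓞 K)) : ordQ Q 1 = 0 := by
  simp [ordQ]

lemma ordQ_prod (Q : HeightOneSpectrum (𝓞 K)) {ι : Type*} (s : Finset ι) (f : ι → K) (h : ∀ i ∈ s, f i ≠ 0) :
    ordQ Q (∏ i ∈ s, f i) = ∑ i ∈ s, ordQ Q (f i) := by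
  classical
  induction s using Finset.induction_on with
  | empty => simp [ordQ_one]
  | insert a s ha ih =>
    rw [Finset.prod_insert ha, Finset.sum_insert ha, ordQ_mul Q (h _ (by simp))
      (Finset.prod_ne_zero_iff.2 fun i hi => h i (by simp [hi])), ih fun i hi => h i (by simp [hi])]

lemma v_le_iff (Q : HeightOneSpectrum (𝓞 K)) {x : K} (hx : x ≠ 0) : Q.valuation K x ≤ 1 ↔ 0 ≤ ordQ Q x := by
  rw [ordQ, neg_nonneg, WithZero.log_le_iff_le_exp (vne Q hx), WithZero.exp_zero]

lemma v_lt_iff (Q : HeightOneSpectrum (𝓞 K)) {x : K} (hx : x ≠ 0) : Q.valuation K x < 1 ↔ 0 < ordQ Q x := by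
  rw [ordQ, neg_pos, WithZero.log_lt_iff_lt_exp (vne Q hx), WithZero.exp_zero]

lemma v_eq_iff (Q : HeightOneSpectrum (𝓞 K)) {x : K} (hx : x ≠ 0) : Q.valuation K x = 1 ↔ ordQ Q x = 0 := by
  have h1 := v_le_iff Q hx
  have h2 := v_lt_iff Q hx
  constructor
  · intro h
    rw [ordQ, h]; simp
  · intro h
    exact le_antisymm (h1.2 h.ge) (not_lt.1 fun h3 => by have := h2.1 h3; omega)

lemma v_int (Q : HeightOneSpectrum (𝓞 K)) {x : K} (hx : IsIntegral ℤ x) : Q.valuation K x ≤ 1 :=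
  Q.valuation_le_one (K := K) (⟨x, hx⟩ : 𝓞 K)

lemma ordQ_int (Q : HeightOneSpectrum (𝓞 K)) {x : K} (hx0 : x ≠ 0) (hx : IsIntegral ℤ x) : 0 ≤ ordQ Q x :=
  (v_le_iff Q hx0).1 (v_int Q hx)

lemma int_of_v {x : K} (h : ∀ Q : HeightOneSpectrum (𝓞 K), Q.valuation K x ≤ 1) : IsIntegral ℤ x := by
  obtain ⟨y, rfl⟩ := HeightOneSpectrum.mem_integers_of_valuation_le_one K x h
  exact y.2

lemma ordQ_unit (Q : HeightOneSpectrum (𝓞 K)) {x : K} (hx0 : x ≠ 0) (hx : IsIntegral ℤ x) (hx' : IsIntegral ℤ x⁻¹) :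
    ordQ Q x = 0 := by
  have h1 := ordQ_int Q hx0 hx
  have h2 := ordQ_int Q (inv_ne_zero hx0) hx'
  rw [ordQ_inv] at h2; omega

noncomputable def phi (γ : K ≃ₐ[ℚ] K) : 𝓞 K ≃+* 𝓞 K := RingOfIntegers.mapRingEquiv (γ : K ≃+* K)

@[simp] lemma phi_apply (γ : K ≃ₐ[ℚ] K) (x : 𝓞 K) : ((phi γ x : 𝓞 K) : K) = γ x := rfl

noncomputable def mv (γ : K ≃ₐ[ℚ] K) (Q : HeightOneSpectrum (𝓞 K)) : HeightOneSpectrum (𝓞 K) where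
  asIdeal := Q.asIdeal.map (phi γ)
  isPrime := Ideal.map_isPrime_of_equiv (phi γ)
  ne_bot := by
    rw [Ne, Ideal.map_eq_bot_iff_of_injective (phi γ).injective]
    exact Q.ne_bot

lemma intv_eq (P Q : HeightOneSpectrum (𝓞 K)) (X Y : 𝓞 K) (hX : X ≠ 0) (hY : Y ≠ 0)
    (h : ∀ n : ℕ, X ∈ Q.asIdeal ^ n ↔ Y ∈ P.asIdeal ^ n) : P.intValuation Y = Q.intValuation X := by
  apply le_antisymm
  · rw [Q.intValuation_eq_exp_neg_multiplicity hX, HeightOneSpectrum.intValuation_le_pow_iff_mem, ← h,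
      ← HeightOneSpectrum.intValuation_le_pow_iff_mem, Q.intValuation_eq_exp_neg_multiplicity hX]
  · rw [P.intValuation_eq_exp_neg_multiplicity hY, HeightOneSpectrum.intValuation_le_pow_iff_mem, h,
      ← HeightOneSpectrum.intValuation_le_pow_iff_mem, P.intValuation_eq_exp_neg_multiplicity hY]

lemma v_mv (γ : K ≃ₐ[ℚ] K) (Q : HeightOneSpectrum (𝓞 K)) (x : K) :
    (mv γ Q).valuation K (γ x) = Q.valuation K x := by
  have key : ∀ X : 𝓞 K, (mv γ Q).valuation K (γ X) = Q.valuation K (X : K) := by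
    intro X
    by_cases hX : X = 0
    · simp [hX]
    · rw [← phi_apply]
      change (mv γ Q).valuation K (algebraMap _ _ (phi γ X)) = Q.valuation K (algebraMap _ _ X)
      rw [HeightOneSpectrum.valuation_of_algebraMap, HeightOneSpectrum.valuation_of_algebraMap]
      apply intv_eq _ _ _ _ hX (by simpa using hX)
      intro n
      simp only [mv]
      rw [← Ideal.map_pow]
      constructor
      · intro h; exact Ideal.mem_map_of_mem _ h
      · intro h
        obtain ⟨Z, hZ, hZX⟩ := (Ideal.mem_map_of_equiv (phi γ) _).1 h
        rwa [← (phi γ).injective hZX]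
  obtain ⟨a, b, hb, rfl⟩ := IsFractionRing.div_surjective (A := 𝓞 K) x
  rw [map_div₀, map_div₀, map_div₀]
  rw [key, key]

lemma ordQ_mv (γ : K ≃ₐ[ℚ] K) (Q : HeightOneSpectrum (𝓞 K)) (x : K) : ordQ (mv γ Q) (γ x) = ordQ Q x := by
  rw [ordQ, v_mv, ordQ]

lemma mem_iff_v (Q : HeightOneSpectrum (𝓞 K)) (X : 𝓞 K) : X ∈ Q.asIdeal ↔ Q.valuation K (X : K) < 1 :=
  (Q.valuation_lt_one_iff_mem (K := K) X).symm

lemma mv_eq_of (P Q : HeightOneSpectrum (𝓞 K)) (γ : K ≃ₐ[ℚ] K)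
    (h : ∀ x, IsIntegral ℤ x → (Q.valuation K x < 1 ↔ P.valuation K (γ x) < 1)) : mv γ Q = P := by
  apply HeightOneSpectrum.ext
  ext X
  rw [mem_iff_v, mem_iff_v]
  have h1 : γ (γ.symm (X : K)) = X := γ.apply_symm_apply _
  rw [← h1, v_mv]
  exact h _ (Setup.int_aut γ.symm X.2)

lemma mv_mul (γ δ : K ≃ₐ[ℚ] K) (Q : HeightOneSpectrum (𝓞 K)) : mv (γ * δ) Q = mv γ (mv δ Q) := by
  apply mv_eq_of
  intro x hx
  rw [AlgEquiv.mul_apply, v_mv, v_mv]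

lemma mv_one (Q : HeightOneSpectrum (𝓞 K)) : mv (1 : K ≃ₐ[ℚ] K) Q = Q := by
  apply mv_eq_of
  intro x hx
  rfl


/-- congruence modulo the maximal ideal -/
def CQ (Q : HeightOneSpectrum (𝓞 K)) (x y : K) : Prop := Q.valuation K (x - y) < 1

lemma CQ.refl (Q : HeightOneSpectrum (𝓞 K)) (x : K) : CQ Q x x := by simp [CQ]

lemma CQ.symm {Q : HeightOneSpectrum (𝓞 K)} {x y : K} (h : CQ Q x y) : CQ Q y x := by
  rw [CQ, Valuation.map_sub_swap]; exact h

lemma CQ.add {Q : HeightOneSpectrum (𝓞 K)} {x y x' y' : K} (h : CQ Q x y) (h' : CQ Q x' y') :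
    CQ Q (x + x') (y + y') := by
  rw [CQ, add_sub_add_comm]
  exact Valuation.map_add_lt _ h h'

lemma CQ.neg {Q : HeightOneSpectrum (𝓞 K)} {x y : K} (h : CQ Q x y) : CQ Q (-x) (-y) := by
  rw [CQ, neg_sub_neg]; exact h.symm

lemma CQ.sub {Q : HeightOneSpectrum (𝓞 K)} {x y x' y' : K} (h : CQ Q x y) (h' : CQ Q x' y') :
    CQ Q (x - x') (y - y') := by
  rw [sub_eq_add_neg, sub_eq_add_neg]; exact h.add h'.neg

lemma CQ.trans {Q : HeightOneSpectrum (𝓞 K)} {x y z : K} (h : CQ Q x y) (h' : CQ Q y z) : CQ Q x z := by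
  rw [CQ, ← sub_add_sub_cancel x y z]
  exact Valuation.map_add_lt _ h h'

lemma CQ.mul_left {Q : HeightOneSpectrum (𝓞 K)} {x y : K} (h : CQ Q x y) {z : K} (hz : Q.valuation K z ≤ 1) :
    CQ Q (z * x) (z * y) := by
  rw [CQ, ← mul_sub, map_mul]
  exact lt_of_le_of_lt (mul_le_of_le_one_left' hz) h

lemma CQ.mul_right {Q : HeightOneSpectrum (𝓞 K)} {x y : K} (h : CQ Q x y) {z : K} (hz : Q.valuation K z ≤ 1) :
    CQ Q (x * z) (y * z) := by
  rw [mul_comm x, mul_comm y]; exact h.mul_left hz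

lemma CQ.le {Q : HeightOneSpectrum (𝓞 K)} {x y : K} (h : CQ Q x y) (hx : Q.valuation K x ≤ 1) : Q.valuation K y ≤ 1 := by
  have : y = x + (y - x) := by ring
  rw [this]
  exact Valuation.map_add_le _ hx (le_of_lt h.symm)

lemma CQ.mul {Q : HeightOneSpectrum (𝓞 K)} {x y x' y' : K} (h : CQ Q x y) (h' : CQ Q x' y')
    (hx : Q.valuation K x ≤ 1) (hx' : Q.valuation K x' ≤ 1) : CQ Q (x * x') (y * y') :=
  (h.mul_right hx').trans (h'.mul_left (h.le hx))

lemma v_pow_le {Q : HeightOneSpectrum (𝓞 K)} {x : K} (h : Q.valuation K x ≤ 1) (n : ℕ) : Q.valuation K (x ^ n) ≤ 1 := by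
  rw [map_pow]; exact pow_le_one' h n

lemma CQ.pow {Q : HeightOneSpectrum (𝓞 K)} {x y : K} (h : CQ Q x y) (hx : Q.valuation K x ≤ 1) (n : ℕ) :
    CQ Q (x ^ n) (y ^ n) := by
  induction n with
  | zero => simpa using CQ.refl Q 1
  | succ n ih =>
    rw [pow_succ, pow_succ]
    exact ih.mul h (v_pow_le hx n) hx

lemma CQ.sum {Q : HeightOneSpectrum (𝓞 K)} {ι : Type*} (s : Finset ι) (f g : ι → K) (h : ∀ i ∈ s, CQ Q (f i) (g i)) :
    CQ Q (∑ i ∈ s, f i) (∑ i ∈ s, g i) := by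
  classical
  induction s using Finset.induction_on with
  | empty => simpa using CQ.refl Q 0
  | insert a s ha ih =>
    rw [Finset.sum_insert ha, Finset.sum_insert ha]
    exact (h _ (by simp)).add (ih fun i hi => h i (by simp [hi]))

lemma CQ.prod {Q : HeightOneSpectrum (𝓞 K)} {ι : Type*} (s : Finset ι) (f g : ι → K) (h : ∀ i ∈ s, CQ Q (f i) (g i))
    (hf : ∀ i ∈ s, Q.valuation K (f i) ≤ 1) :
    CQ Q (∏ i ∈ s, f i) (∏ i ∈ s, g i) := by
  classical
  induction s using Finset.induction_on with
  | empty => simpa using CQ.refl Q 1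
  | insert a s ha ih =>
    rw [Finset.prod_insert ha, Finset.prod_insert ha]
    refine (h _ (by simp)).mul (ih (fun i hi => h i (by simp [hi])) fun i hi => hf i (by simp [hi])) (hf _ (by simp)) ?_
    rw [map_prod]
    exact Finset.prod_le_one' fun i hi => hf i (by simp [hi])

lemma CQ.cancel {Q : HeightOneSpectrum (𝓞 K)} {x y z : K} (h : CQ Q (z * x) (z * y)) (hz : Q.valuation K z = 1) :
    CQ Q x y := by
  rw [CQ, ← mul_sub, map_mul, hz, one_mul] at h; exact h

lemma CQ.sq_one {Q : HeightOneSpectrum (𝓞 K)} {x : K} (h : CQ Q (x ^ 2) 1) : CQ Q x 1 ∨ CQ Q x (-1) := by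
  by_contra hh
  push Not at hh
  obtain ⟨h1, h2⟩ := hh
  rw [CQ, not_lt] at h1 h2
  have e : x ^ 2 - 1 = (x - 1) * (x - -1) := by ring
  rw [CQ, e, map_mul] at h
  exact absurd h (not_lt.2 (one_le_mul h1 h2))

lemma exists_unif (Q : HeightOneSpectrum (𝓞 K)) : ∃ π : K, π ≠ 0 ∧ ordQ Q π = 1 := by
  obtain ⟨π, h⟩ := Q.valuation_exists_uniformizer K
  refine ⟨π, ?_, ?_⟩
  · rintro rfl
    rw [map_zero] at h
    exact WithZero.exp_ne_zero h.symm
  · rw [ordQ, h]; simp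

/-- the residue field is finite: a common exponent -/
lemma exists_frob (Q : HeightOneSpectrum (𝓞 K)) : ∃ N : ℕ, 1 < N ∧ Q.valuation K (N : K) < 1 ∧
    ∀ x : K, Q.valuation K x ≤ 1 → Q.valuation K (x ^ N - x) < 1 := by
  have : Finite (𝓞 K ⧸ Q.asIdeal) := Ideal.finiteQuotientOfFreeOfNeBot _ Q.ne_bot
  have hm : Q.asIdeal.IsMaximal := Q.isMaximal
  let _ := Ideal.Quotient.field Q.asIdeal
  have := Fintype.ofFinite (𝓞 K ⧸ Q.asIdeal)
  refine ⟨Fintype.card (𝓞 K ⧸ Q.asIdeal), Fintype.one_lt_card, ?_, ?_⟩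
  · have : ((Fintype.card (𝓞 K ⧸ Q.asIdeal) : 𝓞 K)) ∈ Q.asIdeal := by
      rw [← Ideal.Quotient.eq_zero_iff_mem, map_natCast]
      exact FiniteField.cast_card_eq_zero _
    rw [mem_iff_v] at this
    simpa using this
  · intro x hx
    obtain ⟨X, hX⟩ := HeightOneSpectrum.exists_valuation_sub_lt_of_integer (K := K) Q hx 1
    have h1 : X ^ Fintype.card (𝓞 K ⧸ Q.asIdeal) - X ∈ Q.asIdeal := by
      rw [← Ideal.Quotient.eq_zero_iff_mem, map_sub, map_pow, FiniteField.pow_card, sub_self]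
    rw [mem_iff_v] at h1
    simp only [Units.val_one] at hX
    have hX : CQ Q (X : K) x := hX
    have hX1 : Q.valuation K (X : K) ≤ 1 := v_int Q X.2
    have h2 : CQ Q ((X : K) ^ Fintype.card (𝓞 K ⧸ Q.asIdeal)) X := by
      simpa [CQ] using h1
    exact ((hX.pow hX1 _).symm.trans h2).trans hX

end ordmach

section
variable {K : Type} [Field K] [NumberField K]

lemma v_mul_lt {Q : HeightOneSpectrum (𝓞 K)} {x y : K} (hx : Q.valuation K x < 1) (hy : Q.valuation K y ≤ 1) :
    Q.valuation K (x * y) < 1 := by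
  rw [map_mul]; exact lt_of_le_of_lt (mul_le_of_le_one_right' hy) hx

lemma v_int_dvd {Q : HeightOneSpectrum (𝓞 K)} {r : ℕ} (h : Q.valuation K (r : K) < 1) {z : ℤ} (hz : (r : ℤ) ∣ z) :
    Q.valuation K (z : K) < 1 := by
  obtain ⟨k, rfl⟩ := hz
  push_cast
  exact v_mul_lt h (v_int Q (int_intCast k))

lemma v_nat_cop {Q : HeightOneSpectrum (𝓞 K)} {q m : ℕ} (h : Q.valuation K (q : K) < 1) (hc : Nat.Coprime q m) :
    Q.valuation K (m : K) = 1 := by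
  obtain ⟨u, v, huv⟩ := Nat.isCoprime_iff_coprime.2 hc
  apply le_antisymm (v_int Q (int_natCast m))
  by_contra hlt
  push Not at hlt
  have h1 : ((u : K) * q + v * m) = 1 := by exact_mod_cast huv
  have h2 : Q.valuation K ((u : K) * q + v * m) < 1 := by
    apply Valuation.map_add_lt
    · rw [mul_comm]; exact v_mul_lt h (v_int Q (int_intCast u))
    · rw [mul_comm]; exact v_mul_lt hlt (v_int Q (int_intCast v))
  rw [h1] at h2
  simp at h2

lemma exists_prime (Q : HeightOneSpectrum (𝓞 K)) : ∃ q : ℕ, q.Prime ∧ Q.valuation K (q : K) < 1 := by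
  obtain ⟨N, hN, h, -⟩ := exists_frob Q
  have key : ∀ M : ℕ, M ≠ 0 → Q.valuation K (M : K) < 1 → ∃ q : ℕ, q.Prime ∧ Q.valuation K (q : K) < 1 := by
    intro M
    induction M using Nat.recOnMul with
    | zero => simp
    | one => simp
    | prime q hq => intro _ h; exact ⟨q, hq, h⟩
    | mul a b ha hb =>
      intro h0 h1
      rw [Nat.cast_mul, map_mul] at h1
      by_cases h2 : Q.valuation K (a : K) < 1
      · exact ha (by rintro rfl; simp at h0) h2
      · apply hb (by rintro rfl; simp at h0)
        by_contra h3
        exact absurd h1 (not_lt.2 (one_le_mul (not_lt.1 h2) (not_lt.1 h3)))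
  exact key N (by omega) h

lemma stab_v {Q : HeightOneSpectrum (𝓞 K)} {γ : K ≃ₐ[ℚ] K} (h : mv γ Q = Q) (x : K) :
    Q.valuation K (γ x) = Q.valuation K x := by
  nth_rw 1 [← h]; exact v_mv γ Q x

lemma stab_ord {Q : HeightOneSpectrum (𝓞 K)} {γ : K ≃ₐ[ℚ] K} (h : mv γ Q = Q) (x : K) :
    ordQ Q (γ x) = ordQ Q x := by
  nth_rw 1 [← h]; exact ordQ_mv γ Q x

lemma frob_of_stab (Q : HeightOneSpectrum (𝓞 K)) (γ : K ≃ₐ[ℚ] K) (h : mv γ Q = Q) (r : ℕ) (hr : r.Prime)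
    (hrQ : Q.valuation K (r : K) < 1) : ∃ j : ℕ, ∀ x : K, IsIntegral ℤ x → CQ Q (γ x) (x ^ (r ^ j)) := by
  have hfr : Fact r.Prime := ⟨hr⟩
  have hfin : Finite (𝓞 K ⧸ Q.asIdeal) := Ideal.finiteQuotientOfFreeOfNeBot _ Q.ne_bot
  have hm : Q.asIdeal.IsMaximal := Q.isMaximal
  let _ := Ideal.Quotient.field Q.asIdeal
  have hr0 : ((r : ℕ) : 𝓞 K ⧸ Q.asIdeal) = 0 := by
    rw [← map_natCast (Ideal.Quotient.mk Q.asIdeal), Ideal.Quotient.eq_zero_iff_mem, mem_iff_v]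
    simpa using hrQ
  have hch : CharP (𝓞 K ⧸ Q.asIdeal) r := (CharP.charP_iff_prime_eq_zero hr).2 hr0
  let _ : Algebra (ZMod r) (𝓞 K ⧸ Q.asIdeal) := ZMod.algebra _ r
  have hQ : Q.asIdeal = Q.asIdeal.map (phi γ : 𝓞 K →+* 𝓞 K) := by
    conv_lhs => rw [← h]
    rfl
  let e := Ideal.quotientEquiv Q.asIdeal Q.asIdeal (phi γ) hQ
  let E : (𝓞 K ⧸ Q.asIdeal) ≃ₐ[ZMod r] (𝓞 K ⧸ Q.asIdeal) := AlgEquiv.ofRingEquiv (f := e) (by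
    intro x
    exact DFunLike.congr_fun (Subsingleton.elim (e.toRingHom.comp (algebraMap (ZMod r) (𝓞 K ⧸ Q.asIdeal))) (algebraMap (ZMod r) (𝓞 K ⧸ Q.asIdeal))) x)
  obtain ⟨j, hj⟩ := (FiniteField.bijective_frobeniusAlgEquivOfAlgebraic_pow (ZMod r) (𝓞 K ⧸ Q.asIdeal)).2 E
  refine ⟨j.1, ?_⟩
  intro x hx
  obtain ⟨X, rfl⟩ : ∃ X : 𝓞 K, (X : K) = x := ⟨⟨x, hx⟩, rfl⟩
  have h1 : E (Ideal.Quotient.mk _ X) = Ideal.Quotient.mk _ (phi γ X) := rfl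
  have h2 : E (Ideal.Quotient.mk _ X) = (Ideal.Quotient.mk _ X) ^ (r ^ j.1) := by
    rw [← hj]
    simp only []
    rw [AlgEquiv.coe_pow, FiniteField.coe_frobeniusAlgEquivOfAlgebraic_iterate, ZMod.card]
  have h3 : phi γ X - X ^ (r ^ j.1) ∈ Q.asIdeal := by
    rw [← Ideal.Quotient.eq_zero_iff_mem, map_sub, map_pow, ← h1, h2, sub_self]
  rw [mem_iff_v] at h3
  simpa [CQ] using h3
end

namespace Setup
variable {p ℓ : ℕ} {L K : Type} [Field L] [NumberField L] [Field K] [NumberField K] [Algebra L K]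
    {conj : L ≃ₐ[ℚ] L} {α : L} (S : Setup p ℓ L K conj α)
include S

lemma one_sub_inv (k : ℕ) (hk : ¬ p ∣ k) : IsIntegral ℤ ((1 - S.ζ) / (1 - S.ζ ^ k)) := by
  have : Fact p.Prime := ⟨S.hp⟩
  have hk0 : (k : ZMod p) ≠ 0 := by rwa [Ne, ZMod.natCast_eq_zero_iff]
  have h1 : S.ζ ^ (k * ((k : ZMod p)⁻¹).val) = S.ζ ^ 1 := by
    apply S.zpow_eq
    push_cast
    rw [ZMod.natCast_zmod_val, mul_inv_cancel₀ hk0]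
  have h2 : (1 - S.ζ) / (1 - S.ζ ^ k) = ∑ i ∈ Finset.range ((k : ZMod p)⁻¹).val, (S.ζ ^ k) ^ i := by
    rw [div_eq_iff (by
      intro h
      exact S.one_sub_ne k hk (by linear_combination -h)), geom_sum_mul_neg, ← pow_mul, h1, pow_one]
  rw [h2]
  exact IsIntegral.sum _ fun i _ => (S.intζ.pow k).pow i

lemma vζ (Q : HeightOneSpectrum (𝓞 K)) : Q.valuation K S.ζ = 1 := by
  rw [v_eq_iff Q S.ζ0]
  exact ordQ_unit Q S.ζ0 S.intζ S.intζi

lemma vπ (Q : HeightOneSpectrum (𝓞 K)) (k : ℕ) (hk : ¬ p ∣ k) (h : Q.valuation K (p : K) = 1) :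
    Q.valuation K (1 - S.ζ ^ k) = 1 := by
  have h1 := S.p_div.mul (S.one_sub_inv k hk)
  have h0 : 1 - S.ζ ^ k ≠ 0 := fun h => S.one_sub_ne k hk (by linear_combination -h)
  have h2 : (p : K) / (1 - S.ζ) * ((1 - S.ζ) / (1 - S.ζ ^ k)) = p / (1 - S.ζ ^ k) := by
    have := S.pi0
    field_simp
  rw [h2] at h1
  have h3 := ordQ_int Q (div_ne_zero S.pK0 h0) h1
  rw [ordQ_div Q S.pK0 h0, (v_eq_iff Q S.pK0).1 h] at h3
  have h4 := ordQ_int Q h0 (isIntegral_one.sub (S.intζ.pow k))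
  rw [v_eq_iff Q h0]; omega

lemma vA (Q : HeightOneSpectrum (𝓞 K)) (h : Q.valuation K (ℓ : K) = 1) :
    Q.valuation K (algebraMap L K α) = 1 := by
  have h1 : Q.valuation K ((algebraMap L K α) ^ 2) = 1 := by rw [S.A2, Valuation.map_neg, h]
  have hℓ : (ℓ : K) ≠ 0 := by exact_mod_cast S.hℓ.ne'
  rw [v_eq_iff Q (pow_ne_zero 2 S.A0), ordQ_pow] at h1
  rw [v_eq_iff Q S.A0]
  simpa using h1

lemma case_r (r : ℕ) (hr : r.Prime) (hr4 : r % 4 = 3) (hℓr : ℓ < r) (hpr : p < r)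
    (hrp : ¬ IsSquare ((r : ℕ) : ZMod p)) (Q : HeightOneSpectrum (𝓞 K)) (hc : mv S.c Q = Q)
    (hQ : Q.valuation K (r : K) < 1) : False := by
  have : Fact p.Prime := ⟨S.hp⟩
  have : Fact r.Prime := ⟨hr⟩
  obtain ⟨j, hj⟩ := frob_of_stab Q S.c hc r hr hQ
  have hvp : Q.valuation K (p : K) = 1 := v_nat_cop hQ ((Nat.coprime_primes hr S.hp).2 (by omega))
  have hcopℓ : Nat.Coprime r ℓ := by
    rw [hr.coprime_iff_not_dvd]
    intro h
    have := Nat.le_of_dvd S.hℓ h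
    omega
  have hvℓ : Q.valuation K (ℓ : K) = 1 := v_nat_cop hQ hcopℓ
  have hv2 : Q.valuation K ((2 : ℕ) : K) = 1 := v_nat_cop hQ ((Nat.coprime_primes hr Nat.prime_two).2 (by omega))
  have h1 := hj _ S.intζ
  rw [S.cζ] at h1
  have hdvd : p ∣ r ^ j + 1 := by
    by_contra hnd
    have h2 := S.vπ Q _ hnd hvp
    have h3 := h1.mul_left (z := S.ζ) (S.vζ Q).le
    rw [mul_inv_cancel₀ S.ζ0, ← pow_succ', CQ, h2] at h3
    exact lt_irrefl _ h3
  have hrj : ((r : ℕ) : ZMod p) ^ j = -1 := by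
    have := (ZMod.natCast_eq_zero_iff _ p).2 hdvd
    push_cast at this
    linear_combination this
  have hjev : Even j := by
    by_contra hodd
    rw [Nat.not_even_iff_odd] at hodd
    obtain ⟨i, rfl⟩ := hodd
    apply hrp
    obtain ⟨e, he⟩ := (ZMod.exists_sq_eq_neg_one_iff (p := p)).2 (by have := S.hp1; omega)
    have hr0 : ((r : ℕ) : ZMod p) ≠ 0 := by
      intro h
      apply hrp
      rw [h]; exact ⟨0, by simp⟩
    refine ⟨e * (((r : ℕ) : ZMod p) ^ i)⁻¹, ?_⟩
    have : ((r : ℕ) : ZMod p) ^ i ≠ 0 := pow_ne_zero _ hr0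
    field_simp
    linear_combination hrj + he
  obtain ⟨i, rfl⟩ := hjev
  obtain ⟨m, hm⟩ : ∃ m, r ^ (i + i) = 1 + 2 * ((r - 1) * m) := by
    obtain ⟨b, hb⟩ : ∃ b, r = 2 * b + 1 := ⟨r / 2, by omega⟩
    obtain ⟨w, hw⟩ : r ^ 2 - 1 ∣ (r ^ 2) ^ i - 1 := by simpa using Nat.sub_dvd_pow_sub_pow (r ^ 2) 1 i
    refine ⟨(b + 1) * w, ?_⟩
    have e1 : r ^ (i + i) = (r ^ 2) ^ i := by rw [← pow_mul]; congr 1; ring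
    have e2 : 1 ≤ (r ^ 2) ^ i := Nat.one_le_pow _ _ (pow_pos hr.pos 2)
    have e3 : r ^ 2 - 1 = 2 * ((r - 1) * (b + 1)) := by
      have : r - 1 = 2 * b := by omega
      rw [this, hb]
      have : (2 * b + 1) ^ 2 = 2 * (2 * b * (b + 1)) + 1 := by ring
      omega
    rw [e3] at hw
    rw [e1]
    have e4 : 2 * ((r - 1) * ((b + 1) * w)) = 2 * ((r - 1) * (b + 1)) * w := by ring
    omega
  have h2 := hj _ (intL (K := K) |>.2 S.intα)
  rw [S.cA, hm, pow_add, pow_one, pow_mul, S.A2] at h2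
  have h3 : CQ Q ((-(ℓ : K)) ^ ((r - 1) * m)) 1 := by
    have e : (r : ℤ) ∣ (-(ℓ : ℤ)) ^ ((r - 1) * m) - 1 := by
      rw [← ZMod.intCast_zmod_eq_zero_iff_dvd]
      push_cast
      rw [pow_mul, ZMod.pow_card_sub_one_eq_one, one_pow, sub_self]
      rw [neg_ne_zero, Ne, ZMod.natCast_eq_zero_iff]
      exact (hr.coprime_iff_not_dvd).1 hcopℓ
    have := v_int_dvd hQ e
    push_cast at this
    exact this
  have hvA := S.vA Q hvℓ
  have h4 := h2.trans (h3.mul_left (z := algebraMap L K α) hvA.le)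
  have e : -algebraMap L K α - algebraMap L K α * 1 = -(((2 : ℕ) : K) * algebraMap L K α) := by push_cast; ring
  rw [CQ, e, Valuation.map_neg, map_mul, hvA, hv2, one_mul] at h4
  exact lt_irrefl _ h4

end Setup

section
variable {K : Type} [Field K] [NumberField K]

lemma CQ.inv {Q : HeightOneSpectrum (𝓞 K)} {x y : K} (h : CQ Q x y) (hx : Q.valuation K x = 1) (hy : Q.valuation K y = 1) :
    CQ Q x⁻¹ y⁻¹ := by
  have hx0 : x ≠ 0 := by rintro rfl; simp at hx
  have hy0 : y ≠ 0 := by rintro rfl; simp at hy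
  have e : x⁻¹ - y⁻¹ = (y - x) * (x⁻¹ * y⁻¹) := by field_simp
  rw [CQ, e, map_mul, map_mul, map_inv₀, map_inv₀, hx, hy]
  simp only [inv_one, mul_one]
  exact h.symm

lemma CQ.zpow {Q : HeightOneSpectrum (𝓞 K)} {x y : K} (h : CQ Q x y) (hx : Q.valuation K x = 1) (hy : Q.valuation K y = 1)
    (m : ℤ) : CQ Q (x ^ m) (y ^ m) := by
  obtain ⟨k, rfl | rfl⟩ := m.eq_nat_or_neg
  · simpa using h.pow hx.le k
  · simp only [zpow_neg, zpow_natCast]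
    apply (h.pow hx.le k).inv <;> simp [hx, hy]

lemma v_of_pow {Q : HeightOneSpectrum (𝓞 K)} {x : K} {k : ℕ} (hk : k ≠ 0) (h : Q.valuation K x ^ k = 1) :
    Q.valuation K x = 1 := by
  have hx0 : x ≠ 0 := by rintro rfl; simp [hk] at h
  rw [← map_pow, v_eq_iff Q (pow_ne_zero k hx0), ordQ_pow] at h
  rw [v_eq_iff Q hx0]
  simpa [hk] using h

lemma CQ.v_eq {Q : HeightOneSpectrum (𝓞 K)} {x y : K} (h : CQ Q x y) (hx : Q.valuation K x = 1) :
    Q.valuation K y = 1 := by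
  have h1 := h.le hx.le
  apply le_antisymm h1
  by_contra h2
  push Not at h2
  have : Q.valuation K (x - y + y) < 1 := Valuation.map_add_lt _ h h2
  rw [sub_add_cancel, hx] at this
  exact lt_irrefl _ this

lemma CQ.v_lt {Q : HeightOneSpectrum (𝓞 K)} {x y : K} (h : CQ Q x y) (hx : Q.valuation K x < 1) :
    Q.valuation K y < 1 := by
  have h1 := h.symm
  have : Q.valuation K (y - x + x) < 1 := Valuation.map_add_lt _ h1 hx
  rwa [sub_add_cancel] at this

lemma stab_of_int {Q : HeightOneSpectrum (𝓞 K)} {γ : K ≃ₐ[ℚ] K} (h : ∀ x, IsIntegral ℤ x → CQ Q (γ x) x) :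
    mv γ Q = Q := by
  apply mv_eq_of
  intro x hx
  exact ⟨(h x hx).symm.v_lt, (h x hx).v_lt⟩

lemma cong_of_int {Q : HeightOneSpectrum (𝓞 K)} {γ : K ≃ₐ[ℚ] K} (h : ∀ x, IsIntegral ℤ x → CQ Q (γ x) x)
    {x : K} (hx : Q.valuation K x ≤ 1) : CQ Q (γ x) x := by
  obtain ⟨X, hX⟩ := HeightOneSpectrum.exists_valuation_sub_lt_of_integer (K := K) Q hx 1
  have hX : CQ Q (X : K) x := hX
  have h1 : CQ Q (γ (X : K)) (γ x) := by
    rw [CQ, ← map_sub, stab_v (stab_of_int h)]; exact hX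
  exact (h1.symm.trans (h _ X.2)).trans hX

lemma rad_ord (y : K) (hy0 : y ≠ 0) (hy : IsIntegral ℤ y)
    (h : ∀ x : K, IsIntegral ℤ x → IsIntegral ℤ (x ^ 2 / y) → IsIntegral ℤ (x / y))
    (Q : HeightOneSpectrum (𝓞 K)) : ordQ Q y ≤ 1 := by
  by_contra hlt
  push Not at hlt
  obtain ⟨Y, rfl⟩ : ∃ X : 𝓞 K, (X : K) = y := ⟨⟨y, hy⟩, rfl⟩
  have hY0 : Y ≠ 0 := by rintro rfl; simp at hy0
  have hmem : Y ∈ Q.asIdeal ^ 2 := by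
    rw [← HeightOneSpectrum.intValuation_le_pow_iff_mem, ← HeightOneSpectrum.valuation_of_algebraMap (K := K),
      ← WithZero.log_le_iff_le_exp (vne Q hy0)]
    rw [ordQ] at hlt
    push_cast
    have : WithZero.log ((HeightOneSpectrum.valuation K Q) (Y : K)) ≤ -2 := by omega
    exact this
  rw [← Ideal.span_singleton_le_iff_mem, ← Ideal.dvd_iff_le] at hmem
  obtain ⟨J, hJ⟩ := hmem
  have hJ0 : J ≠ 0 := by
    rintro rfl
    rw [mul_zero, Ideal.zero_eq_bot, Ideal.span_singleton_eq_bot] at hJ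
    exact hY0 hJ
  have hle : Q.asIdeal * J ≤ Q.asIdeal ^ 2 * J := by
    intro X hX
    rw [← hJ, Ideal.mem_span_singleton]
    have h1 : X ^ 2 ∈ Ideal.span {Y} := by
      have : X ^ 2 ∈ (Q.asIdeal * J) ^ 2 := Ideal.pow_mem_pow hX 2
      rw [hJ]
      have e : (Q.asIdeal * J) ^ 2 = (Q.asIdeal ^ 2 * J) * J := by rw [mul_pow, pow_two J, mul_assoc]
      rw [e] at this
      exact Ideal.dvd_iff_le.1 (Dvd.intro J rfl) this
    rw [Ideal.mem_span_singleton] at h1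
    obtain ⟨Z, hZ⟩ := h1
    have hZ' : (X : K) ^ 2 = Y * Z := by
      have := congrArg (algebraMap (𝓞 K) K) hZ
      rw [map_pow, map_mul] at this
      exact this
    have h2 : IsIntegral ℤ ((X : K) / (Y : K)) := by
      apply h (X : K) (RingOfIntegers.isIntegral_coe X)
      rw [hZ', mul_div_cancel_left₀ _ hy0]
      exact RingOfIntegers.isIntegral_coe Z
    obtain ⟨W, hW⟩ : ∃ W : 𝓞 K, (W : K) = X / Y := ⟨⟨_, h2⟩, rfl⟩
    refine ⟨W, ?_⟩
    apply RingOfIntegers.ext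
    change (X : K) = algebraMap (𝓞 K) K (Y * W)
    rw [map_mul]
    change (X : K) = Y * W
    rw [hW, mul_div_cancel₀ _ hy0]
  rw [← Ideal.dvd_iff_le] at hle
  have e : Q.asIdeal ^ 2 * J = (Q.asIdeal * J) * Q.asIdeal := by rw [pow_two, mul_assoc, mul_comm]
  rw [e] at hle
  have h3 : Q.asIdeal ∣ 1 := by
    have hQ0 : Q.asIdeal * J ≠ 0 := mul_ne_zero Q.ne_bot hJ0
    apply (mul_dvd_mul_iff_left hQ0).1
    rwa [mul_one]
  exact Q.isPrime.ne_top (by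
    rw [← Ideal.one_eq_top]
    exact le_antisymm (by rw [Ideal.one_eq_top]; exact le_top) (Ideal.dvd_iff_le.1 h3))
end

namespace Setup
variable {p ℓ : ℕ} {L K : Type} [Field L] [NumberField L] [Field K] [NumberField K] [Algebra L K]
    {conj : L ≃ₐ[ℚ] L} {α : L} (S : Setup p ℓ L K conj α)
include S

lemma intπ : IsIntegral ℤ (1 - S.ζ) := isIntegral_one.sub S.intζ

lemma ord_gπ (Q : HeightOneSpectrum (𝓞 K)) (i : ℕ) : ordQ Q ((S.g ^ i) (1 - S.ζ)) = ordQ Q (1 - S.ζ) := by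
  have hne : (S.g ^ i) (1 - S.ζ) ≠ 0 := (map_ne_zero (S.g ^ i)).2 S.pi0
  have h1 := ordQ_int Q (div_ne_zero hne S.pi0) (S.gsub i)
  have e : (S.g ^ i) (1 - S.ζ) = 1 - S.ζ ^ ((S.a ^ i : (ZMod p)ˣ) : ZMod p).val := by
    rw [map_sub, map_one, S.gpowζ]
  have : Fact p.Prime := ⟨S.hp⟩
  have hnd : ¬ p ∣ ((S.a ^ i : (ZMod p)ˣ) : ZMod p).val := by
    rw [← ZMod.natCast_eq_zero_iff, ZMod.natCast_zmod_val]
    exact Units.ne_zero _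
  have h3 := S.one_sub_inv _ hnd
  rw [← e] at h3
  have h2 := ordQ_int Q (div_ne_zero S.pi0 hne) h3
  rw [ordQ_div Q hne S.pi0] at h1
  rw [ordQ_div Q S.pi0 hne] at h2
  omega

lemma p_pos1 : 0 < p - 1 := by have := S.hp.two_le; omega

lemma ord_p (Q : HeightOneSpectrum (𝓞 K)) : ordQ Q (p : K) = ((p - 1 : ℕ) : ℤ) * ordQ Q (1 - S.ζ) := by
  rw [← S.prod_one_sub, ordQ_prod Q _ _ fun i _ => (map_ne_zero (S.g ^ i)).2 S.pi0]
  rw [Finset.sum_congr rfl fun i _ => S.ord_gπ Q i]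
  simp

lemma ord_π_one (hf : Fund ℓ) (Q : HeightOneSpectrum (𝓞 K)) (hQ : Q.valuation K (p : K) < 1) :
    ordQ Q (1 - S.ζ) = 1 := by
  rw [v_lt_iff Q S.pK0, S.ord_p Q] at hQ
  have h1 := rad_ord _ S.pi0 S.intπ (S.rad_pi hf) Q
  have h2 := pos_of_mul_pos_right hQ (by positivity)
  omega

lemma g_cong (hf : Fund ℓ) (Q : HeightOneSpectrum (𝓞 K)) (hQ : Q.valuation K (p : K) < 1) (x : K)
    (hx : IsIntegral ℤ x) : CQ Q (S.g x) x := by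
  have h1 := S.g_sub hx
  have e : S.g x - x = (1 - S.ζ) * ((S.g x - x) / (1 - S.ζ)) := by
    rw [mul_div_cancel₀ _ S.pi0]
  rw [CQ, e]
  apply v_mul_lt _ (v_int Q h1)
  rw [v_lt_iff Q S.pi0, S.ord_π_one hf Q hQ]; norm_num

lemma case_p (hf : Fund ℓ) (r : ℕ) (hr : r.Prime) (hpr : p < r)
    (hrp : ¬ IsSquare ((r : ℕ) : ZMod p)) (n d : K)
    (hn : ∏ i ∈ Finset.range (p - 1), (S.g ^ i) n = -(r : K) ^ ((p - 1) / 2))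
    (hd : d ≠ 0) (hgd : r * S.g d = d * n * S.c n)
    (Q : HeightOneSpectrum (𝓞 K)) (hc : mv S.c Q = Q)
    (hQ : Q.valuation K (p : K) < 1) : Odd (ordQ Q d) := by
  have : Fact p.Prime := ⟨S.hp⟩
  have hvr : Q.valuation K (r : K) = 1 := v_nat_cop hQ ((Nat.coprime_primes S.hp hr).2 (by omega))
  have hr0 : (r : K) ≠ 0 := by exact_mod_cast hr.ne_zero
  have hgc := S.g_cong hf Q hQ
  have hg := stab_of_int hgc
  have hn0 : n ≠ 0 := by
    rintro rfl
    rw [Finset.prod_eq_zero (Finset.mem_range.2 S.p_pos1) (map_zero (S.g ^ 0))] at hn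
    exact pow_ne_zero _ hr0 (by linear_combination hn)
  have hgi : ∀ i x, Q.valuation K ((S.g ^ i) x) = Q.valuation K x := by
    intro i
    induction i with
    | zero => intro x; rfl
    | succ i ih => intro x; rw [pow_succ, AlgEquiv.mul_apply, ih, stab_v hg]
  have hvn : Q.valuation K n = 1 := by
    have h1 := congrArg (Q.valuation K) hn
    rw [map_prod, Finset.prod_congr rfl fun i _ => hgi i n, Finset.prod_const, Finset.card_range,
      Valuation.map_neg, map_pow, hvr, one_pow] at h1
    exact v_of_pow S.p_pos1.ne' h1
  have hgin : ∀ i, CQ Q ((S.g ^ i) n) n := by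
    intro i
    induction i with
    | zero => exact CQ.refl Q n
    | succ i ih =>
      rw [pow_succ', AlgEquiv.mul_apply]
      exact (cong_of_int hgc (by rw [hgi, hvn])).trans ih
  set f := (p - 1) / 2 with hfdef
  have hff : f * 2 = p - 1 := by rw [mul_comm]; exact S.two_f
  have hrf : CQ Q ((r : K) ^ f) (-1) := by
    have e : ((p : ℕ) : ℤ) ∣ (r : ℤ) ^ f + 1 := by
      rw [← ZMod.intCast_zmod_eq_zero_iff_dvd]
      push_cast
      have h0 : ((r : ℕ) : ZMod p) ≠ 0 := by
        intro h
        apply hrp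
        rw [h]; exact ⟨0, by simp⟩
      have e2 : f = p / 2 := by have := S.hp1; omega
      rcases ZMod.pow_div_two_eq_neg_one_or_one p h0 with h | h
      · exact absurd ((ZMod.euler_criterion p h0).2 h) hrp
      · rw [e2, h]; ring
    have := v_int_dvd hQ e
    push_cast at this
    rw [CQ, sub_neg_eq_add]
    exact this
  have hnp : CQ Q ((n ^ f) ^ 2) 1 := by
    rw [← pow_mul, hff]
    have h1 := CQ.prod (Finset.range (p - 1)) _ _ (fun i _ => hgin i) (fun i _ => by rw [hgi, hvn])
    rw [hn, Finset.prod_const, Finset.card_range] at h1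
    have h2 := h1.symm.trans hrf.neg
    rwa [neg_neg] at h2
  have hcc : ∀ x y, CQ Q x y → CQ Q (S.c x) (S.c y) := by
    intro x y h
    rw [CQ, ← map_sub, stab_v hc]; exact h
  have hnn : CQ Q ((n * S.c n) ^ f) 1 := by
    rw [mul_pow, ← map_pow]
    have hvf : Q.valuation K (n ^ f) ≤ 1 := v_pow_le hvn.le f
    rcases hnp.sq_one with h | h
    · have h2 := hcc _ _ h
      rw [map_one] at h2
      simpa using h.mul h2 hvf (by rw [stab_v hc]; exact hvf)
    · have h2 := hcc _ _ h
      rw [map_neg, map_one] at h2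
      simpa using h.mul h2 hvf (by rw [stab_v hc]; exact hvf)
  have hπ1 := S.ord_π_one hf Q hQ
  set m := ordQ Q d with hm
  have hπ0 := S.pi0
  have hπm : (1 - S.ζ) ^ m ≠ 0 := zpow_ne_zero m hπ0
  obtain ⟨u, hu⟩ : ∃ u, d = (1 - S.ζ) ^ m * u := ⟨d / (1 - S.ζ) ^ m, by field_simp⟩
  have hu0 : u ≠ 0 := by rintro rfl; exact hd (by rw [hu, mul_zero])
  have hvu : Q.valuation K u = 1 := by
    rw [v_eq_iff Q hu0]
    have : ordQ Q d = m := rfl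
    rw [hu, ordQ_mul Q hπm hu0, ordQ_zpow, hπ1] at this
    omega
  obtain ⟨b, hb⟩ : ∃ b, S.g (1 - S.ζ) = (1 - S.ζ) * b := ⟨S.g (1 - S.ζ) / (1 - S.ζ), by field_simp⟩
  have hbs : b = ∑ i ∈ Finset.range (S.a : ZMod p).val, S.ζ ^ i := by
    apply mul_left_cancel₀ hπ0
    rw [← hb, map_sub, map_one, S.gζ, mul_comm, geom_sum_mul_neg]
  have hba : CQ Q b ((S.a : ZMod p).val : K) := by
    have h1 := CQ.sum (Q := Q) (Finset.range (S.a : ZMod p).val) (fun i => S.ζ ^ i) (fun i => (1 : K)) (by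
      intro i _
      have : CQ Q S.ζ 1 := by
        apply CQ.symm
        rw [CQ, v_lt_iff Q hπ0, hπ1]; norm_num
      simpa using this.pow (S.vζ Q).le i)
    rw [hbs]
    simpa using h1
  have hvb : Q.valuation K b ≤ 1 := by
    rw [hbs]; exact v_int Q (IsIntegral.sum _ fun i _ => S.intζ.pow i)
  have hbf : CQ Q (b ^ f) (-1) := by
    have e : ((p : ℕ) : ℤ) ∣ ((S.a : ZMod p).val : ℤ) ^ f + 1 := by
      rw [← ZMod.intCast_zmod_eq_zero_iff_dvd]
      push_cast
      rw [ZMod.natCast_zmod_val]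
      have := congrArg (Units.val) S.a_f
      push_cast at this
      rw [this]; ring
    have := v_int_dvd hQ e
    push_cast at this
    apply (hba.pow hvb f).trans
    rw [CQ, sub_neg_eq_add]
    exact this
  have hvm1 : Q.valuation K (-1 : K) = 1 := by rw [Valuation.map_neg, map_one]
  have hvbf : Q.valuation K (b ^ f) = 1 := hbf.symm.v_eq hvm1
  have hvb1 : Q.valuation K b = 1 := by
    rw [map_pow] at hvbf
    have hf0 : f ≠ 0 := by have := S.p_pos1; omega
    exact v_of_pow hf0 hvbf
  have hb0 : b ≠ 0 := by rintro rfl; simp at hvb1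
  have hmain : CQ Q (r * b ^ m) (n * S.c n) := by
    have e : r * b ^ m * S.g u = n * S.c n * u := by
      apply mul_left_cancel₀ hπm
      have h1 := hgd
      rw [hu, map_mul, map_zpow₀, hb, mul_zpow] at h1
      linear_combination h1
    have h2 : CQ Q (r * b ^ m * S.g u) (r * b ^ m * u) := by
      apply (cong_of_int hgc hvu.le).mul_left
      rw [map_mul, map_zpow₀, hvr, hvb1]; simp
    rw [e] at h2
    apply CQ.cancel (z := u) _ hvu
    rw [mul_comm u, mul_comm u]
    exact h2.symm
  have hfin : CQ Q ((r : K) ^ f * (b ^ f) ^ m) 1 := by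
    have h1 := hmain.pow (by rw [map_mul, map_zpow₀, hvr, hvb1]; simp) f
    have h2 := h1.trans hnn
    have e : ((r : K) * b ^ m) ^ f = (r : K) ^ f * (b ^ f) ^ m := by
      rw [mul_pow]
      congr 1
      rw [← zpow_natCast, ← zpow_mul, ← zpow_natCast, ← zpow_mul, mul_comm]
    rwa [e] at h2
  have h5 : CQ Q ((r : K) ^ f * (b ^ f) ^ m) (-1 * (-1) ^ m) := by
    apply hrf.mul (hbf.zpow hvbf hvm1 m)
    · rw [map_pow, hvr, one_pow]
    · rw [map_zpow₀, hvbf, one_zpow]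
  have h6 := h5.symm.trans hfin
  by_contra hodd
  rw [Int.not_odd_iff_even] at hodd
  rw [hodd.neg_one_zpow, mul_one] at h6
  have hv2 : Q.valuation K ((2 : ℕ) : K) = 1 := v_nat_cop hQ ((Nat.coprime_primes S.hp Nat.prime_two).2 (by
    have := S.hp1; omega))
  have e : (-1 : K) - 1 = -((2 : ℕ) : K) := by push_cast; ring
  rw [CQ, e, Valuation.map_neg, hv2] at h6
  exact lt_irrefl _ h6

end Setup

section
variable {K : Type} [Field K] [NumberField K]

lemma v_le_ord (Q : HeightOneSpectrum (𝓞 K)) {x y : K} (hx : x ≠ 0) (hy : y ≠ 0) :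
    Q.valuation K x ≤ Q.valuation K y ↔ ordQ Q y ≤ ordQ Q x := by
  rw [ordQ, ordQ, neg_le_neg_iff, WithZero.log_le_log (vne Q hx) (vne Q hy)]

lemma v_le_unif (Q : HeightOneSpectrum (𝓞 K)) {x y : K} (hx : Q.valuation K x < 1) (hy0 : y ≠ 0) (hy : ordQ Q y = 1) :
    Q.valuation K x ≤ Q.valuation K y := by
  by_cases h0 : x = 0
  · rw [h0, map_zero]; exact zero_le
  · rw [v_le_ord Q h0 hy0, hy]
    have := (v_lt_iff Q h0).1 hx
    omega

lemma fixed_even (Q : HeightOneSpectrum (𝓞 K)) (τ : K ≃ₐ[ℚ] K) (hττ : ∀ x, τ (τ x) = x)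
    (hτ : ∀ x, IsIntegral ℤ x → CQ Q (τ x) x) (x0 : K) (hx0 : Q.valuation K x0 ≤ 1) (hx1 : τ x0 ≠ x0)
    (y : K) (hy : y ≠ 0) (hτy : τ y = y) : Even (ordQ Q y) := by
  by_contra hodd
  rw [Int.not_even_iff_odd] at hodd
  obtain ⟨k, hk⟩ := hodd
  have hs := stab_of_int hτ
  obtain ⟨u, hu0, hu⟩ := exists_unif Q
  have hτu0 : τ u ≠ 0 := (map_ne_zero τ).2 hu0
  have hU0 : u * τ u ≠ 0 := mul_ne_zero hu0 hτu0
  obtain ⟨π, hπ⟩ : ∃ π, π = y / (u * τ u) ^ k := ⟨_, rfl⟩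
  have hUk : (u * τ u) ^ k ≠ 0 := zpow_ne_zero k hU0
  have hπ0 : π ≠ 0 := by rw [hπ]; exact div_ne_zero hy hUk
  have hπ1 : ordQ Q π = 1 := by
    rw [hπ, ordQ_div Q hy hUk, ordQ_zpow, ordQ_mul Q hu0 hτu0, stab_ord hs, hu, hk]; ring
  have hτπ : τ π = π := by
    rw [hπ, map_div₀, map_zpow₀, map_mul, hττ, hτy, mul_comm (τ u)]
  obtain ⟨N, hN1, hN, hfr⟩ := exists_frob Q
  have key : ∀ j : ℕ, ∀ x, Q.valuation K x ≤ 1 → Q.valuation K (τ x - x) ≤ Q.valuation K π ^ j := by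
    intro j
    induction j with
    | zero =>
      intro x hx
      rw [pow_zero]
      exact le_of_lt (cong_of_int hτ hx)
    | succ j ih =>
      intro x hx
      have h1 : Q.valuation K (x - x ^ N) ≤ Q.valuation K π := by
        apply v_le_unif Q _ hπ0 hπ1
        rw [Valuation.map_sub_swap]; exact hfr x hx
      obtain ⟨w, hw⟩ : ∃ w, x = x ^ N + π * w := ⟨(x - x ^ N) / π, by field_simp; ring⟩
      have hvw : Q.valuation K w ≤ 1 := by
        have e : w = (x - x ^ N) / π := by
          rw [eq_div_iff hπ0]; linear_combination -hw
        rw [e, map_div₀]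
        exact div_le_one_of_le₀ h1 zero_le
      have hτx : CQ Q (τ x) x := cong_of_int hτ hx
      have hvτx : Q.valuation K (τ x) ≤ 1 := by rw [stab_v hs]; exact hx
      have e : τ x - x = (∑ i ∈ Finset.range N, (τ x) ^ i * x ^ (N - 1 - i)) * (τ x - x) + π * (τ w - w) := by
        rw [(Commute.all (τ x) x).geom_sum₂_mul]
        have h2 := congrArg τ hw
        rw [map_add, map_pow, map_mul, hτπ] at h2
        linear_combination h2 - hw
      have hsum : Q.valuation K (∑ i ∈ Finset.range N, (τ x) ^ i * x ^ (N - 1 - i)) < 1 := by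
        have h3 : CQ Q (∑ i ∈ Finset.range N, (τ x) ^ i * x ^ (N - 1 - i)) (∑ i ∈ Finset.range N, x ^ (N - 1)) := by
          apply CQ.sum
          intro i hi
          have hi' := Finset.mem_range.1 hi
          have e2 : x ^ (N - 1) = x ^ i * x ^ (N - 1 - i) := by rw [← pow_add]; congr 1; omega
          rw [e2]
          exact (hτx.pow hvτx i).mul_right (v_pow_le hx _)
        apply h3.symm.v_lt
        rw [Finset.sum_const, Finset.card_range, nsmul_eq_mul]
        exact v_mul_lt hN (v_pow_le hx _)
      rw [e]
      apply Valuation.map_add_le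
      · rw [map_mul, pow_succ, mul_comm]
        exact mul_le_mul' (ih x hx) (v_le_unif Q hsum hπ0 hπ1)
      · rw [map_mul, pow_succ, mul_comm]
        exact mul_le_mul' (ih w hvw) le_rfl
  have hne : τ x0 - x0 ≠ 0 := sub_ne_zero.2 hx1
  have h4 := key ((ordQ Q (τ x0 - x0)).toNat + 1) x0 hx0
  rw [← map_pow, v_le_ord Q hne (pow_ne_zero _ hπ0), ordQ_pow, hπ1] at h4
  push_cast at h4
  have := Int.self_le_toNat (ordQ Q (τ x0 - x0))
  omega

end

namespace Setup
variable {p ℓ : ℕ} {L K : Type} [Field L] [NumberField L] [Field K] [NumberField K] [Algebra L K]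
    {conj : L ≃ₐ[ℚ] L} {α : L} (S : Setup p ℓ L K conj α)
include S

lemma ℓK0 : (ℓ : K) ≠ 0 := by exact_mod_cast S.hℓ.ne'

lemma τ_eq (x : K) : S.τ x = S.h (S.c x) := by rw [S.c_eq, S.hhx]

lemma h_d (r : ℕ) (n d : K) (hgd : r * S.g d = d * n * S.c n) (j : ℕ) :
    (r : K) ^ j * (S.g ^ j) d = d * (∏ i ∈ Finset.range j, (S.g ^ i) n) * S.c (∏ i ∈ Finset.range j, (S.g ^ i) n) := by
  induction j with
  | zero => simp
  | succ j ih =>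
    have h1 := congrArg (S.g ^ j) hgd
    simp only [map_mul, map_natCast] at h1
    rw [S.gpowc] at h1
    rw [pow_succ (S.g), AlgEquiv.mul_apply, Finset.prod_range_succ, map_mul, pow_succ]
    linear_combination (r : K) ^ j * h1 + (S.g ^ j) n * S.c ((S.g ^ j) n) * ih

lemma case_ℓ (hf : Fund ℓ) (r : ℕ) (hr : r.Prime) (hℓr : ℓ < r) (n d : K)
    (hn : ∏ i ∈ Finset.range (p - 1), (S.g ^ i) n = -(r : K) ^ ((p - 1) / 2))
    (hd : d ≠ 0) (hcd : S.c d = d) (hgd : r * S.g d = d * n * S.c n)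
    (Q : HeightOneSpectrum (𝓞 K)) (hc : mv S.c Q = Q)
    (hQ : Q.valuation K (ℓ : K) < 1) : Even (ordQ Q d + ordQ Q (algebraMap L K α)) := by
  have hvr : Q.valuation K (r : K) = 1 := v_nat_cop hQ (by
    rw [Nat.coprime_comm, hr.coprime_iff_not_dvd]
    intro h
    have := Nat.le_of_dvd S.hℓ h
    omega)
  have hr0 : (r : K) ≠ 0 := by exact_mod_cast hr.ne_zero
  have hvA : Q.valuation K (algebraMap L K α) < 1 := by
    by_contra h
    have h1 : Q.valuation K ((algebraMap L K α) ^ 2) < 1 := by rw [S.A2, Valuation.map_neg]; exact hQ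
    rw [pow_two, map_mul] at h1
    exact absurd h1 (not_lt.2 (one_le_mul (not_lt.1 h) (not_lt.1 h)))
  have hA0 := S.A0
  have hτ : ∀ x, IsIntegral ℤ x → CQ Q (S.τ x) x := by
    intro x hx
    have e : S.τ x - x = algebraMap L K α * ((S.τ x - x) / algebraMap L K α) := by field_simp
    rw [CQ, e]
    exact v_mul_lt hvA (v_int Q (S.τ_sub hf hx))
  have hsτ := stab_of_int hτ
  have hvh : ∀ x, Q.valuation K (S.h x) = Q.valuation K x := by
    intro x
    have : S.h x = S.τ (S.c x) := by rw [S.τ_eq, S.ccx]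
    rw [this, stab_v hsτ, stab_v hc]
  set f := (p - 1) / 2 with hfdef
  obtain ⟨V, hV⟩ : ∃ V, V = ∏ i ∈ Finset.range f, (S.g ^ i) n := ⟨_, rfl⟩
  have hVh : V * S.h V = -(r : K) ^ f := by
    rw [← hn]
    have e : p - 1 = f + f := by have := S.two_f; omega
    rw [e, Finset.prod_range_add, hV, map_prod]
    congr 1
    apply Finset.prod_congr rfl
    intro i _
    rw [h, pow_add]; rfl
  have hvV : Q.valuation K V = 1 := by
    have h1 := congrArg (Q.valuation K) hVh
    rw [map_mul, hvh, Valuation.map_neg, map_pow, hvr, one_pow, ← pow_two] at h1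
    exact v_of_pow two_ne_zero h1
  have hV0 : V ≠ 0 := by rintro rfl; simp at hvV
  have hcV0 : S.c V ≠ 0 := (map_ne_zero S.c).2 hV0
  have hhd : (r : K) ^ f * S.h d = d * V * S.c V := by rw [hV]; exact S.h_d r n d hgd f
  have hτx : S.τ (d * S.c V) = -(d * S.c V) := by
    rw [map_mul, S.τ_eq, S.τ_eq, hcd, S.ccx]
    apply mul_left_cancel₀ (pow_ne_zero f hr0)
    linear_combination S.h V * hhd + d * S.c V * hVh
  have hy : S.τ (d * S.c V / algebraMap L K α) = d * S.c V / algebraMap L K α := by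
    rw [map_div₀, hτx, S.τA, neg_div_neg_eq]
  have h2 := fixed_even Q S.τ S.ττx hτ (algebraMap L K α) hvA.le (by
    rw [S.τA]
    intro h
    have : (2 : K) * algebraMap L K α = 0 := by linear_combination -h
    simp [hA0] at this) _ (div_ne_zero (mul_ne_zero hd hcV0) hA0) hy
  rw [ordQ_div Q (mul_ne_zero hd hcV0) hA0, ordQ_mul Q hd hcV0, stab_ord hc, (v_eq_iff Q hV0).1 hvV] at h2
  rw [Int.even_iff] at h2 ⊢
  omega

end Setup

section
variable {K : Type} [Field K] [NumberField K]

lemma mem_int_iff (Q : HeightOneSpectrum (𝓞 K)) (q : ℕ) (hq : q.Prime) (h : Q.valuation K (q : K) < 1) (z : ℤ) :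
    Q.valuation K (z : K) < 1 ↔ (q : ℤ) ∣ z := by
  refine ⟨fun hz => ?_, fun hz => v_int_dvd h hz⟩
  by_contra hn
  have hcop : Nat.Coprime q z.natAbs := (Nat.Prime.coprime_iff_not_dvd hq).2 (fun h => hn (Int.natCast_dvd.2 h))
  have h1 := v_nat_cop h hcop
  obtain ⟨k, rfl | rfl⟩ := z.eq_nat_or_neg
  · simp at hz h1
    rw [h1] at hz
    exact lt_irrefl _ hz
  · simp at hz h1
    rw [h1] at hz
    exact lt_irrefl _ hz

lemma exists_nat_mul (x : K) : ∃ M : ℕ, 0 < M ∧ IsIntegral ℤ ((M : K) * x) := by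
  obtain ⟨y, hy0, hy⟩ := IsAlgebraic.exists_integral_multiple (R := ℤ) (((IsFractionRing.isAlgebraic_iff ℤ ℚ K).2 (Algebra.IsAlgebraic.isAlgebraic (R := ℚ) x)))
  refine ⟨y.natAbs, Int.natAbs_pos.2 hy0, ?_⟩
  rw [zsmul_eq_mul] at hy
  obtain ⟨k, rfl | rfl⟩ := y.eq_nat_or_neg
  · simpa using hy
  · have := hy.neg
    simpa using this

lemma exists_mv (hG : IsGalois ℚ K) (Q Q' : HeightOneSpectrum (𝓞 K)) (q : ℕ) (hq : q.Prime)
    (h : Q.valuation K (q : K) < 1) (h' : Q'.valuation K (q : K) < 1) : ∃ γ : K ≃ₐ[ℚ] K, mv γ Q = Q' := by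
  have hu : Q.asIdeal.under ℤ = Q'.asIdeal.under ℤ := by
    ext z
    rw [Ideal.mem_comap, Ideal.mem_comap, mem_iff_v, mem_iff_v]
    have e : ((algebraMap ℤ (𝓞 K) z : 𝓞 K) : K) = (z : K) := by simp
    rw [e, mem_int_iff Q q hq h, mem_int_iff Q' q hq h']
  have := Q.isPrime
  have := Q'.isPrime
  obtain ⟨γ, hγ⟩ := Algebra.IsInvariant.exists_smul_of_under_eq ℤ (𝓞 K) (Gal(K/ℚ)) Q.asIdeal Q'.asIdeal hu
  refine ⟨γ, ?_⟩
  apply HeightOneSpectrum.ext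
  rw [hγ]
  rfl
end

namespace Setup
variable {p ℓ : ℕ} {L K : Type} [Field L] [NumberField L] [Field K] [NumberField K] [Algebra L K]
    {conj : L ≃ₐ[ℚ] L} {α : L} (S : Setup p ℓ L K conj α)
include S

lemma mv_gc (Q : HeightOneSpectrum (𝓞 K)) (hc : mv S.c Q = Q) (i : ℕ) : mv S.c (mv (S.g ^ i) Q) = mv (S.g ^ i) Q := by
  rw [← mv_mul, ← (show Commute S.g S.c from S.gc).pow_left i, mv_mul, hc]

lemma exists_gmv (Q Q' : HeightOneSpectrum (𝓞 K)) (hc : mv S.c Q = Q) (q : ℕ) (hq : q.Prime)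
    (h : Q.valuation K (q : K) < 1) (h' : Q'.valuation K (q : K) < 1) : ∃ j : ℕ, mv (S.g ^ j) Q = Q' := by
  obtain ⟨γ, rfl⟩ := exists_mv S.galQ Q Q' q hq h h'
  obtain ⟨i, -, rfl | rfl⟩ := S.aut_cases γ
  · exact ⟨i, rfl⟩
  · refine ⟨i + (p - 1) / 2, ?_⟩
    have e : S.τ = S.g ^ ((p - 1) / 2) * S.c := AlgEquiv.ext fun x => S.τ_eq x
    rw [e, ← mul_assoc, ← pow_add, mv_mul _ S.c, hc]

lemma g_par (r : ℕ) (hr : r.Prime) (hr4 : r % 4 = 3) (hℓr : ℓ < r) (hpr : p < r)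
    (hrp : ¬ IsSquare ((r : ℕ) : ZMod p)) (n d : K) (hn : n ≠ 0)
    (hd : d ≠ 0) (hgd : r * S.g d = d * n * S.c n)
    (Q : HeightOneSpectrum (𝓞 K)) (hc : mv S.c Q = Q) (j : ℕ) :
    Even (ordQ (mv (S.g ^ j) Q) d - ordQ Q d) := by
  induction j with
  | zero => rw [pow_zero, mv_one]; simp
  | succ j ih =>
    have h1 := S.mv_gc Q hc j
    have h2 := S.mv_gc Q hc (j + 1)
    rw [pow_succ', mv_mul] at h2 ⊢
    generalize mv (S.g ^ j) Q = P at *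
    have hr0 : (r : K) ≠ 0 := by exact_mod_cast hr.ne_zero
    have hvr : ordQ (mv S.g P) (r : K) = 0 := by
      rw [← v_eq_iff _ hr0]
      apply le_antisymm (v_int _ (int_natCast r))
      by_contra hlt
      push Not at hlt
      exact S.case_r r hr hr4 hℓr hpr hrp _ h2 hlt
    have hgd0 : S.g d ≠ 0 := (map_ne_zero S.g).2 hd
    have hcn0 : S.c n ≠ 0 := (map_ne_zero S.c).2 hn
    have h3 := congrArg (ordQ (mv S.g P)) hgd
    rw [ordQ_mul _ hr0 hgd0, ordQ_mul _ (mul_ne_zero hd hn) hcn0, ordQ_mul _ hd hn, hvr, ordQ_mv, stab_ord h2] at h3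
    have e : ordQ (mv S.g P) d - ordQ Q d = (ordQ P d - ordQ Q d) - 2 * ordQ (mv S.g P) n := by omega
    rw [e]
    exact ih.sub (even_two_mul _)

lemma ord_q (hf : Fund ℓ) (q : ℕ) (hq : q.Prime) (hqℓ : ¬ q ∣ ℓ) (hqp : q ≠ p) (Q : HeightOneSpectrum (𝓞 K))
    (h : Q.valuation K (q : K) < 1) : ordQ Q (q : K) = 1 := by
  have hq0 : (q : K) ≠ 0 := by exact_mod_cast hq.ne_zero
  have h1 := rad_ord (q : K) hq0 (int_natCast q) (S.rad_q hf q hq hqℓ hqp) Q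
  rw [v_lt_iff Q hq0] at h
  omega

omit S in
lemma ord_nat_cop {Q : HeightOneSpectrum (𝓞 K)} {q m : ℕ} (h : Q.valuation K (q : K) < 1) (hm : m ≠ 0) (hc : Nat.Coprime q m) :
    ordQ Q (m : K) = 0 := (v_eq_iff Q (by exact_mod_cast hm)).1 (v_nat_cop h hc)

lemma exists_t (hf : Fund ℓ) (r : ℕ) (hr : r.Prime) (hr4 : r % 4 = 3) (hℓr : ℓ < r) (hpr : p < r)
    (hrp : ¬ IsSquare ((r : ℕ) : ZMod p)) (n d : K)
    (hn : ∏ i ∈ Finset.range (p - 1), (S.g ^ i) n = -(r : K) ^ ((p - 1) / 2))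
    (hd : d ≠ 0) (hcd : S.c d = d) (hgd : r * S.g d = d * n * S.c n) :
    ∃ t : ℕ, 0 < t ∧ ∀ Q : HeightOneSpectrum (𝓞 K), mv S.c Q = Q →
      Even (ordQ Q (t : K) + ordQ Q d + ordQ Q (algebraMap L K α) + ordQ Q (1 - S.ζ)) := by
  classical
  have hr0 : (r : K) ≠ 0 := by exact_mod_cast hr.ne_zero
  have hn0 : n ≠ 0 := by
    rintro rfl
    have : (r : K) * S.g d = 0 := by rw [hgd]; ring
    exact mul_ne_zero hr0 ((map_ne_zero S.g).2 hd) this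
  obtain ⟨M1, hM1, hi1⟩ := exists_nat_mul d
  obtain ⟨M2, hM2, hi2⟩ := exists_nat_mul d⁻¹
  let B : ℕ → Prop := fun q => ¬ q ∣ p * ℓ ∧ ∃ Q : HeightOneSpectrum (𝓞 K), mv S.c Q = Q ∧ Q.valuation K (q : K) < 1 ∧
    Odd (ordQ Q d)
  let T : Finset ℕ := (M1 * M2).primeFactors.filter B
  have hT : ∀ q ∈ T, q.Prime := fun q hq => Nat.prime_of_mem_primeFactors (Finset.mem_filter.1 hq).1
  have ht0 : ∏ q ∈ T, q ≠ 0 := Finset.prod_ne_zero_iff.2 fun q hq => (hT q hq).ne_zero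
  refine ⟨∏ q ∈ T, q, Nat.pos_of_ne_zero ht0, ?_⟩
  intro Q hc
  obtain ⟨q, hq, hQ⟩ := exists_prime Q
  have hq0 : (q : K) ≠ 0 := by exact_mod_cast hq.ne_zero
  have hcopT : q ∉ T → ordQ Q ((∏ q ∈ T, q : ℕ) : K) = 0 := by
    intro hqT
    apply ord_nat_cop hQ ht0
    apply Nat.Coprime.prod_right
    intro q' hq'
    rw [Nat.coprime_primes hq (hT q' hq')]
    rintro rfl
    exact hqT hq'
  have hnotB : q ∣ p * ℓ → q ∉ T := fun h h' => (Finset.mem_filter.1 h').2.1 h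
  by_cases hqp : q = p
  · subst hqp
    rw [hcopT (hnotB (dvd_mul_right _ _))]
    have h1 := S.case_p hf r hr hpr hrp n d hn hd hgd Q hc hQ
    have h2 := S.ord_π_one hf Q hQ
    have h3 : ordQ Q (algebraMap L K α) = 0 := by
      rw [← v_eq_iff Q S.A0]
      exact S.vA Q (v_nat_cop hQ ((Nat.Prime.coprime_iff_not_dvd hq).2 S.hpℓ))
    rw [h2, h3]
    obtain ⟨k, hk⟩ := h1
    exact ⟨k + 1, by omega⟩
  have hcop : Nat.Coprime q p := (Nat.coprime_primes hq S.hp).2 hqp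
  have hπ : ordQ Q (1 - S.ζ) = 0 := by
    rw [← v_eq_iff Q S.pi0]
    have := S.vπ Q 1 (by rw [Nat.dvd_one]; exact S.hp.ne_one) (v_nat_cop hQ hcop)
    rwa [pow_one] at this
  rw [hπ, add_zero]
  by_cases hqℓ : q ∣ ℓ
  · rw [hcopT (hnotB (dvd_mul_of_dvd_right hqℓ _)), zero_add]
    apply S.case_ℓ hf r hr hℓr n d hn hd hcd hgd Q hc
    obtain ⟨k, hk⟩ := hqℓ
    rw [hk]
    push_cast
    exact v_mul_lt hQ (v_int Q (int_natCast k))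
  have h3 : ordQ Q (algebraMap L K α) = 0 := by
    rw [← v_eq_iff Q S.A0]
    exact S.vA Q (v_nat_cop hQ ((Nat.Prime.coprime_iff_not_dvd hq).2 hqℓ))
  rw [h3, add_zero]
  by_cases hqT : q ∈ T
  · have hB : B q := (Finset.mem_filter.1 hqT).2
    obtain ⟨-, Q', hc', hQ', hodd⟩ := hB
    obtain ⟨j, rfl⟩ := S.exists_gmv Q' Q hc' q hq hQ' hQ
    have h4 := S.g_par r hr hr4 hℓr hpr hrp n d hn0 hd hgd Q' hc' j
    have h5 : ordQ (mv (S.g ^ j) Q') ((∏ q ∈ T, q : ℕ) : K) = 1 := by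
      rw [← Finset.mul_prod_erase T _ hqT]
      push_cast
      rw [ordQ_mul _ hq0, S.ord_q hf q hq hqℓ hqp _ hQ]
      · have : ordQ (mv (S.g ^ j) Q') ((∏ x ∈ T.erase q, x : ℕ) : K) = 0 := by
          apply ord_nat_cop hQ
          · exact Finset.prod_ne_zero_iff.2 fun q hq => (hT q (Finset.mem_of_mem_erase hq)).ne_zero
          · apply Nat.Coprime.prod_right
            intro q' hq'
            rw [Nat.coprime_primes hq (hT q' (Finset.mem_of_mem_erase hq'))]
            rintro rfl
            exact Finset.notMem_erase _ _ hq'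
        push_cast at this
        rw [this]; rfl
      · have := Finset.prod_ne_zero_iff.2 fun q' hq' => (hT q' (Finset.mem_of_mem_erase (a := q) hq')).ne_zero
        have h6 : ((∏ x ∈ T.erase q, x : ℕ) : K) ≠ 0 := by exact_mod_cast this
        push_cast at h6
        exact h6
    rw [h5]
    obtain ⟨k, hk⟩ := h4
    obtain ⟨m, hm⟩ := hodd
    exact ⟨k + m + 1, by omega⟩
  · rw [hcopT hqT, zero_add]
    by_contra hodd
    rw [Int.not_even_iff_odd] at hodd
    apply hqT
    have hB : B q := by
      refine ⟨?_, Q, hc, hQ, hodd⟩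
      intro h
      rcases (Nat.Prime.dvd_mul hq).1 h with h | h
      · exact hqp ((Nat.prime_dvd_prime_iff_eq hq S.hp).1 h)
      · exact hqℓ h
    refine Finset.mem_filter.2 ⟨?_, hB⟩
    rw [Nat.mem_primeFactors]
    refine ⟨hq, ?_, by positivity⟩
    by_contra hnd
    have hnd1 : ¬ q ∣ M1 := fun h => hnd (dvd_mul_of_dvd_left h _)
    have hnd2 : ¬ q ∣ M2 := fun h => hnd (dvd_mul_of_dvd_right h _)
    have e1 := ord_nat_cop hQ hM1.ne' ((Nat.Prime.coprime_iff_not_dvd hq).2 hnd1)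
    have e2 := ord_nat_cop hQ hM2.ne' ((Nat.Prime.coprime_iff_not_dvd hq).2 hnd2)
    have hM10 : (M1 : K) ≠ 0 := by exact_mod_cast hM1.ne'
    have hM20 : (M2 : K) ≠ 0 := by exact_mod_cast hM2.ne'
    have f1 := ordQ_int Q (mul_ne_zero hM10 hd) hi1
    have f2 := ordQ_int Q (mul_ne_zero hM20 (inv_ne_zero hd)) hi2
    rw [ordQ_mul Q hM10 hd, e1] at f1
    rw [ordQ_mul Q hM20 (inv_ne_zero hd), e2, ordQ_inv] at f2
    obtain ⟨k, hk⟩ := hodd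
    omega

end Setup

lemma multiset_split {β : Type*} [DecidableEq β] (f : β → β) (hf : ∀ x, f (f x) = x) (N : ℕ) :
    ∀ m : Multiset β, m.card = N → m.map f = m → (∀ x, f x = x → Even (m.count x)) →
      ∃ s : Multiset β, s + s.map f = m := by
  have hinj : Function.Injective f := fun x y h => by rw [← hf x, ← hf y, h]
  induction N using Nat.strong_induction_on with
  | _ N ih =>
    intro m hm hfm hev
    rcases Multiset.empty_or_exists_mem m with rfl | ⟨a, ha⟩
    · exact ⟨0, by simp⟩
    have key : ∃ m', m = a ::ₘ f a ::ₘ m' := by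
      obtain ⟨m1, rfl⟩ := Multiset.exists_cons_of_mem ha
      by_cases hfa : f a = a
      · have h1 := hev a hfa
        rw [Multiset.count_cons_self] at h1
        have : a ∈ m1 := by
          rw [← Multiset.count_pos]
          by_contra h
          have h0 : Multiset.count a m1 = 0 := by omega
          rw [h0] at h1
          exact absurd h1 (by decide)
        obtain ⟨m2, rfl⟩ := Multiset.exists_cons_of_mem this
        exact ⟨m2, by rw [hfa]⟩
      · have : f a ∈ a ::ₘ m1 := by
          rw [← hfm]; exact Multiset.mem_map_of_mem f ha
        rcases Multiset.mem_cons.1 this with h | h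
        · exact absurd h hfa
        obtain ⟨m2, rfl⟩ := Multiset.exists_cons_of_mem h
        exact ⟨m2, rfl⟩
    obtain ⟨m', rfl⟩ := key
    rw [Multiset.map_cons, Multiset.map_cons, hf, Multiset.cons_swap, Multiset.cons_inj_right, Multiset.cons_inj_right] at hfm
    rw [Multiset.card_cons, Multiset.card_cons] at hm
    obtain ⟨s, hs⟩ := ih m'.card (by omega) m' rfl hfm (by
      intro x hx
      have h1 := hev x hx
      rw [Multiset.count_cons, Multiset.count_cons] at h1
      by_cases hxa : x = a
      · subst hxa
        rw [hx] at h1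
        simp only [if_true] at h1
        obtain ⟨k, hk⟩ := h1
        exact ⟨k - 1, by omega⟩
      · have : x ≠ f a := fun h => hxa (by rw [← hx, h, hf])
        simpa [hxa, this] using h1)
    refine ⟨a ::ₘ s, ?_⟩
    rw [Multiset.map_cons, Multiset.cons_add, Multiset.add_cons, hs]

section
variable {K : Type} [Field K] [NumberField K]

lemma ord_eq_count (Q : HeightOneSpectrum (𝓞 K)) (W : 𝓞 K) (hW : W ≠ 0) [DecidableEq (Ideal (𝓞 K))] :
    ordQ Q (W : K) = (UniqueFactorizationMonoid.normalizedFactors (Ideal.span {W})).count Q.asIdeal := by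
  have h0 : Ideal.span {W} ≠ ⊥ := by rwa [Ne, Ideal.span_singleton_eq_bot]
  have h1 := UniqueFactorizationMonoid.emultiplicity_eq_count_normalizedFactors Q.irreducible h0
  rw [normalize_eq] at h1
  have h2 := multiplicity_eq_of_emultiplicity_eq_some h1
  rw [ordQ, show Q.valuation K (W : K) = Q.intValuation W from Q.valuation_of_algebraMap W,
    Q.intValuation_eq_exp_neg_multiplicity hW, h2]
  simp

lemma ideal_split (c : K ≃ₐ[ℚ] K) (hc : c * c = 1) (W : 𝓞 K) (hW : W ≠ 0)
    (hcW : Ideal.map (phi c) (Ideal.span {W}) = Ideal.span {W})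
    (hev : ∀ Q : HeightOneSpectrum (𝓞 K), mv c Q = Q → Even (ordQ Q (W : K))) :
    ∃ I : Ideal (𝓞 K), I * I.map (phi c) = Ideal.span {W} := by
  classical
  obtain ⟨m, hm⟩ : ∃ m, m = UniqueFactorizationMonoid.normalizedFactors (Ideal.span {W}) := ⟨_, rfl⟩
  have h0 : Ideal.span {W} ≠ ⊥ := by rwa [Ne, Ideal.span_singleton_eq_bot]
  have hprod : m.prod = Ideal.span {W} := by
    rw [hm]; exact Ideal.prod_normalizedFactors_eq_self h0
  have hphi : ∀ x, phi c (phi c x) = x := by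
    intro x
    apply RingOfIntegers.ext
    rw [phi_apply, phi_apply, ← AlgEquiv.mul_apply, hc]; rfl
  have hinv : ∀ J : Ideal (𝓞 K), Ideal.map (phi c) (Ideal.map (phi c) J) = J := by
    intro J
    have : ((phi c : 𝓞 K →+* 𝓞 K).comp (phi c : 𝓞 K →+* 𝓞 K)) = RingHom.id _ := RingHom.ext hphi
    exact (Ideal.map_map (phi c : 𝓞 K →+* 𝓞 K) (phi c : 𝓞 K →+* 𝓞 K)).trans
      ((congrArg (fun f => Ideal.map f J) this).trans (Ideal.map_id J))
  have hmprime : ∀ P ∈ m, Prime P := by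
    intro P hP
    rw [hm] at hP
    exact UniqueFactorizationMonoid.prime_of_normalized_factor P hP
  have hmapprod : ∀ s : Multiset (Ideal (𝓞 K)), (s.map (Ideal.map (phi c))).prod = Ideal.map (phi c) s.prod := by
    intro s
    exact (map_multiset_prod (Ideal.mapHom (phi c)) s).symm
  have hmap : m.map (Ideal.map (phi c)) = m := by
    have h1 : UniqueFactorizationMonoid.normalizedFactors (m.map (Ideal.map (phi c))).prod = m.map (Ideal.map (phi c)) := by
      apply UniqueFactorizationMonoid.normalizedFactors_prod_of_prime
      intro P hP
      obtain ⟨P', hP', rfl⟩ := Multiset.mem_map.1 hP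
      have hP1 := hmprime P' hP'
      have := Ideal.isPrime_of_prime hP1
      apply Ideal.prime_of_isPrime
      · rw [Ne, Ideal.map_eq_bot_iff_of_injective (phi c).injective]
        exact hP1.ne_zero
      · exact Ideal.map_isPrime_of_equiv (phi c)
    rw [← h1, hmapprod, hprod, hcW, hm]
  obtain ⟨s, hs⟩ := multiset_split (Ideal.map (phi c)) hinv _ m rfl hmap (by
    intro P hP
    by_cases hPm : P ∈ m
    · have hP1 := hmprime P hPm
      have h2 := hev ⟨P, Ideal.isPrime_of_prime hP1, hP1.ne_zero⟩ (HeightOneSpectrum.ext hP)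
      rw [ord_eq_count _ W hW, ← hm] at h2
      exact_mod_cast h2
    · rw [Multiset.count_eq_zero_of_notMem hPm]; exact Even.zero)
  refine ⟨s.prod, ?_⟩
  rw [← hmapprod, ← Multiset.prod_add, hs, hprod]
end

namespace Setup
variable {p ℓ : ℕ} {L K : Type} [Field L] [NumberField L] [Field K] [NumberField K] [Algebra L K]
    {conj : L ≃ₐ[ℚ] L} {α : L} (S : Setup p ℓ L K conj α)
include S

lemma main_ideal (hf : Fund ℓ) (s : K →+* ℂ) : ∃ (I : Ideal (𝓞 K)) (δ : K) (W : 𝓞 K), W ≠ 0 ∧ δ ≠ 0 ∧ S.c δ = δ ∧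
    (∀ i, ∃ y : ℝ, 0 < y ∧ s ((S.g ^ i) δ) = y) ∧ I * I.map (phi S.c) = Ideal.span {W} ∧
    δ * p * algebraMap L K α * W = 1 - S.ζ := by
  obtain ⟨r, hr, hr4, hℓr, hpr, hdvd, hsq, hpsq, hrp⟩ := aux_prime ℓ S.hℓ p S.hp S.hp1 S.hpℓ
  obtain ⟨X, Y, hXY⟩ := aux_norm ℓ r S.hℓ hr hℓr hdvd hsq
  obtain ⟨n, hn⟩ := S.exists_n r hr hr4 hpsq X Y hXY
  obtain ⟨d, hd, hcd, hgd, hpos⟩ := S.exists_d r hr.pos n hn s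
  obtain ⟨t, ht, hev⟩ := S.exists_t hf r hr hr4 hℓr hpr hrp n d hn hd hcd hgd
  have ht0 : (t : K) ≠ 0 := by exact_mod_cast ht.ne'
  have hA0 := S.A0
  have hp0 := S.pK0
  have hπ0 := S.pi0
  obtain ⟨M, hM, hMi⟩ := exists_nat_mul ((1 - S.ζ) / (p * algebraMap L K α * (t * d)))
  have hM0 : (M : K) ≠ 0 := by exact_mod_cast hM.ne'
  obtain ⟨w, hw⟩ : ∃ w, w = (M : K) * (M * ((1 - S.ζ) / (p * algebraMap L K α * (t * d)))) := ⟨_, rfl⟩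
  have hwi : IsIntegral ℤ w := by rw [hw]; exact (int_natCast M).mul hMi
  have hw0 : w ≠ 0 := by
    rw [hw]
    exact mul_ne_zero hM0 (mul_ne_zero hM0 (div_ne_zero hπ0 (mul_ne_zero (mul_ne_zero hp0 hA0) (mul_ne_zero ht0 hd))))
  have hcw : S.ζ * S.c w = w := by
    rw [hw]
    simp only [map_mul, map_div₀, map_natCast, map_sub, map_one, S.cA, S.cζ, hcd]
    have := S.ζ0
    field_simp
    ring
  have hordw : ∀ Q : HeightOneSpectrum (𝓞 K), mv S.c Q = Q → Even (ordQ Q w) := by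
    intro Q hQ
    rw [hw, ordQ_mul Q hM0 (mul_ne_zero hM0 (div_ne_zero hπ0 (mul_ne_zero (mul_ne_zero hp0 hA0) (mul_ne_zero ht0 hd)))),
      ordQ_mul Q hM0 (div_ne_zero hπ0 (mul_ne_zero (mul_ne_zero hp0 hA0) (mul_ne_zero ht0 hd))),
      ordQ_div Q hπ0 (mul_ne_zero (mul_ne_zero hp0 hA0) (mul_ne_zero ht0 hd)), ordQ_mul Q (mul_ne_zero hp0 hA0) (mul_ne_zero ht0 hd),
      ordQ_mul Q hp0 hA0, ordQ_mul Q ht0 hd, S.ord_p Q]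
    have h2 := S.two_f
    obtain ⟨k, hk⟩ := hev Q hQ
    rw [← h2]
    push_cast
    refine ⟨ordQ Q (M : K) + ordQ Q (1 - S.ζ) - k - (((p - 1) / 2 : ℕ) : ℤ) * ordQ Q (1 - S.ζ), ?_⟩
    push_cast
    linear_combination -hk
  obtain ⟨W, rfl⟩ : ∃ X : 𝓞 K, (X : K) = w := ⟨⟨w, hwi⟩, rfl⟩
  have hW0 : W ≠ 0 := fun h => hw0 (by rw [h]; rfl)
  have hspan : Ideal.map (phi S.c) (Ideal.span {W}) = Ideal.span {W} := by
    rw [Ideal.map_span, Set.image_singleton]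
    apply le_antisymm
    · rw [Ideal.span_singleton_le_span_singleton]
      obtain ⟨Z, hZ⟩ : ∃ X : 𝓞 K, (X : K) = S.ζ⁻¹ := ⟨⟨_, S.intζi⟩, rfl⟩
      refine ⟨Z, ?_⟩
      apply RingOfIntegers.ext
      change S.c (W : K) = algebraMap (𝓞 K) K (W * Z)
      rw [map_mul]
      change S.c (W : K) = W * Z
      rw [hZ, ← div_eq_mul_inv, eq_div_iff S.ζ0, mul_comm, hcw]
    · rw [Ideal.span_singleton_le_span_singleton]
      obtain ⟨Z, hZ⟩ : ∃ X : 𝓞 K, (X : K) = S.ζ := ⟨⟨_, S.intζ⟩, rfl⟩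
      refine ⟨Z, ?_⟩
      apply RingOfIntegers.ext
      change (W : K) = algebraMap (𝓞 K) K (phi S.c W * Z)
      rw [map_mul]
      change (W : K) = S.c W * Z
      rw [hZ, mul_comm, hcw]
  obtain ⟨I, hI⟩ := ideal_split S.c S.cc W hW0 hspan hordw
  refine ⟨I, t * d / M ^ 2, W, hW0, div_ne_zero (mul_ne_zero ht0 hd) (pow_ne_zero 2 hM0), ?_, ?_, hI, ?_⟩
  · simp only [map_mul, map_div₀, map_natCast, map_pow, hcd]
  · intro i
    obtain ⟨y, hy, hy2⟩ := hpos i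
    refine ⟨t * y / M ^ 2, by positivity, ?_⟩
    rw [map_div₀, map_mul, map_pow, map_natCast, map_natCast, map_div₀, map_mul, map_pow, map_natCast, map_natCast, hy2]
    push_cast
    rfl
  · rw [hw]
    field_simp

end Setup

namespace Setup
variable {p ℓ : ℕ} {L K : Type} [Field L] [NumberField L] [Field K] [NumberField K] [Algebra L K]
    {conj : L ≃ₐ[ℚ] L} {α : L} (S : Setup p ℓ L K conj α)

/-- the trace form -/
noncomputable def H (δ x y : K) : L := Algebra.trace L K (δ * x * S.c y)

include S

lemma H_dual (I : Ideal (𝓞 K)) (δ : K) (W : 𝓞 K) (hW : W ≠ 0) (hI : I * I.map (phi S.c) = Ideal.span {W})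
    (hδ : δ * p * algebraMap L K α * W = 1 - S.ζ) (v : K) :
    (∀ X ∈ I, IsIntegral ℤ (S.H δ v (X : K))) ↔ ∃ U ∈ I, v = algebraMap L K α * (U : K) := by
  have hW0 : (W : K) ≠ 0 := by simpa using hW
  have hA0 := S.A0
  have hπ0 := S.pi0
  have hp0 := S.pK0
  constructor
  · intro h
    have h1 : ∀ X ∈ I, ∃ Z : 𝓞 K, v * S.c (X : K) = algebraMap L K α * (W * (Z : K)) := by
      intro X hX
      have h2 := (S.trace_dual (δ * v * S.c (X : K))).1 (by
        intro x hx
        obtain ⟨Y, rfl⟩ : ∃ X : 𝓞 K, (X : K) = x := ⟨⟨x, hx⟩, rfl⟩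
        have h3 := h (phi S.c Y * X) (I.mul_mem_left _ hX)
        have e : ((phi S.c Y * X : 𝓞 K) : K) = S.c (Y : K) * X := map_mul (algebraMap (𝓞 K) K) _ _
        rw [H, e, map_mul S.c, S.ccx] at h3
        rwa [show δ * v * (S.c (X : K)) * (Y : K) = δ * v * ((Y : K) * S.c (X : K)) by ring])
      refine ⟨⟨_, h2⟩, ?_⟩
      change v * S.c (X : K) = algebraMap L K α * (W * (p * (δ * v * S.c (X : K)) / (1 - S.ζ)))
      rw [← mul_assoc, mul_div_assoc', eq_div_iff hπ0, ← hδ]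
      ring
    have h2 : ∀ m ∈ I * I.map (phi S.c), ∃ U ∈ I, v * (m : K) = algebraMap L K α * (W * (U : K)) := by
      intro m hm
      induction hm using Submodule.mul_induction_on' with
      | mem_mul_mem a ha b hb =>
        obtain ⟨b', hb', rfl⟩ := (Ideal.mem_map_iff_of_surjective (phi S.c) (phi S.c).surjective).1 hb
        obtain ⟨Z, hZ⟩ := h1 b' hb'
        refine ⟨Z * a, I.mul_mem_left _ ha, ?_⟩
        have e : ((a * phi S.c b' : 𝓞 K) : K) = a * S.c (b' : K) := map_mul (algebraMap (𝓞 K) K) _ _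
        have e2 : ((Z * a : 𝓞 K) : K) = Z * a := map_mul (algebraMap (𝓞 K) K) _ _
        rw [e, e2]
        linear_combination (a : K) * hZ
      | add a ha b hb iha ihb =>
        obtain ⟨U, hU, hU'⟩ := iha
        obtain ⟨V, hV, hV'⟩ := ihb
        refine ⟨U + V, I.add_mem hU hV, ?_⟩
        have e : ((a + b : 𝓞 K) : K) = a + b := map_add (algebraMap (𝓞 K) K) _ _
        have e2 : ((U + V : 𝓞 K) : K) = U + V := map_add (algebraMap (𝓞 K) K) _ _
        rw [e, e2]
        linear_combination hU' + hV'
    obtain ⟨U, hU, hU'⟩ := h2 W (by rw [hI]; exact Ideal.mem_span_singleton_self W)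
    refine ⟨U, hU, ?_⟩
    apply mul_right_cancel₀ hW0
    linear_combination hU'
  · rintro ⟨U, hU, rfl⟩ X hX
    have h1 : U * phi S.c X ∈ Ideal.span {W} := by
      rw [← hI]
      exact Ideal.mul_mem_mul hU (Ideal.mem_map_of_mem _ hX)
    obtain ⟨Z, hZ⟩ := Ideal.mem_span_singleton.1 h1
    have hZ' : (U : K) * S.c (X : K) = W * Z := by
      have := congrArg (algebraMap (𝓞 K) K) hZ
      rw [map_mul, map_mul] at this
      exact this
    have h2 := (S.trace_dual (δ * algebraMap L K α * W * Z)).2 (by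
      have e : (p : K) * (δ * algebraMap L K α * W * Z) / (1 - S.ζ) = Z := by
        rw [div_eq_iff hπ0, ← hδ]; ring
      rw [e]
      exact RingOfIntegers.isIntegral_coe Z) 1 isIntegral_one
    rw [H]
    rwa [show δ * (algebraMap L K α * (U : K)) * S.c (X : K) = δ * algebraMap L K α * W * Z * 1 by
      linear_combination δ * algebraMap L K α * hZ']

lemma H_herm (δ : K) (hcδ : S.c δ = δ) (x y : K) : S.H δ y x = conj (S.H δ x y) := by
  rw [H, H, S.conj_trace_c, map_mul S.c, map_mul S.c, hcδ, S.ccx]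
  congr 1
  ring

lemma H_val (δ : K) (s : K →+* ℂ) (y : ℕ → ℝ) (hy : ∀ i, s ((S.g ^ i) δ) = y i) (x : K) (q : ℚ)
    (hq : S.H δ x x = algebraMap ℚ L q) :
    (q : ℝ) = ∑ i ∈ Finset.range (p - 1), y i * Complex.normSq (s ((S.g ^ i) x)) := by
  have h1 := congrArg (algebraMap L K) hq
  rw [H, S.trace_eq] at h1
  have h2 := congrArg s h1
  have e : s (algebraMap L K (algebraMap ℚ L q)) = (q : ℂ) := by simp
  rw [e, map_sum] at h2
  have h3 : ((q : ℝ) : ℂ) = ((∑ i ∈ Finset.range (p - 1), y i * Complex.normSq (s ((S.g ^ i) x)) : ℝ) : ℂ) := by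
    rw [Complex.ofReal_ratCast, ← h2]
    push_cast
    apply Finset.sum_congr rfl
    intro i _
    rw [map_mul, map_mul, S.gpowc, map_mul, map_mul, hy, S.emb_c, mul_assoc, Complex.mul_conj]
  exact_mod_cast h3

lemma H_rat (δ : K) (hcδ : S.c δ = δ) (x : K) : ∃ q : ℚ, S.H δ x x = algebraMap ℚ L q :=
  S.conj_rat _ (S.H_herm δ hcδ x x).symm

lemma H_pos (δ : K) (hcδ : S.c δ = δ) (s : K →+* ℂ) (y : ℕ → ℝ) (hy0 : ∀ i, 0 < y i) (hy : ∀ i, s ((S.g ^ i) δ) = y i)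
    (x : K) (hx : x ≠ 0) : ∃ q : ℚ, 0 < q ∧ S.H δ x x = algebraMap ℚ L q := by
  obtain ⟨q, hq⟩ := S.H_rat δ hcδ x
  refine ⟨q, ?_, hq⟩
  have h1 := S.H_val δ s y hy x q hq
  have h2 : (0 : ℝ) < q := by
    rw [h1]
    apply Finset.sum_pos
    · intro i _
      apply mul_pos (hy0 i)
      rw [Complex.normSq_pos]
      exact (map_ne_zero s).2 ((map_ne_zero (S.g ^ i)).2 hx)
    · have := S.p_pos1
      exact ⟨0, Finset.mem_range.2 this⟩
  exact_mod_cast h2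

lemma gpow_mod (i : ℕ) (x : K) : (S.g ^ i) x = (S.g ^ (i % (p - 1))) x := by
  conv_lhs => rw [← Nat.div_add_mod i (p - 1), pow_add, pow_mul, S.gpow_card, one_pow, one_mul]

lemma emb_norm (s φ : K →+* ℂ) (x : K) : ∃ i < p - 1, ‖φ x‖ = ‖s ((S.g ^ i) x)‖ := by
  have := S.galQ
  obtain ⟨γ, hγ⟩ := NumberField.ComplexEmbedding.exists_comp_symm_eq_of_comp_eq (k := ℚ) s φ (RingHom.ext_rat _ _)
  obtain ⟨γ', hγ'⟩ : ∃ γ', γ' = γ.symm := ⟨_, rfl⟩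
  have h1 : φ x = s (γ' x) := by rw [← hγ, hγ']; rfl
  obtain ⟨i, hi, h | h⟩ := S.aut_cases γ'
  · exact ⟨i, hi, by rw [h1, h]⟩
  · refine ⟨(i + (p - 1) / 2) % (p - 1), Nat.mod_lt _ S.p_pos1, ?_⟩
    rw [h1, h, ← S.gpow_mod, AlgEquiv.mul_apply, S.τ_eq, Setup.h, ← AlgEquiv.mul_apply, ← pow_add, S.gpowc, S.emb_c]
    exact RCLike.norm_conj _

lemma H_fin (δ : K) (hcδ : S.c δ = δ) (s : K →+* ℂ) (y : ℕ → ℝ) (hy0 : ∀ i, 0 < y i) (hy : ∀ i, s ((S.g ^ i) δ) = y i)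
    (a : L) : {x : K | IsIntegral ℤ x ∧ S.H δ x x = a}.Finite := by
  by_cases ha : ∃ q : ℚ, a = algebraMap ℚ L q
  · obtain ⟨q, rfl⟩ := ha
    apply (NumberField.Embeddings.finite_of_norm_le K ℂ (∑ i ∈ Finset.range (p - 1), (q / y i + 1))).subset
    rintro x ⟨hx, hxq⟩
    refine ⟨hx, fun φ => ?_⟩
    obtain ⟨i, hi, hφ⟩ := S.emb_norm s φ x
    have h1 := S.H_val δ s y hy x q hxq
    have hq0 : (0 : ℝ) ≤ q := by
      rw [h1]
      exact Finset.sum_nonneg fun i _ => mul_nonneg (hy0 i).le (Complex.normSq_nonneg _)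
    have h2 : y i * Complex.normSq (s ((S.g ^ i) x)) ≤ q := by
      rw [h1]
      exact Finset.single_le_sum (f := fun i => y i * Complex.normSq (s ((S.g ^ i) x)))
        (fun i _ => mul_nonneg (hy0 i).le (Complex.normSq_nonneg _)) (Finset.mem_range.2 hi)
    have h3 : Complex.normSq (s ((S.g ^ i) x)) ≤ q / y i := by
      rw [le_div_iff₀ (hy0 i), mul_comm]; exact h2
    rw [Complex.normSq_eq_norm_sq, ← hφ] at h3
    have h4 : ‖φ x‖ ≤ q / y i + 1 := by
      nlinarith [sq_nonneg (‖φ x‖ - 1), norm_nonneg (φ x)]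
    refine h4.trans ?_
    exact Finset.single_le_sum (f := fun i => (q : ℝ) / y i + 1)
        (fun i _ => by have := hy0 i; positivity) (Finset.mem_range.2 hi)
  · convert Set.finite_empty
    ext x
    simp only [Set.mem_ofPred_eq, Set.mem_empty_iff_false, iff_false]
    rintro ⟨_, hx⟩
    obtain ⟨q, hq⟩ := S.H_rat δ hcδ x
    exact ha ⟨q, by rw [← hx, hq]⟩

end Setup

namespace Setup
variable {p ℓ : ℕ} {L K : Type} [Field L] [NumberField L] [Field K] [NumberField K] [Algebra L K]
    {conj : L ≃ₐ[ℚ] L} {α : L} (S : Setup p ℓ L K conj α)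

omit [NumberField K] in
lemma coe_int (X : 𝓞 K) : IsIntegral ℤ (X : K) := RingOfIntegers.isIntegral_coe X

/-- coordinates -/
noncomputable def e : (Fin (p - 1) → L) ≃ₗ[L] K :=
  (S.pb.basis.reindex (finCongr S.pbd)).equivFun.symm

/-- the lattice -/
noncomputable def lat (I : Ideal (𝓞 K)) : Submodule (𝓞 L) (Fin (p - 1) → L) where
  carrier := {v | ∃ X ∈ I, (X : K) = S.e v}
  add_mem' := by
    rintro v w ⟨X, hX, hv⟩ ⟨Y, hY, hw⟩
    refine ⟨X + Y, I.add_mem hX hY, ?_⟩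
    rw [map_add, ← hv, ← hw]
    exact map_add (algebraMap (𝓞 K) K) _ _
  zero_mem' := ⟨0, I.zero_mem, by rw [map_zero]; rfl⟩
  smul_mem' := by
    rintro a v ⟨X, hX, hv⟩
    obtain ⟨Z, hZ⟩ : ∃ X : 𝓞 K, (X : K) = algebraMap L K (a : L) :=
      ⟨⟨_, (intL (K := K)).2 (coe_int a)⟩, rfl⟩
    refine ⟨Z * X, I.mul_mem_left _ hX, ?_⟩
    have h1 : a • v = (a : L) • v := rfl
    rw [h1, map_smul, Algebra.smul_def, ← hZ, ← hv]
    exact map_mul (algebraMap (𝓞 K) K) _ _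

lemma mem_lat (I : Ideal (𝓞 K)) (v : Fin (p - 1) → L) : v ∈ S.lat I ↔ ∃ X ∈ I, (X : K) = S.e v := Iff.rfl

lemma lat_mul (I : Ideal (𝓞 K)) (z : K) (hz : IsIntegral ℤ z) (v : Fin (p - 1) → L) (hv : v ∈ S.lat I) :
    S.e.symm (z * S.e v) ∈ S.lat I := by
  obtain ⟨X, hX, hv⟩ := hv
  obtain ⟨Z, rfl⟩ : ∃ X : 𝓞 K, (X : K) = z := ⟨⟨z, hz⟩, rfl⟩
  refine ⟨Z * X, I.mul_mem_left _ hX, ?_⟩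
  rw [LinearEquiv.apply_symm_apply, ← hv]
  exact map_mul (algebraMap (𝓞 K) K) _ _

/-- multiplication by ζ -/
noncomputable def sig (I : Ideal (𝓞 K)) : S.lat I ≃ₗ[𝓞 L] S.lat I where
  toFun v := ⟨S.e.symm (S.ζ * S.e v), S.lat_mul I _ S.intζ _ v.2⟩
  invFun v := ⟨S.e.symm (S.ζ⁻¹ * S.e v), S.lat_mul I _ S.intζi _ v.2⟩
  map_add' v w := by
    apply Subtype.ext
    change S.e.symm (S.ζ * S.e ((v : Fin (p - 1) → L) + w)) = S.e.symm _ + S.e.symm _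
    rw [map_add, mul_add, map_add]
  map_smul' a v := by
    apply Subtype.ext
    change S.e.symm (S.ζ * S.e ((a : L) • (v : Fin (p - 1) → L))) = (a : L) • S.e.symm (S.ζ * S.e v)
    rw [map_smul, mul_smul_comm, map_smul]
  left_inv v := by
    apply Subtype.ext
    change S.e.symm (S.ζ⁻¹ * S.e (S.e.symm (S.ζ * S.e v))) = v
    rw [LinearEquiv.apply_symm_apply, inv_mul_cancel_left₀ S.ζ0, LinearEquiv.symm_apply_apply]
  right_inv v := by
    apply Subtype.ext
    change S.e.symm (S.ζ * S.e (S.e.symm (S.ζ⁻¹ * S.e v))) = v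
    rw [LinearEquiv.apply_symm_apply, mul_inv_cancel_left₀ S.ζ0, LinearEquiv.symm_apply_apply]

lemma e_sig (I : Ideal (𝓞 K)) (x : S.lat I) : S.e (S.sig I x : Fin (p - 1) → L) = S.ζ * S.e x :=
  S.e.apply_symm_apply _

lemma e_sig_pow (I : Ideal (𝓞 K)) (k : ℕ) (x : S.lat I) :
    S.e ((S.sig I ^ k) x : Fin (p - 1) → L) = S.ζ ^ k * S.e x := by
  induction k generalizing x with
  | zero => rw [pow_zero, pow_zero, one_mul]; rfl
  | succ k ih =>
    rw [pow_succ, pow_succ, mul_assoc, ← S.e_sig I x]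
    exact ih (S.sig I x)

lemma sig_pow (I : Ideal (𝓞 K)) : S.sig I ^ p = 1 := by
  apply LinearEquiv.ext
  intro x
  apply Subtype.ext
  apply S.e.injective
  rw [S.e_sig_pow, S.hζ.pow_eq_one, one_mul]; rfl

lemma sig_fix (I : Ideal (𝓞 K)) (x : S.lat I) (h : S.sig I x = x) : x = 0 := by
  have h1 := S.e_sig I x
  rw [h] at h1
  have h2 : (1 - S.ζ) * S.e (x : Fin (p - 1) → L) = 0 := by linear_combination h1
  rcases mul_eq_zero.1 h2 with h3 | h3
  · exact absurd h3 S.pi0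
  · apply Subtype.ext
    exact S.e.map_eq_zero_iff.1 h3

lemma sig_order (I : Ideal (𝓞 K)) (W : 𝓞 K) (hW : W ≠ 0) (hWI : W ∈ I) : orderOf (S.sig I) = p := by
  have : Fact p.Prime := ⟨S.hp⟩
  apply orderOf_eq_prime (S.sig_pow I)
  intro h
  have hm : S.e.symm (W : K) ∈ S.lat I := ⟨W, hWI, (S.e.apply_symm_apply _).symm⟩
  have h1 := S.sig_fix I ⟨_, hm⟩ (by rw [h]; rfl)
  have h2 : S.e.symm (W : K) = 0 := congrArg Subtype.val h1
  rw [LinearEquiv.map_eq_zero_iff] at h2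
  exact hW (by simpa using h2)

lemma lat_fg (I : Ideal (𝓞 K)) : (S.lat I).FG := by
  apply Submodule.FG.of_restrictScalars ℤ
  have h1 : (I.restrictScalars ℤ).FG := IsNoetherian.noetherian _
  let F : 𝓞 K →ₗ[ℤ] (Fin (p - 1) → L) :=
    ((S.e.symm : K →+ (Fin (p - 1) → L)).comp ((algebraMap (𝓞 K) K : 𝓞 K →+* K) : 𝓞 K →+ K)).toIntLinearMap
  have h2 : (S.lat I).restrictScalars ℤ = (I.restrictScalars ℤ).map F := by
    ext v
    rw [Submodule.restrictScalars_mem, mem_lat, Submodule.mem_map]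
    constructor
    · rintro ⟨X, hX, h⟩
      refine ⟨X, hX, ?_⟩
      change S.e.symm (X : K) = v
      rw [h, LinearEquiv.symm_apply_apply]
    · rintro ⟨X, hX, h⟩
      refine ⟨X, hX, ?_⟩
      rw [← h]
      exact (S.e.apply_symm_apply _).symm
  rw [h2]
  exact h1.map F

lemma lat_span (I : Ideal (𝓞 K)) (W : 𝓞 K) (hW : W ≠ 0) (hWI : W ∈ I) :
    Submodule.span L (S.lat I : Set (Fin (p - 1) → L)) = ⊤ := by
  rw [eq_top_iff]
  rintro v -
  have hW0 : (W : K) ≠ 0 := by simpa using hW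
  obtain ⟨M, hM, hMi⟩ := exists_nat_mul (S.e v / W)
  have hM0 : (M : L) ≠ 0 := by exact_mod_cast hM.ne'
  have h1 : (M : L) • v ∈ S.lat I := by
    obtain ⟨Z, hZ⟩ : ∃ X : 𝓞 K, (X : K) = M * (S.e v / W) := ⟨⟨_, hMi⟩, rfl⟩
    refine ⟨Z * W, I.mul_mem_left _ hWI, ?_⟩
    have e2 : ((Z * W : 𝓞 K) : K) = Z * W := map_mul (algebraMap (𝓞 K) K) _ _
    rw [e2, hZ, map_smul, Algebra.smul_def, map_natCast, mul_assoc, div_mul_cancel₀ _ hW0]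
  have h2 : v = (M : L)⁻¹ • ((M : L) • v) := by rw [smul_smul, inv_mul_cancel₀ hM0, one_smul]
  rw [h2]
  exact Submodule.smul_mem _ _ (Submodule.subset_span h1)

end Setup

lemma card_dvd_of_free {β : Type*} (p : ℕ) (hp : p.Prime) (X : Set β) (hX : X.Finite) (f : β → β)
    (hf : ∀ x ∈ X, f x ∈ X) (hfp : ∀ x, f^[p] x = x) (hfix : ∀ x ∈ X, f x ≠ x) : p ∣ X.ncard := by
  classical
  have : Fact p.Prime := ⟨hp⟩
  have := hX.fintype
  let F : Function.End X := fun x => ⟨f x, hf x x.2⟩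
  have hFi : ∀ (k : ℕ) (x : X), (((F ^ k : Function.End X) x : X) : β) = f^[k] x := by
    intro k
    induction k with
    | zero => intro x; rfl
    | succ k ih =>
      intro x
      rw [pow_succ, Function.iterate_succ_apply]
      exact ih (F x)
  have h1 := Equiv.Perm.card_fixedPoints_modEq (f := F) (p := p) (n := 1) (by
    funext x
    apply Subtype.ext
    rw [pow_one, hFi, hfp]; rfl)
  have h2 : Fintype.card (Function.fixedPoints F) = 0 := by
    rw [Fintype.card_eq_zero_iff]
    refine ⟨fun x => ?_⟩
    exact hfix x.1 x.1.2 (congrArg Subtype.val x.2)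
  rw [h2] at h1
  rw [Set.ncard_eq_toFinset_card', Set.toFinset_card]
  exact (Nat.modEq_zero_iff_dvd).1 h1



/-- There exists a Hermitian `O_L`-lattice `Λ_h` of rank `p-1`
(realized inside `V = L^{p-1}`) with `Λ_h^* = (O_L^*)⁻¹ Λ_h`, admitting an `O_L`-linear
isometry of order `p` fixing only `0`, such that all representation numbers `R_A` for
nonzero Hermitian `A ∈ L^{n×n}` are divisible by `p`. -/
theorem exists_hermitian_lattice_theta_congruence (ℓ : ℕ) (hℓpos : 0 < ℓ)
    (hfund : (ℓ % 4 = 3 ∧ Squarefree ℓ) ∨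
      ∃ m : ℕ, ℓ = 4 * m ∧ Squarefree m ∧ (m % 4 = 1 ∨ m % 4 = 2))
    (p : ℕ) (hp : p.Prime) (hp1 : p % 4 = 1) (hpℓ : ¬ p ∣ ℓ)
    (L : Type) [Field L] [NumberField L]
    (α : L) (hα : α ^ 2 = -(ℓ : L)) (hdim : Module.finrank ℚ L = 2)
    (conj : L ≃ₐ[ℚ] L) (hconjα : conj α = -α) :
    ∃ (h : (Fin (p - 1) → L) → (Fin (p - 1) → L) → L)
      (Λ : Submodule (𝓞 L) (Fin (p - 1) → L)) (σ : Λ ≃ₗ[𝓞 L] Λ),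
      (∀ x y z, h (x + y) z = h x z + h y z) ∧
      (∀ (a : L) (x y), h (a • x) y = a * h x y) ∧
      (∀ x y, h y x = conj (h x y)) ∧
      (∀ x, x ≠ 0 → ∃ r : ℚ, 0 < r ∧ h x x = algebraMap ℚ L r) ∧
      Λ.FG ∧ Submodule.span L (Λ : Set (Fin (p - 1) → L)) = ⊤ ∧
      ({v | ∀ x ∈ Λ, ∃ c : 𝓞 L, h v x = (c : L)} =
        {v | ∃ w ∈ Λ, v = α • w}) ∧
      orderOf σ = p ∧
      (∀ x y : Λ, h (σ x) (σ y) = h x y) ∧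
      (∀ x : Λ, σ x = x → x = 0) ∧
      (∀ (n : ℕ), 1 ≤ n → ∀ A : Matrix (Fin n) (Fin n) L, A ≠ 0 →
        (∀ i j, A j i = conj (A i j)) →
        {x : Fin n → Λ | ∀ i j, h (x i) (x j) = A i j}.Finite ∧
        p ∣ Set.ncard {x : Fin n → Λ | ∀ i j, h (x i) (x j) = A i j}) := by
  obtain ⟨K, _, _, _, ⟨S⟩⟩ := exists_setup ℓ hℓpos p hp hp1 hpℓ L α hα hdim conj hconjα
  obtain ⟨s⟩ : Nonempty (K →+* ℂ) := inferInstance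
  obtain ⟨I, δ, W, hW, hδ0, hcδ, hpos, hI, hδ⟩ := S.main_ideal hfund s
  choose y hy0 hy using hpos
  have hWI : W ∈ I := by
    have : Ideal.span {W} ≤ I := Ideal.dvd_iff_le.1 (Dvd.intro _ hI)
    exact this (Ideal.mem_span_singleton_self W)
  have hHζ : ∀ u v : K, S.H δ (S.ζ * u) (S.ζ * v) = S.H δ u v := by
    intro u v
    rw [Setup.H, Setup.H, map_mul S.c, S.cζ]
    congr 1
    have := S.ζ0
    field_simp
  have hiso : ∀ x y : S.lat I, S.H δ (S.e (S.sig I x)) (S.e (S.sig I y)) = S.H δ (S.e x) (S.e y) := by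
    intro x y
    rw [S.e_sig, S.e_sig, hHζ]
  refine ⟨fun x y => S.H δ (S.e x) (S.e y), S.lat I, S.sig I, ?_, ?_, ?_, ?_, S.lat_fg I, S.lat_span I W hW hWI, ?_,
    S.sig_order I W hW hWI, hiso, S.sig_fix I, ?_⟩
  · intro x y z
    change S.H δ (S.e (x + y)) (S.e z) = _
    rw [map_add, Setup.H, mul_add, add_mul, map_add]; rfl
  · intro a x y
    change S.H δ (S.e (a • x)) (S.e y) = _
    rw [map_smul, Setup.H, mul_smul_comm, smul_mul_assoc, map_smul]; rfl
  · intro x y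
    exact S.H_herm δ hcδ _ _
  · intro x hx
    exact S.H_pos δ hcδ s y hy0 hy _ (S.e.map_ne_zero_iff.2 hx)
  · ext v
    rw [Set.mem_ofPred_eq, Set.mem_ofPred_eq]
    have h1 := S.H_dual I δ W hW hI hδ (S.e v)
    constructor
    · intro h
      obtain ⟨U, hU, hv⟩ := h1.1 (by
        intro X hX
        obtain ⟨c, hc⟩ := h (S.e.symm (X : K)) ⟨X, hX, (S.e.apply_symm_apply _).symm⟩
        change S.H δ (S.e v) (S.e (S.e.symm (X : K))) = c at hc
        rw [LinearEquiv.apply_symm_apply] at hc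
        rw [hc]
        exact Setup.coe_int c)
      refine ⟨S.e.symm (U : K), ⟨U, hU, (S.e.apply_symm_apply _).symm⟩, ?_⟩
      apply S.e.injective
      rw [map_smul, LinearEquiv.apply_symm_apply, hv, Algebra.smul_def]
    · rintro ⟨w, ⟨U, hU, hw⟩, rfl⟩ x ⟨X, hX, hx⟩
      have h2 := h1.2 ⟨U, hU, by rw [map_smul, Algebra.smul_def, hw]⟩ X hX
      rw [hx] at h2
      exact ⟨⟨_, h2⟩, rfl⟩
  · intro n hn A hA _
    have hfin : {x : Fin n → S.lat I | ∀ i j, S.H δ (S.e (x i)) (S.e (x j)) = A i j}.Finite := by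
      have hfi : ∀ i, {x : S.lat I | S.H δ (S.e x) (S.e x) = A i i}.Finite := by
        intro i
        apply Set.Finite.of_finite_image (f := fun x : S.lat I => S.e (x : Fin (p - 1) → L))
        · apply (S.H_fin δ hcδ s y hy0 hy (A i i)).subset
          rintro _ ⟨x, hx, rfl⟩
          refine ⟨?_, hx⟩
          obtain ⟨X, hX, h⟩ := x.2
          change IsIntegral ℤ (S.e (x : Fin (p - 1) → L))
          rw [← h]
          exact Setup.coe_int X
        · intro a _ b _ hab
          exact Subtype.ext (S.e.injective hab)
      apply (Set.Finite.pi' hfi).subset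
      intro x hx i
      exact hx i i
    refine ⟨hfin, ?_⟩
    apply card_dvd_of_free p hp _ hfin (fun x i => S.sig I (x i))
    · intro x hx i j
      exact (hiso (x i) (x j)).trans (hx i j)
    · intro x
      have h1 : ∀ (k : ℕ) (x : Fin n → S.lat I), (fun (x : Fin n → S.lat I) i => S.sig I (x i))^[k] x = fun i => (S.sig I ^ k) (x i) := by
        intro k
        induction k with
        | zero => intro x; rfl
        | succ k ih =>
          intro x
          rw [Function.iterate_succ_apply, ih, pow_succ]
          rfl
      rw [h1, S.sig_pow]
      rfl
    · intro x hx hxx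
      apply hA
      ext i j
      rw [← hx i j]
      have h0 : x i = 0 := S.sig_fix I (x i) (congrFun hxx i)
      change S.H δ (S.e (x i)) (S.e (x j)) = 0
      rw [h0]
      change S.H δ (S.e 0) (S.e (x j)) = 0
      rw [map_zero, Setup.H, mul_zero, zero_mul, map_zero]
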